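/- arXiv:1403.1629 — 3 statements merged into one kernel-verified Lean document; each statement's English description precedes it below -/
import Mathlib

section
/- For any Λ ∈ [0, ∞] (an extended real number) there exists a sequence (a_k)_{k≥1} of signs a_k ∈ {−1, 1} such that limsup_{N→∞} |∑_{k=1}^N a_k cos(2πkx)| / √(N log log N) = Λ for almost every real number x. -/
open MeasureTheory Filter Finset Real
open scoped ENNReal

/-- `e(y) = exp(2πiy)` -/
noncomputable def ee (y : ℝ) : ℂ := Complex.exp ((2 * π * y : ℝ) * Complex.I)

lemma ee_add (x y : ℝ) : ee (x + y) = ee x * ee y := by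
  unfold ee; rw [← Complex.exp_add]; congr 1; push_cast; ring

lemma ee_zero : ee 0 = 1 := by simp [ee]

lemma norm_ee (y : ℝ) : ‖ee y‖ = 1 := Complex.norm_exp_ofReal_mul_I _

lemma ee_re (y : ℝ) : (ee y).re = Real.cos (2 * π * y) := Complex.exp_ofReal_mul_I_re _

lemma ee_int (n : ℤ) : ee n = 1 := by
  unfold ee
  rw [Complex.exp_eq_one_iff]
  exact ⟨n, by push_cast; ring⟩

lemma ee_sub_one (y : ℝ) : ‖ee y - 1‖ ≤ 2 * π * |y| := by
  have h := Real.norm_exp_I_mul_ofReal_sub_one_le (x := 2 * π * y)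
  have : ‖(2 * π * y : ℝ)‖ = 2 * π * |y| := by
    rw [Real.norm_eq_abs, abs_mul, abs_of_pos (by positivity)]
  rw [this] at h
  unfold ee
  rwa [mul_comm]

lemma ee_lip (x y : ℝ) : ‖ee x - ee y‖ ≤ 2 * π * |x - y| := by
  have : ee x - ee y = ee y * (ee (x - y) - 1) := by
    rw [mul_sub, ← ee_add]; simp
  rw [this, norm_mul, norm_ee, one_mul]
  exact ee_sub_one _

lemma ee_natmul (r : ℕ) (y : ℝ) : ee (r * y) = ee y ^ r := by
  unfold ee; rw [← Complex.exp_nat_mul]; congr 1; push_cast; ring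

/-- partial sums -/
noncomputable def ps (b : ℕ → ℝ) (N : ℕ) (x : ℝ) : ℂ := ∑ k ∈ range N, (b k : ℂ) * ee (k * x)

/-- shift of a sequence by g -/
noncomputable def sh (g : ℕ) (c : ℕ → ℝ) : ℕ → ℝ := fun k => if g ≤ k then c (k - g) else 0

lemma ps_add (b c : ℕ → ℝ) (N x) : ps (fun k => b k + c k) N x = ps b N x + ps c N x := by
  unfold ps; rw [← sum_add_distrib]; refine sum_congr rfl fun k _ => ?_; push_cast; ring

lemma ps_sub (b c : ℕ → ℝ) (N x) : ps (fun k => b k - c k) N x = ps b N x - ps c N x := by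
  unfold ps; rw [← sum_sub_distrib]; refine sum_congr rfl fun k _ => ?_; push_cast; ring

lemma ps_sh (g : ℕ) (c : ℕ → ℝ) (N : ℕ) (x : ℝ) :
    ps (sh g c) N x = ee (g * x) * ps c (N - g) x := by
  induction N with
  | zero => simp [ps]
  | succ N ih =>
    have h1 : ps (sh g c) (N+1) x = ps (sh g c) N x + (sh g c N : ℂ) * ee (N * x) := by
      unfold ps; rw [sum_range_succ]
    rw [h1, ih]
    by_cases h : g ≤ N
    · have h2 : N + 1 - g = (N - g) + 1 := by omega
      rw [h2]
      have h3 : ps c (N - g + 1) x = ps c (N - g) x + (c (N - g) : ℂ) * ee ((N - g : ℕ) * x) := by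
        unfold ps; rw [sum_range_succ]
      have h4 : ee (N * x) = ee (g * x) * ee ((N - g : ℕ) * x) := by
        rw [← ee_add]; congr 1; push_cast [Nat.cast_sub h]; ring
      rw [h3, h4]; simp only [sh, if_pos h]; ring
    · have h2 : N + 1 - g = 0 := by omega
      have h3 : N - g = 0 := by omega
      rw [h2, h3]; simp [sh, h]

lemma ps_eq_of_zero (c : ℕ → ℝ) {M N : ℕ} (hMN : M ≤ N) (x : ℝ) (h : ∀ k, M ≤ k → c k = 0) :
    ps c N x = ps c M x := by
  unfold ps
  symm
  apply sum_subset (range_mono hMN)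
  intro k _ hk
  simp only [mem_range, not_lt] at hk
  simp [h k hk]

/-! Golay -/
noncomputable def gol (g : ℕ → ℕ) : ℕ → (ℕ → ℝ) × (ℕ → ℝ)
  | 0 => (fun k => if k = 0 then 1 else 0, fun k => if k = 0 then 1 else 0)
  | i + 1 => (fun k => (gol g i).1 k + sh (g i) (gol g i).2 k,
              fun k => (gol g i).1 k - sh (g i) (gol g i).2 k)

noncomputable def gpq (g : ℕ → ℕ) (x : ℝ) : ℕ → ℂ × ℂ
  | 0 => (1, 1)
  | i + 1 => ((gpq g x i).1 + ee (g i * x) * (gpq g x i).2,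
              (gpq g x i).1 - ee (g i * x) * (gpq g x i).2)

def Gap (g : ℕ → ℕ) : Prop := 1 ≤ g 0 ∧ ∀ i, 2 * g i ≤ g (i + 1)

lemma gol_supp {g : ℕ → ℕ} (hg : Gap g) (i : ℕ) : ∀ k, g i ≤ k →
    (gol g i).1 k = 0 ∧ (gol g i).2 k = 0 := by
  induction i with
  | zero =>
    intro k hk
    have : k ≠ 0 := by have := hg.1; omega
    simp [gol, this]
  | succ i ih =>
    intro k hk
    have h2 := hg.2 i
    have h3 := ih k (by omega)
    have h4 := ih (k - g i) (by omega)
    have h5 : g i ≤ k := by omega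
    simp [gol, sh, h3, h4]

lemma gol_abs {g : ℕ → ℕ} (hg : Gap g) (i : ℕ) (k : ℕ) :
    (|(gol g i).1 k| = 0 ∨ |(gol g i).1 k| = 1) ∧ |(gol g i).2 k| = |(gol g i).1 k| := by
  induction i generalizing k with
  | zero => by_cases h : k = 0 <;> simp [gol, h]
  | succ i ih =>
    by_cases h : g i ≤ k
    · have h1 := gol_supp hg i k h
      have h2 := ih (k - g i)
      simp only [gol, sh, if_pos h, h1.1, zero_add, zero_sub, abs_neg, h2.2]
      exact ⟨h2.1, trivial⟩
    · simp only [gol, sh, if_neg h, add_zero, sub_zero]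
      exact ⟨(ih k).1, trivial⟩

lemma gol_abs_succ {g : ℕ → ℕ} (hg : Gap g) (i : ℕ) :
    (fun k => |(gol g (i+1)).1 k|) = fun k => |(gol g i).1 k| + sh (g i) (fun k => |(gol g i).1 k|) k := by
  funext k
  by_cases h : g i ≤ k
  · have h1 := gol_supp hg i k h
    simp [gol, sh, if_pos h, h1.1, (gol_abs hg i (k - g i)).2]
  · simp [gol, sh, if_neg h]

lemma gol_full {g : ℕ → ℕ} (hg : Gap g) (x : ℝ) (i : ℕ) : ∀ N, g i ≤ N →
    ps (gol g i).1 N x = (gpq g x i).1 ∧ ps (gol g i).2 N x = (gpq g x i).2 := by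
  induction i with
  | zero =>
    intro N hN
    have h1 : 1 ≤ N := hg.1.trans hN
    have : ∀ c : ℕ → ℝ, c = (fun k => if k = 0 then 1 else 0) → ps c N x = 1 := by
      intro c hc
      rw [ps_eq_of_zero c h1 x (by intro k hk; rw [hc]; simp; omega)]
      simp [ps, hc, ee_zero]
    exact ⟨this _ rfl, this _ rfl⟩
  | succ i ih =>
    intro N hN
    have h2 := hg.2 i
    have h3 := ih N (by omega)
    have h4 := ih (N - g i) (by omega)
    simp only [gol, gpq, ps_add, ps_sub, ps_sh, h3.1, h4.2]
    trivial

lemma gpq_sq (g : ℕ → ℕ) (x : ℝ) (i : ℕ) :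
    ‖(gpq g x i).1‖ ^ 2 + ‖(gpq g x i).2‖ ^ 2 = 2 ^ (i + 1) := by
  induction i with
  | zero => simp [gpq]; norm_num
  | succ i ih =>
    have h := parallelogram_law_with_norm ℝ (gpq g x i).1 (ee (g i * x) * (gpq g x i).2)
    rw [norm_mul, norm_ee, one_mul] at h
    simp only [gpq]
    rw [pow_succ 2 (i+1)]
    linarith

lemma sq_sqrt2 (i : ℕ) : (√2 ^ i) ^ 2 = (2:ℝ) ^ i := by
  rw [← pow_mul, mul_comm, pow_mul, Real.sq_sqrt (by norm_num)]

lemma gpq_le (g : ℕ → ℕ) (x : ℝ) (i : ℕ) :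
    ‖(gpq g x i).1‖ ≤ √2 ^ (i + 1) ∧ ‖(gpq g x i).2‖ ≤ √2 ^ (i + 1) := by
  have h := gpq_sq g x i
  have h2 := sq_sqrt2 (i + 1)
  constructor
  · apply le_of_sq_le_sq _ (by positivity)
    nlinarith [sq_nonneg ‖(gpq g x i).2‖]
  · apply le_of_sq_le_sq _ (by positivity)
    nlinarith [sq_nonneg ‖(gpq g x i).1‖]

lemma sqrt2_gt : (1.4142:ℝ) < √2 := by
  rw [Real.lt_sqrt (by norm_num)]; norm_num
lemma sqrt2_lt : √2 < (1.4143:ℝ) := by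
  rw [Real.sqrt_lt' (by norm_num)]; norm_num

lemma gol_part {g : ℕ → ℕ} (hg : Gap g) (x : ℝ) (i : ℕ) : ∀ N,
    ‖ps (gol g i).1 N x‖ ≤ 4 * √2 ^ i ∧ ‖ps (gol g i).2 N x‖ ≤ 4 * √2 ^ i := by
  induction i with
  | zero =>
    intro N
    rcases Nat.eq_zero_or_pos N with h | h
    · subst h; simp [ps]
    · have : ∀ c : ℕ → ℝ, c = (fun k => if k = 0 then 1 else 0) → ps c N x = 1 := by
        intro c hc
        rw [ps_eq_of_zero c h x (by intro k hk; rw [hc]; simp; omega)]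
        simp [ps, hc, ee_zero]
      have h1 : ps (gol g 0).1 N x = 1 := this _ rfl
      have h2 : ps (gol g 0).2 N x = 1 := this _ rfl
      rw [h1, h2]; norm_num
  | succ i ih =>
    intro N
    have e1 : ps (gol g (i+1)).1 N x = ps (gol g i).1 N x + ee (g i * x) * ps (gol g i).2 (N - g i) x := by
      simp only [gol, ps_add, ps_sh]
    have e2 : ps (gol g (i+1)).2 N x = ps (gol g i).1 N x - ee (g i * x) * ps (gol g i).2 (N - g i) x := by
      simp only [gol, ps_sub, ps_sh]
    have hs : (0:ℝ) < √2 ^ i := by positivity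
    rw [e1, e2, pow_succ]
    by_cases h : g i ≤ N
    · have h1 := (gol_full hg x i N h).1
      have h2 := (gpq_le g x i).1
      have h3 := (ih (N - g i)).2
      rw [← h1] at h2
      rw [pow_succ] at h2
      have key : √2 ^ i * √2 + 4 * √2 ^ i ≤ 4 * (√2 ^ i * √2) := by nlinarith [sqrt2_gt]
      constructor
      · refine (norm_add_le _ _).trans ?_
        rw [norm_mul, norm_ee, one_mul]; linarith
      · refine (norm_sub_le _ _).trans ?_
        rw [norm_mul, norm_ee, one_mul]; linarith
    · have h0 : N - g i = 0 := by omega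
      have : ps (gol g i).2 0 x = 0 := by simp [ps]
      rw [h0, this, mul_zero, add_zero, sub_zero]
      have := (ih N).1
      have key : 4 * √2 ^ i ≤ 4 * (√2 ^ i * √2) := by nlinarith [sqrt2_gt]
      exact ⟨by linarith, by linarith⟩

lemma gpq_lip {g : ℕ → ℕ} (hg : Gap g) (x y : ℝ) (i : ℕ) :
    ‖(gpq g x (i+1)).1 - (gpq g y (i+1)).1‖ ≤ 22 * g i * √2 ^ (i+1) * |x - y| ∧
    ‖(gpq g x (i+1)).2 - (gpq g y (i+1)).2‖ ≤ 22 * g i * √2 ^ (i+1) * |x - y| := by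
  have step : ∀ i (D : ℝ), ‖(gpq g x i).1 - (gpq g y i).1‖ ≤ D → ‖(gpq g x i).2 - (gpq g y i).2‖ ≤ D →
      ‖(gpq g x (i+1)).1 - (gpq g y (i+1)).1‖ ≤ 2 * D + 2 * π * (g i * |x - y|) * √2 ^ (i+1) ∧
      ‖(gpq g x (i+1)).2 - (gpq g y (i+1)).2‖ ≤ 2 * D + 2 * π * (g i * |x - y|) * √2 ^ (i+1) := by
    intro i D h1 h2
    have h3 : ‖ee (g i * x) * (gpq g x i).2 - ee (g i * y) * (gpq g y i).2‖ ≤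
        D + 2 * π * (g i * |x - y|) * √2 ^ (i+1) := by
      have e : ee (g i * x) * (gpq g x i).2 - ee (g i * y) * (gpq g y i).2 =
        ee (g i * x) * ((gpq g x i).2 - (gpq g y i).2) + (ee (g i * x) - ee (g i * y)) * (gpq g y i).2 := by
        ring
      rw [e]
      refine (norm_add_le _ _).trans ?_
      rw [norm_mul, norm_mul, norm_ee, one_mul]
      have h4 := ee_lip (g i * x) (g i * y)
      rw [← mul_sub, abs_mul, Nat.abs_cast] at h4
      have h5 := (gpq_le g y i).2
      gcongr
    constructor
    · have e : (gpq g x (i+1)).1 - (gpq g y (i+1)).1 = ((gpq g x i).1 - (gpq g y i).1) +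
        (ee (g i * x) * (gpq g x i).2 - ee (g i * y) * (gpq g y i).2) := by simp only [gpq]; ring
      rw [e]; refine (norm_add_le _ _).trans ?_; linarith
    · have e : (gpq g x (i+1)).2 - (gpq g y (i+1)).2 = ((gpq g x i).1 - (gpq g y i).1) -
        (ee (g i * x) * (gpq g x i).2 - ee (g i * y) * (gpq g y i).2) := by simp only [gpq]; ring
      rw [e]; refine (norm_sub_le _ _).trans ?_; linarith
  have hpi := Real.pi_lt_d2
  induction i with
  | zero =>
    have h := step 0 0 (by simp [gpq]) (by simp [gpq])
    have : 2 * 0 + 2 * π * (g 0 * |x - y|) * √2 ^ (0+1) ≤ 22 * g 0 * √2 ^ (0+1) * |x - y| := by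
      have : 0 ≤ (g 0 * |x - y|) * √2 ^ (0+1) := by positivity
      nlinarith
    exact ⟨h.1.trans this, h.2.trans this⟩
  | succ i ih =>
    have h := step (i+1) _ ih.1 ih.2
    have h2 : (2 * g i : ℝ) ≤ g (i+1) := by exact_mod_cast hg.2 i
    have : 2 * (22 * g i * √2 ^ (i+1) * |x - y|) + 2 * π * (g (i+1) * |x - y|) * √2 ^ (i+1+1) ≤
        22 * g (i+1) * √2 ^ (i+1+1) * |x - y| := by
      have hA : 0 ≤ √2 ^ (i+1) * |x - y| := by positivity
      have hB : 0 ≤ g (i+1) * (√2 ^ (i+1) * |x - y|) := by positivity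
      have h3 : 2 * (22 * g i * √2 ^ (i+1) * |x - y|) ≤ 22 * (g (i+1) * (√2 ^ (i+1) * |x - y|)) := by
        nlinarith
      have h4 : 22 * (g (i+1) * (√2 ^ (i+1) * |x - y|)) ≤
          (22 - 2 * π) * √2 * (g (i+1) * (√2 ^ (i+1) * |x - y|)) := by
        apply mul_le_mul_of_nonneg_right _ hB
        nlinarith [sqrt2_gt]
      rw [pow_succ √2 (i+1)]
      nlinarith
    exact ⟨h.1.trans this, h.2.trans this⟩


noncomputable def rep (c : ℕ → ℝ) (L : ℕ) : ℕ → ℕ → ℝ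
  | 0 => fun _ => 0
  | R + 1 => fun j => rep c L R j + sh (R * L) c j

lemma rep_supp {c : ℕ → ℝ} {L : ℕ} (hc : ∀ k, L ≤ k → c k = 0) (R : ℕ) :
    ∀ j, R * L ≤ j → rep c L R j = 0 := by
  induction R with
  | zero => intro j _; rfl
  | succ R ih =>
    intro j hj
    rw [Nat.succ_mul] at hj
    have h1 : R * L ≤ j := by omega
    have h2 : L ≤ j - R * L := by omega
    simp [rep, ih j h1, sh, hc _ h2]

lemma rep_abs {c : ℕ → ℝ} {L : ℕ} (hc : ∀ k, L ≤ k → c k = 0) (hv : ∀ k, |c k| = 0 ∨ |c k| = 1)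
    (R : ℕ) (j : ℕ) : |rep c L R j| = rep (fun k => |c k|) L R j ∧
      (|rep c L R j| = 0 ∨ |rep c L R j| = 1) := by
  induction R with
  | zero => simp [rep]
  | succ R ih =>
    by_cases h : R * L ≤ j
    · have h1 := rep_supp hc R j h
      have h2 := rep_supp (c := fun k => |c k|) (L := L) (fun k hk => by simp [hc k hk]) R j h
      simp only [rep, h1, h2, sh, if_pos h, zero_add]
      exact ⟨trivial, hv _⟩
    · simp only [rep, sh, if_neg h, add_zero]
      exact ih

lemma rep_full {c : ℕ → ℝ} {L : ℕ} {x : ℝ} {F : ℂ} (hF : ∀ N, L ≤ N → ps c N x = F) (R : ℕ) :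
    ∀ N, R * L ≤ N → ps (rep c L R) N x = F * ∑ r ∈ range R, ee (r * (L * x)) := by
  induction R with
  | zero => intro N _; simp [rep, ps]
  | succ R ih =>
    intro N hN
    rw [Nat.succ_mul] at hN
    have h1 : R * L ≤ N := by omega
    have h2 : L ≤ N - R * L := by omega
    simp only [rep]
    rw [ps_add, ps_sh, ih N h1, hF _ h2, sum_range_succ]
    push_cast
    rw [mul_assoc (R:ℝ)]
    ring

lemma rep_part {c : ℕ → ℝ} {L : ℕ} {x : ℝ} {F : ℂ} (hF : ∀ N, L ≤ N → ps c N x = F) {M B : ℝ}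
    (hB0 : 0 ≤ B) (hM : ‖F‖ ≤ M) (hB : ∀ N, ‖ps c N x‖ ≤ B) (R : ℕ) :
    ∀ N, ‖ps (rep c L R) N x‖ ≤ R * M + B := by
  have hM0 : 0 ≤ M := (norm_nonneg _).trans hM
  induction R with
  | zero => intro N; simpa [rep, ps] using hB0
  | succ R ih =>
    intro N
    have e : ps (rep c L (R+1)) N x = ps (rep c L R) N x + ee ((R * L : ℕ) * x) * ps c (N - R * L) x := by
      simp only [rep]; rw [ps_add, ps_sh]
    rw [e]
    push_cast
    by_cases h : R * L ≤ N
    · refine (norm_add_le _ _).trans ?_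
      rw [norm_mul, norm_ee, one_mul, rep_full hF R N h, norm_mul]
      have h1 : ‖∑ r ∈ range R, ee (r * (L * x))‖ ≤ R := by
        refine (norm_sum_le _ _).trans ?_
        simp [norm_ee]
      have h2 : ‖F‖ * ‖∑ r ∈ range R, ee (r * (L * x))‖ ≤ M * R := by gcongr
      have := hB (N - R * L)
      linarith
    · have h0 : N - R * L = 0 := by omega
      have : ps c 0 x = 0 := by simp [ps]
      rw [h0, this, mul_zero, add_zero]
      have := ih N
      linarith

lemma rep_part' {c : ℕ → ℝ} {L : ℕ} {x : ℝ} {B : ℝ}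
    (hB : ∀ N, ‖ps c N x‖ ≤ B) (R : ℕ) :
    ∀ N, ‖ps (rep c L R) N x‖ ≤ R * B := by
  induction R with
  | zero => intro N; simp [rep, ps]
  | succ R ih =>
    intro N
    have e : ps (rep c L (R+1)) N x = ps (rep c L R) N x + ee ((R * L : ℕ) * x) * ps c (N - R * L) x := by
      simp only [rep]; rw [ps_add, ps_sh]
    rw [e]
    refine (norm_add_le _ _).trans ?_
    rw [norm_mul, norm_ee, one_mul]
    have := hB (N - R * L)
    have := ih N
    push_cast
    linarith

/-- gap sequence -/
def gg (m t i : ℕ) : ℕ := if i < m then 2 ^ i else 2 ^ (m + (i - m + 1) * t)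

lemma gg_gap (m t : ℕ) (ht : 1 ≤ t) : Gap (gg m t) := by
  constructor
  · unfold gg; split_ifs <;> exact Nat.one_le_two_pow
  · intro i
    unfold gg
    split_ifs with h1 h2 h3
    · rw [← pow_succ']
    · rw [← pow_succ']
      apply Nat.pow_le_pow_right (by norm_num)
      nlinarith
    · omega
    · rw [← pow_succ']
      apply Nat.pow_le_pow_right (by norm_num)
      have : i + 1 - m + 1 = (i - m + 1) + 1 := by omega
      rw [this, Nat.add_mul (i - m + 1) 1 t]
      omega

noncomputable def Cx (x : ℝ) : ℝ := 2 / ‖ee x - 1‖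

lemma Cx_nonneg (x : ℝ) : 0 ≤ Cx x := by unfold Cx; positivity

lemma ps_one {x : ℝ} (hx : ee x ≠ 1) (N : ℕ) : ‖ps (fun _ => 1) N x‖ ≤ Cx x := by
  have e : ps (fun _ => 1) N x = ∑ k ∈ range N, ee x ^ k := by
    unfold ps; refine sum_congr rfl fun k _ => ?_
    rw [ee_natmul]; simp
  rw [e, geom_sum_eq hx, norm_div]
  unfold Cx
  gcongr
  refine (norm_sub_le _ _).trans ?_
  rw [norm_pow, norm_ee]; norm_num

lemma gol_abs_low (m t : ℕ) (ht : 1 ≤ t) (i : ℕ) (hi : i ≤ m) (k : ℕ) :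
    |(gol (gg m t) i).1 k| = if k < 2 ^ i then 1 else 0 := by
  induction i generalizing k with
  | zero => by_cases h : k = 0 <;> simp [gol, h]
  | succ i ih =>
    have h := congrFun (gol_abs_succ (gg_gap m t ht) i) k
    rw [h, ih (by omega)]
    have hg : gg m t i = 2 ^ i := by simp [gg]; omega
    simp only [sh, hg, ih (by omega)]
    rw [pow_succ]
    split_ifs <;> first | omega | norm_num

lemma gol_abs_part (m t : ℕ) (ht : 1 ≤ t) {x : ℝ} (hx : ee x ≠ 1) (N : ℕ) :
    ‖ps (fun k => |(gol (gg m t) (m+2)).1 k|) N x‖ ≤ 4 * Cx x := by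
  have h0 : ∀ N, ‖ps (fun k => |(gol (gg m t) m).1 k|) N x‖ ≤ Cx x := by
    intro N
    have : ps (fun k => |(gol (gg m t) m).1 k|) N x = ps (fun _ => 1) (min N (2^m)) x := by
      unfold ps
      symm
      rw [← sum_subset (range_mono (min_le_left N (2^m)))
        (f := fun k : ℕ => ((|(gol (gg m t) m).1 k| : ℝ) : ℂ) * ee (k * x))]
      · refine sum_congr rfl fun k hk => ?_
        simp only [mem_range, lt_min_iff] at hk
        rw [gol_abs_low m t ht m le_rfl, if_pos hk.2]
      · intro k hk hk2
        simp only [mem_range, lt_min_iff, not_and, not_lt] at hk hk2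
        rw [gol_abs_low m t ht m le_rfl, if_neg (by have := hk2 hk; omega)]
        simp
    rw [this]; exact ps_one hx _
  have step : ∀ i (B : ℝ), (∀ N, ‖ps (fun k => |(gol (gg m t) i).1 k|) N x‖ ≤ B) →
      ∀ N, ‖ps (fun k => |(gol (gg m t) (i+1)).1 k|) N x‖ ≤ 2 * B := by
    intro i B h N
    rw [gol_abs_succ (gg_gap m t ht), ps_add, ps_sh]
    refine (norm_add_le _ _).trans ?_
    rw [norm_mul, norm_ee, one_mul]
    have := h N
    have := h (N - gg m t i)
    linarith
  have := step _ _ (step _ _ h0) N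
  linarith

/-! steering -/
lemma dig_exists (t : ℕ) (z : ℂ) : ∃ f : ℕ, f < 2 ^ t ∧
    ‖ee ((f:ℝ) / 2 ^ t) * z - ‖z‖‖ ≤ 2 * π * (1 / 2 ^ t) * ‖z‖ := by
  set α : ℝ := Int.fract (-(z.arg) / (2 * π)) with hα
  have hα0 : 0 ≤ α := Int.fract_nonneg _
  have hα1 : α < 1 := Int.fract_lt_one _
  have hp : (0:ℝ) < 2 ^ t := by positivity
  have hz : ee α * z = ‖z‖ := by
    have e1 : ee α = ee (-(z.arg) / (2 * π)) := by
      have : -(z.arg) / (2 * π) = α + (⌊-(z.arg) / (2 * π)⌋ : ℤ) := by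
        rw [hα]; exact (Int.fract_add_floor _).symm
      rw [this, ee_add, ee_int, mul_one]
    rw [e1]
    have : ee (-(z.arg) / (2 * π)) = Complex.exp (-(z.arg * Complex.I)) := by
      unfold ee; congr 1
      have : 2 * π * (-(z.arg) / (2 * π)) = -z.arg := by field_simp
      rw [this]; push_cast; ring
    have h3 : Complex.exp (-(z.arg * Complex.I)) * (‖z‖ * Complex.exp (z.arg * Complex.I)) = ‖z‖ := by
      rw [mul_left_comm, ← Complex.exp_add]; simp
    rwa [Complex.norm_mul_exp_arg_mul_I z, ← this] at h3
  refine ⟨⌊2 ^ t * α⌋₊, ?_, ?_⟩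
  · rw [Nat.floor_lt (by positivity)]
    push_cast
    nlinarith
  · rw [← hz, ← sub_mul, norm_mul]
    have hzz : ‖ee α * z‖ = ‖z‖ := by rw [norm_mul, norm_ee, one_mul]
    gcongr
    refine (ee_lip _ _).trans ?_
    gcongr
    have h1 := Nat.floor_le (show 0 ≤ 2 ^ t * α by positivity)
    have h2 := Nat.lt_floor_add_one (2 ^ t * α)
    rw [abs_le]
    constructor
    · rw [← sub_nonneg]
      have : (⌊2 ^ t * α⌋₊ : ℝ) / 2 ^ t - α - -(1 / 2 ^ t) = (⌊2 ^ t * α⌋₊ + 1 - 2 ^ t * α) / 2 ^ t := by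
        field_simp; ring
      rw [this]; apply div_nonneg <;> linarith
    · have : (⌊2 ^ t * α⌋₊ : ℝ) / 2 ^ t ≤ α := by rw [div_le_iff₀ hp]; linarith
      have : 0 < 1 / (2:ℝ) ^ t := by positivity
      linarith

noncomputable def dig (t : ℕ) (z : ℂ) : ℕ := (dig_exists t z).choose
lemma dig_lt (t z) : dig t z < 2 ^ t := (dig_exists t z).choose_spec.1
lemma dig_spec (t z) : ‖ee ((dig t z:ℝ) / 2 ^ t) * z - ‖z‖‖ ≤ 2 * π * (1 / 2 ^ t) * ‖z‖ :=
  (dig_exists t z).choose_spec.2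

/-- forced digits set -/
def WW (g b : ℕ) (f : ℤ → ℕ) : Set ℝ :=
  {x | ⌊(2:ℝ) ^ (g + b) * x⌋ = 2 ^ b * ⌊(2:ℝ) ^ g * x⌋ + f ⌊(2:ℝ) ^ g * x⌋}

/-- prefix point -/
noncomputable def pt (g : ℕ) (c : ℤ) : ℝ := c / 2 ^ g

lemma pt_close (g : ℕ) (x : ℝ) : |x - pt g ⌊(2:ℝ) ^ g * x⌋| ≤ 1 / 2 ^ g := by
  have h1 := Int.floor_le ((2:ℝ) ^ g * x)
  have h2 := Int.lt_floor_add_one ((2:ℝ) ^ g * x)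
  have hp : (0:ℝ) < 2 ^ g := by positivity
  have : x - pt g ⌊(2:ℝ) ^ g * x⌋ = (2 ^ g * x - ⌊(2:ℝ) ^ g * x⌋) / 2 ^ g := by
    unfold pt; field_simp
  rw [this, abs_div, abs_of_pos hp]
  gcongr
  rw [abs_le]; constructor <;> linarith

lemma WW_frac {g b : ℕ} {f : ℤ → ℕ} {x : ℝ} (hx : x ∈ WW g b f) :
    |2 ^ g * x - ⌊(2:ℝ) ^ g * x⌋ - (f ⌊(2:ℝ) ^ g * x⌋ : ℝ) / 2 ^ b| ≤ 1 / 2 ^ b := by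
  have hx' : ⌊(2:ℝ) ^ (g + b) * x⌋ = 2 ^ b * ⌊(2:ℝ) ^ g * x⌋ + f ⌊(2:ℝ) ^ g * x⌋ := hx
  have h1 := Int.floor_le ((2:ℝ) ^ (g + b) * x)
  have h2 := Int.lt_floor_add_one ((2:ℝ) ^ (g + b) * x)
  rw [hx'] at h1 h2
  push_cast at h1 h2
  have hp : (0:ℝ) < 2 ^ b := by positivity
  have : 2 ^ g * x - ⌊(2:ℝ) ^ g * x⌋ - (f ⌊(2:ℝ) ^ g * x⌋ : ℝ) / 2 ^ b =
     ((2:ℝ) ^ (g + b) * x - (2 ^ b * ⌊(2:ℝ) ^ g * x⌋ + f ⌊(2:ℝ) ^ g * x⌋)) / 2 ^ b := by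
    rw [pow_add]; field_simp; ring
  rw [this, abs_div, abs_of_pos hp]
  gcongr
  rw [abs_le]; constructor <;> linarith

lemma ee_sub_int (y : ℝ) (c : ℤ) : ee (y - c) = ee y := by
  have : ee y = ee (y - c) * ee c := by rw [← ee_add]; congr 1; ring
  rw [this, ee_int, mul_one]

lemma steer {g t : ℕ} {z : ℝ → ℂ} {x Z δ : ℝ}
    (hx : x ∈ WW g t (fun c => dig t (z (pt g c)))) (hZ : ∀ y, ‖z y‖ ≤ Z)
    (hδ : ∀ y, |x - y| ≤ 1 / 2 ^ g → ‖z x - z y‖ ≤ δ) :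
    ‖ee (2 ^ g * x) * z x - ‖z x‖‖ ≤ 4 * π * (1 / 2 ^ t) * Z + 2 * δ := by
  set c := ⌊(2:ℝ) ^ g * x⌋
  set y := pt g c with hy
  have h1 := dig_spec t (z y)
  have h2 := hδ y (pt_close g x)
  have h3 := WW_frac hx
  have h4 : ‖ee (2 ^ g * x) - ee ((dig t (z y) : ℝ) / 2 ^ t)‖ ≤ 2 * π * (1 / 2 ^ t) := by
    rw [← ee_sub_int (2 ^ g * x) c]
    refine (ee_lip _ _).trans ?_
    gcongr
  have e : ee (2 ^ g * x) * z x - ‖z x‖ = ee (2 ^ g * x) * (z x - z y)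
      + (ee (2 ^ g * x) - ee ((dig t (z y) : ℝ) / 2 ^ t)) * z y
      + (ee ((dig t (z y) : ℝ) / 2 ^ t) * z y - ‖z y‖) + ((‖z y‖ - ‖z x‖ : ℝ) : ℂ) := by
    push_cast; ring
  rw [e]
  have h5 : ‖((‖z y‖ - ‖z x‖ : ℝ) : ℂ)‖ ≤ δ := by
    rw [Complex.norm_real, Real.norm_eq_abs]
    refine (abs_norm_sub_norm_le _ _).trans ?_
    rwa [norm_sub_rev]
  have h6 : ‖ee (2 ^ g * x) * (z x - z y)‖ ≤ δ := by rwa [norm_mul, norm_ee, one_mul]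
  have hpos : 0 ≤ 2 * π * (1 / (2:ℝ) ^ t) := by positivity
  have h7 : ‖(ee (2 ^ g * x) - ee ((dig t (z y) : ℝ) / 2 ^ t)) * z y‖ ≤ 2 * π * (1 / 2 ^ t) * Z := by
    rw [norm_mul]; gcongr; exact hZ y
  have h8 : 2 * π * (1 / 2 ^ t) * ‖z y‖ ≤ 2 * π * (1 / 2 ^ t) * Z := by gcongr; exact hZ y
  have n1 := norm_add_le (ee (2 ^ g * x) * (z x - z y)
      + (ee (2 ^ g * x) - ee ((dig t (z y) : ℝ) / 2 ^ t)) * z y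
      + (ee ((dig t (z y) : ℝ) / 2 ^ t) * z y - ‖z y‖)) ((‖z y‖ - ‖z x‖ : ℝ) : ℂ)
  have n2 := norm_add₃_le (a := ee (2 ^ g * x) * (z x - z y))
      (b := (ee (2 ^ g * x) - ee ((dig t (z y) : ℝ) / 2 ^ t)) * z y)
      (c := (ee ((dig t (z y) : ℝ) / 2 ^ t) * z y - ‖z y‖))
  linarith


noncomputable def zz1 (m t : ℕ) (x : ℝ) : ℂ :=
  -Complex.I * (starRingEnd ℂ (gpq (gg m t) x m).1 * (gpq (gg m t) x m).2)
noncomputable def zz2 (m t : ℕ) (x : ℝ) : ℂ :=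
  starRingEnd ℂ (gpq (gg m t) x (m+1)).1 * (gpq (gg m t) x (m+1)).2
noncomputable def zz4 (m t : ℕ) (x : ℝ) : ℂ := (gpq (gg m t) x (m+2)).1

def hit (m t : ℕ) : Set ℝ :=
  WW (m+t) t (fun c => dig t (zz1 m t (pt (m+t) c))) ∩
  WW (m+2*t) t (fun c => dig t (zz2 m t (pt (m+2*t) c))) ∩
  WW (m+3*t) (8*t) (fun _ => 0) ∩
  WW (m+12*t) t (fun c => dig t (zz4 m t (pt (m+12*t) c)))

lemma normsq_add (a b : ℂ) : ‖a + b‖ ^ 2 = ‖a‖ ^ 2 + ‖b‖ ^ 2 + 2 * (starRingEnd ℂ a * b).re := by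
  simp only [← Complex.normSq_eq_norm_sq]
  simp [Complex.normSq_apply]; ring

lemma normsq_sub (a b : ℂ) : ‖a - b‖ ^ 2 = ‖a‖ ^ 2 + ‖b‖ ^ 2 - 2 * (starRingEnd ℂ a * b).re := by
  simp only [← Complex.normSq_eq_norm_sq]
  simp [Complex.normSq_apply]; ring

lemma prod_lip {a b c d : ℂ} {M D : ℝ} (ha : ‖a‖ ≤ M) (hd : ‖d‖ ≤ M) (h1 : ‖a - c‖ ≤ D)
    (h2 : ‖b - d‖ ≤ D) : ‖starRingEnd ℂ a * b - starRingEnd ℂ c * d‖ ≤ 2 * M * D := by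
  have e : starRingEnd ℂ a * b - starRingEnd ℂ c * d =
    starRingEnd ℂ a * (b - d) + starRingEnd ℂ (a - c) * d := by rw [map_sub]; ring
  rw [e]
  refine (norm_add_le _ _).trans ?_
  rw [norm_mul, norm_mul, RCLike.norm_conj, RCLike.norm_conj]
  have : 0 ≤ M := (norm_nonneg _).trans ha
  have : 0 ≤ D := (norm_nonneg _).trans h1
  have : ‖a‖ * ‖b - d‖ ≤ M * D := by gcongr
  have : ‖a - c‖ * ‖d‖ ≤ D * M := by gcongr
  linarith

lemma hit_step1 {m t : ℕ} (hm : 1 ≤ m) (ht : 1 ≤ t) {x : ℝ}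
    (hx : x ∈ WW (m+t) t (fun c => dig t (zz1 m t (pt (m+t) c)))) :
    2 ^ (m+1) - 154 * 2 ^ m * (1 / 2 ^ t) ≤ ‖(gpq (gg m t) x (m+1)).1‖ ^ 2 ∧
    2 ^ (m+1) - 154 * 2 ^ m * (1 / 2 ^ t) ≤ ‖(gpq (gg m t) x (m+1)).2‖ ^ 2 := by
  have hs := sq_sqrt2 m
  have hT : (0:ℝ) < 1 / 2 ^ t := by positivity
  have hs0 : (0:ℝ) < √2 ^ m := by positivity
  have h := steer (Z := 2 ^ m) (δ := 32 * 2 ^ m * (1 / 2 ^ t)) hx ?_ ?_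
  · have e : (starRingEnd ℂ (gpq (gg m t) x m).1 * (ee ((gg m t m) * x) * (gpq (gg m t) x m).2)).re =
        - (ee (2 ^ (m+t) * x) * zz1 m t x - ‖zz1 m t x‖).im := by
      have : ((gg m t m : ℕ) : ℝ) = 2 ^ (m + t) := by simp [gg]
      rw [this]
      simp [zz1]; ring
    have h2 := (Complex.abs_im_le_norm _).trans h
    rw [abs_le] at h2
    have hpi := Real.pi_lt_d2
    have hb : 4 * π * (1 / 2 ^ t) * 2 ^ m + 2 * (32 * 2 ^ m * (1 / 2 ^ t)) ≤ 77 * 2 ^ m * (1 / 2 ^ t) := by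
      have : 0 < (1 / (2:ℝ) ^ t) * 2 ^ m := by positivity
      nlinarith
    have hsq := gpq_sq (gg m t) x m
    simp only [gpq]
    rw [normsq_add, normsq_sub, norm_mul, norm_ee, one_mul, e]
    constructor <;> linarith
  · intro y
    have hsq := gpq_sq (gg m t) y m
    simp only [zz1, norm_mul, norm_neg, Complex.norm_I, one_mul, RCLike.norm_conj]
    rw [pow_succ 2] at hsq
    nlinarith [sq_nonneg (‖(gpq (gg m t) y m).1‖ - ‖(gpq (gg m t) y m).2‖)]
  · intro y hy
    obtain ⟨i, rfl⟩ : ∃ i, m = i + 1 := ⟨m - 1, by omega⟩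
    have hl := gpq_lip (gg_gap (i+1) t ht) x y i
    have hgi : ((gg (i+1) t i : ℕ) : ℝ) = 2 ^ i := by simp [gg]
    rw [hgi] at hl
    have e : zz1 (i+1) t x - zz1 (i+1) t y = -Complex.I *
      (starRingEnd ℂ (gpq (gg (i+1) t) x (i+1)).1 * (gpq (gg (i+1) t) x (i+1)).2 -
       starRingEnd ℂ (gpq (gg (i+1) t) y (i+1)).1 * (gpq (gg (i+1) t) y (i+1)).2) := by
      simp only [zz1]; ring
    rw [e, norm_mul, norm_neg, Complex.norm_I, one_mul]
    refine (prod_lip (gpq_le _ x _).1 (gpq_le _ y _).2 hl.1 hl.2).trans ?_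
    calc 2 * √2 ^ (i+1+1) * (22 * 2 ^ i * √2 ^ (i+1) * |x - y|)
        ≤ 2 * √2 ^ (i+1+1) * (22 * 2 ^ i * √2 ^ (i+1) * (1 / 2 ^ (i+1+t))) := by gcongr
      _ = 22 * √2 * ((√2 ^ (i+1))^2) * (1 / 2 ^ t) := by
        rw [pow_add 2 (i+1) t, pow_succ 2 i, pow_succ √2 (i+1)]; field_simp
      _ ≤ 32 * 2 ^ (i+1) * (1 / 2 ^ t) := by
        rw [hs]; gcongr; nlinarith [sqrt2_lt]

lemma hit_step2 {m t : ℕ} (ht : 1 ≤ t) {x : ℝ}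
    (h1 : 2 ^ (m+1) - 154 * 2 ^ m * (1 / 2 ^ t) ≤ ‖(gpq (gg m t) x (m+1)).1‖ ^ 2)
    (h2 : 2 ^ (m+1) - 154 * 2 ^ m * (1 / 2 ^ t) ≤ ‖(gpq (gg m t) x (m+1)).2‖ ^ 2)
    (hx : x ∈ WW (m+2*t) t (fun c => dig t (zz2 m t (pt (m+2*t) c)))) :
    8 * 2 ^ m - 860 * 2 ^ m * (1 / 2 ^ t) ≤ ‖(gpq (gg m t) x (m+2)).1‖ ^ 2 := by
  have hs := sq_sqrt2 m
  have hT : (0:ℝ) < 1 / 2 ^ t := by positivity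
  have hs0 : (0:ℝ) < √2 ^ m := by positivity
  have h := steer (Z := 2 ^ (m+1)) (δ := 125 * 2 ^ m * (1 / 2 ^ t)) hx ?_ ?_
  · have e : (starRingEnd ℂ (gpq (gg m t) x (m+1)).1 *
        (ee ((gg m t (m+1)) * x) * (gpq (gg m t) x (m+1)).2)).re =
        (ee (2 ^ (m+2*t) * x) * zz2 m t x - ‖zz2 m t x‖).re + ‖zz2 m t x‖ := by
      have : ((gg m t (m+1) : ℕ) : ℝ) = 2 ^ (m + 2 * t) := by simp [gg]
      rw [this, Complex.sub_re, Complex.ofReal_re, sub_add_cancel]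
      congr 1
      simp only [zz2]; ring
    have h3 := (Complex.abs_re_le_norm _).trans h
    rw [abs_le] at h3
    have hpi := Real.pi_lt_d2
    have hb : 4 * π * (1 / 2 ^ t) * 2 ^ (m+1) + 2 * (125 * 2 ^ m * (1 / 2 ^ t)) ≤ 276 * 2 ^ m * (1 / 2 ^ t) := by
      have : 0 < (1 / (2:ℝ) ^ t) * 2 ^ m := by positivity
      rw [pow_succ]
      nlinarith
    have hz : 2 ^ (m+1) - 154 * 2 ^ m * (1 / 2 ^ t) ≤ ‖zz2 m t x‖ := by
      simp only [zz2, norm_mul, RCLike.norm_conj]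
      set a := ‖(gpq (gg m t) x (m+1)).1‖
      set b := ‖(gpq (gg m t) x (m+1)).2‖
      have ha : 0 ≤ a := norm_nonneg _
      have hb : 0 ≤ b := norm_nonneg _
      rcases le_total a b with hab | hab <;> nlinarith
    have hsq := gpq_sq (gg m t) x (m+1)
    have eg : (gpq (gg m t) x (m+2)).1 = (gpq (gg m t) x (m+1)).1 +
      (ee ((gg m t (m+1)) * x) * (gpq (gg m t) x (m+1)).2) := rfl
    rw [eg, normsq_add, norm_mul, norm_ee, one_mul, e]
    have : (2:ℝ) ^ (m+1+1) = 4 * 2 ^ m := by ring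
    have : (2:ℝ) ^ (m+1) = 2 * 2 ^ m := by ring
    linarith
  · intro y
    have hsq := gpq_sq (gg m t) y (m+1)
    simp only [zz2, norm_mul, RCLike.norm_conj]
    rw [pow_succ 2] at hsq
    nlinarith [sq_nonneg (‖(gpq (gg m t) y (m+1)).1‖ - ‖(gpq (gg m t) y (m+1)).2‖)]
  · intro y hy
    have hl := gpq_lip (gg_gap m t ht) x y m
    have hgi : ((gg m t m : ℕ) : ℝ) = 2 ^ (m + t) := by simp [gg]
    rw [hgi] at hl
    refine (prod_lip (gpq_le _ x _).1 (gpq_le _ y _).2 hl.1 hl.2).trans ?_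
    calc 2 * √2 ^ (m+1+1) * (22 * 2 ^ (m+t) * √2 ^ (m+1) * |x - y|)
        ≤ 2 * √2 ^ (m+1+1) * (22 * 2 ^ (m+t) * √2 ^ (m+1) * (1 / 2 ^ (m+2*t))) := by gcongr
      _ = 44 * √2 * (√2)^2 * ((√2 ^ m)^2) * (1 / 2 ^ t) := by
        rw [show m + 2 * t = m + t + t by ring, pow_add 2 (m+t) t]; field_simp; ring
      _ ≤ 125 * 2 ^ m * (1 / 2 ^ t) := by
        rw [hs, Real.sq_sqrt (by norm_num)]; gcongr; nlinarith [sqrt2_lt]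

lemma hit_est {m t R : ℕ} (hm : 1 ≤ m) (ht : 1 ≤ t) (hR : R ≤ 2 ^ (7 * t)) {x : ℝ}
    (hx : x ∈ hit m t) :
    R * √2 ^ m * (√8 - 500 * (1 / 2 ^ t)) ≤
      (ee (2 ^ (m+12*t) * x) * ((gpq (gg m t) x (m+2)).1 *
        ∑ r ∈ range R, ee (r * (2 ^ (m+3*t) * x)))).re := by
  obtain ⟨⟨⟨h1, h2⟩, h3⟩, h4⟩ := hx
  have s1 := hit_step1 hm ht h1
  have s2 := hit_step2 ht s1.1 s1.2 h2
  have hs := sq_sqrt2 m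
  set s := √2 ^ m with hsdef
  have hs0 : (0:ℝ) < s := by positivity
  set T : ℝ := 1 / 2 ^ t with hTdef
  have hT : 0 < T := by positivity
  have hpi := Real.pi_lt_d2
  have hpi0 := Real.pi_pos
  set F := (gpq (gg m t) x (m+2)).1 with hF
  have h8 : √8 = 2 * √2 := by
    rw [show (8:ℝ) = 2^2 * 2 by norm_num, Real.sqrt_mul (by norm_num), Real.sqrt_sq (by norm_num)]
  have h8s : √8 ^ 2 = 8 := Real.sq_sqrt (by norm_num)
  have hFu : ‖F‖ ≤ √8 * s := by
    have := (gpq_le (gg m t) x (m+2)).1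
    refine this.trans (le_of_eq ?_)
    rw [h8, hsdef, show m + 2 + 1 = m + 1 + 2 by ring, pow_add, Real.sq_sqrt (by norm_num), pow_succ]; ring
  have hFl : √8 * s * (1 - 108 * T) ≤ ‖F‖ := by
    by_cases hneg : 1 - 108 * T ≤ 0
    · have : √8 * s * (1 - 108 * T) ≤ 0 := mul_nonpos_of_nonneg_of_nonpos (by positivity) hneg
      exact this.trans (norm_nonneg _)
    · push Not at hneg
      apply le_of_sq_le_sq _ (norm_nonneg _)
      rw [mul_pow, mul_pow, h8s, hs]
      have hp : (0:ℝ) < 2 ^ m := by positivity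
      refine le_trans ?_ s2
      have : (1 - 108 * T) ^ 2 ≤ 1 - 108 * T := by nlinarith
      nlinarith
  have h := steer (Z := √8 * s) (δ := 44 * s * T) h4 ?_ ?_
  · have hzF : zz4 m t x = F := rfl
    rw [hzF] at h
    set D := ∑ r ∈ range R, ee (r * (2 ^ (m+3*t) * x)) with hD
    have hDR : ‖D - R‖ ≤ R * (2 * π * T) := by
      have e : D - R = ∑ r ∈ range R, (ee (r * (2 ^ (m+3*t) * x)) - 1) := by
        rw [sum_sub_distrib]; simp [hD]
      rw [e]
      refine (norm_sum_le _ _).trans ?_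
      refine (sum_le_card_nsmul _ _ (2 * π * T) ?_).trans (by simp)
      intro r hr
      have hw := WW_frac h3
      simp only [Nat.cast_zero, zero_div, sub_zero] at hw
      set c := ⌊(2:ℝ) ^ (m+3*t) * x⌋
      have e2 : ee (r * (2 ^ (m+3*t) * x)) = ee (r * (2 ^ (m+3*t) * x - c)) := by
        rw [← ee_sub_int _ (r * c)]; congr 1; push_cast; ring
      rw [e2]
      refine (ee_sub_one _).trans ?_
      rw [abs_mul, Nat.abs_cast]
      have hr1 : (r:ℝ) ≤ 2 ^ (7 * t) := by
        have : r < R := mem_range.1 hr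
        exact_mod_cast (this.le.trans hR)
      calc 2 * π * (r * |2 ^ (m+3*t) * x - c|) ≤ 2 * π * (2 ^ (7*t) * (1 / 2 ^ (8 * t))) := by gcongr
        _ = 2 * π * T := by
          rw [hTdef, show 8 * t = 7 * t + t by ring, pow_add]; field_simp
    have e : ee (2 ^ (m+12*t) * x) * (F * D) = (ee (2 ^ (m+12*t) * x) * F - ‖F‖) * R
       + ((‖F‖ * R : ℝ) : ℂ) + ee (2 ^ (m+12*t) * x) * F * (D - R) := by push_cast; ring
    rw [e, Complex.add_re, Complex.add_re, Complex.ofReal_re]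
    have b1 := (Complex.abs_re_le_norm ((ee (2 ^ (m+12*t) * x) * F - ‖F‖) * R))
    have b2 := (Complex.abs_re_le_norm (ee (2 ^ (m+12*t) * x) * F * (D - R)))
    rw [abs_le] at b1 b2
    have hR0 : (0:ℝ) ≤ R := Nat.cast_nonneg _
    rw [norm_mul, Complex.norm_natCast] at b1
    rw [norm_mul, norm_mul, norm_ee, one_mul] at b2
    have b3 := mul_le_mul_of_nonneg_right h hR0
    have b4 : ‖F‖ * ‖D - R‖ ≤ √8 * s * (R * (2 * π * T)) := by gcongr
    have b5 := mul_le_mul_of_nonneg_right hFl hR0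
    have hRsT : 0 ≤ R * s * T := by positivity
    have h8u : √8 ≤ 2.8286 := by rw [h8]; linarith [sqrt2_lt]
    have h8pi : √8 * π ≤ 8.92 := by nlinarith
    have : √8 * 108 + 4 * (√8 * π) + 88 + 2 * (√8 * π) ≤ 500 := by linarith
    have := mul_le_mul_of_nonneg_left this hRsT
    nlinarith
  · intro y
    refine ((gpq_le (gg m t) y (m+2)).1).trans (le_of_eq ?_)
    rw [h8, hsdef, show m + 2 + 1 = m + 1 + 2 by ring, pow_add, Real.sq_sqrt (by norm_num), pow_succ]; ring
  · intro y hy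
    have hl := (gpq_lip (gg_gap m t ht) x y (m+1)).1
    have hgi : ((gg m t (m+1) : ℕ) : ℝ) = 2 ^ (m + 2 * t) := by simp [gg]
    rw [hgi] at hl
    refine hl.trans ?_
    calc 22 * 2 ^ (m+2*t) * √2 ^ (m+1+1) * |x - y|
        ≤ 22 * 2 ^ (m+2*t) * √2 ^ (m+1+1) * (1 / 2 ^ (m+12*t)) := by gcongr
      _ ≤ 22 * 2 ^ (m+2*t) * √2 ^ (m+1+1) * (1 / 2 ^ (m+2*t+t)) := by
        apply mul_le_mul_of_nonneg_left _ (by positivity)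
        apply one_div_le_one_div_of_le (by positivity)
        exact pow_le_pow_right₀ (by norm_num) (by omega)
      _ = 22 * (√2)^2 * s * T := by
        rw [pow_add 2 (m+2*t) t, hsdef, hTdef]; field_simp; ring
      _ = 44 * s * T := by rw [Real.sq_sqrt (by norm_num)]; ring


def cell (g : ℕ) (c : ℤ) : Set ℝ := {x | ⌊(2:ℝ) ^ g * x⌋ = c}

def Lev (g : ℕ) (A : Set ℝ) : Prop := ∃ T : Set ℤ, A = {x | ⌊(2:ℝ) ^ g * x⌋ ∈ T}

lemma cell_eq (g : ℕ) (c : ℤ) : cell g c = Set.Ico ((c:ℝ) / 2 ^ g) (((c:ℝ) + 1) / 2 ^ g) := by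
  ext x
  have hp : (0:ℝ) < 2 ^ g := by positivity
  simp only [cell, Set.mem_ofPred_eq, Set.mem_Ico, Int.floor_eq_iff, div_le_iff₀ hp, lt_div_iff₀ hp]
  rw [mul_comm x]

lemma cell_vol (g : ℕ) (c : ℤ) : volume (cell g c) = ENNReal.ofReal (1 / 2 ^ g) := by
  rw [cell_eq, Real.volume_Ico]; congr 1; ring

lemma cell_meas (g : ℕ) (c : ℤ) : MeasurableSet (cell g c) := by
  rw [cell_eq]; exact measurableSet_Ico

lemma floor_sub (g b : ℕ) (x : ℝ) : ⌊(2:ℝ) ^ g * x⌋ = ⌊(2:ℝ) ^ (g + b) * x⌋ / 2 ^ b := by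
  symm
  have hp : (0:ℝ) < 2 ^ b := by positivity
  have hz : (0:ℤ) < 2 ^ b := by positivity
  have h1 := Int.floor_le ((2:ℝ) ^ (g + b) * x)
  have h2 := Int.lt_floor_add_one ((2:ℝ) ^ (g + b) * x)
  set d := ⌊(2:ℝ) ^ (g + b) * x⌋
  rw [eq_comm, Int.floor_eq_iff]
  have e1 : d / 2 ^ b * 2 ^ b ≤ d := Int.ediv_mul_le _ hz.ne'
  have e2 : d < (d / 2 ^ b + 1) * 2 ^ b := Int.lt_ediv_add_one_mul_self _ hz
  have e2' : d + 1 ≤ (d / 2 ^ b + 1) * 2 ^ b := e2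
  have e1r : ((d / 2 ^ b : ℤ) : ℝ) * 2 ^ b ≤ d := by exact_mod_cast e1
  have e2r : (d : ℝ) + 1 ≤ (((d / 2 ^ b : ℤ) : ℝ) + 1) * 2 ^ b := by exact_mod_cast e2'
  have e : (2:ℝ) ^ (g + b) * x = 2 ^ g * x * 2 ^ b := by rw [pow_add]; ring
  rw [e] at h1 h2
  constructor
  · exact le_of_mul_le_mul_right (e1r.trans h1) hp
  · exact lt_of_mul_lt_mul_right (h2.trans_le e2r) hp.le

lemma Lev.mono {g : ℕ} {A : Set ℝ} (h : Lev g A) {g' : ℕ} (hg : g ≤ g') : Lev g' A := by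
  obtain ⟨T, rfl⟩ := h
  obtain ⟨b, rfl⟩ := Nat.exists_eq_add_of_le hg
  exact ⟨{d | d / 2 ^ b ∈ T}, by ext x; simp [floor_sub g b x]⟩

lemma Lev.diff {g : ℕ} {A B : Set ℝ} (h : Lev g A) (h' : Lev g B) : Lev g (A \ B) := by
  obtain ⟨T, rfl⟩ := h
  obtain ⟨T', rfl⟩ := h'
  exact ⟨T \ T', rfl⟩

lemma Lev.meas {g : ℕ} {A : Set ℝ} (h : Lev g A) : MeasurableSet A := by
  obtain ⟨T, rfl⟩ := h
  have : Measurable fun x : ℝ => ⌊(2:ℝ) ^ g * x⌋ := Int.measurable_floor.comp (measurable_const_mul _)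
  exact this (MeasurableSet.of_discrete)

lemma Lev.inter {g : ℕ} {A B : Set ℝ} (h : Lev g A) (h' : Lev g B) : Lev g (A ∩ B) := by
  obtain ⟨T, rfl⟩ := h
  obtain ⟨T', rfl⟩ := h'
  exact ⟨T ∩ T', rfl⟩

lemma WW_lev (g b : ℕ) (f : ℤ → ℕ) : Lev (g + b) (WW g b f) := by
  refine ⟨{d | d = 2 ^ b * (d / 2 ^ b) + f (d / 2 ^ b)}, ?_⟩
  ext x
  simp only [WW, Set.mem_ofPred_eq]
  rw [floor_sub g b x]

lemma WW_vol {g b : ℕ} {f : ℤ → ℕ} (hf : ∀ c, f c < 2 ^ b) {A : Set ℝ} (h : Lev g A) :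
    volume (A ∩ WW g b f) = volume A * ENNReal.ofReal (1 / 2 ^ b) := by
  obtain ⟨T, rfl⟩ := h
  have e1 : {x | ⌊(2:ℝ) ^ g * x⌋ ∈ T} = ⋃ c : T, cell g c := by ext x; simp [cell]
  have e2 : {x | ⌊(2:ℝ) ^ g * x⌋ ∈ T} ∩ WW g b f = ⋃ c : T, cell (g + b) (2 ^ b * c + f c) := by
    ext x
    simp only [WW, cell, Set.mem_inter_iff, Set.mem_ofPred_eq, Set.mem_iUnion, Subtype.exists, exists_prop]
    constructor
    · rintro ⟨h1, h2⟩; exact ⟨_, h1, h2⟩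
    · rintro ⟨c, hc, h2⟩
      have : ⌊(2:ℝ) ^ g * x⌋ = c := by
        rw [floor_sub g b x, h2]
        have hz : (0:ℤ) < 2 ^ b := by positivity
        rw [Int.add_comm, Int.add_mul_ediv_left _ _ hz.ne', Int.ediv_eq_zero_of_lt (by positivity) (by exact_mod_cast hf c)]
        simp
      rw [this]; exact ⟨hc, h2⟩
  rw [e2, e1, measure_iUnion, measure_iUnion, ← ENNReal.tsum_mul_right]
  · refine tsum_congr fun c => ?_
    rw [cell_vol, cell_vol, ← ENNReal.ofReal_mul (by positivity)]
    congr 1; rw [pow_add]; field_simp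
  · intro c d hcd
    refine Set.disjoint_left.2 fun x h1 h2 => hcd ?_
    exact Subtype.ext ((h1 : _ = _).symm.trans h2)
  · intro c; exact cell_meas _ _
  · intro c d hcd
    refine Set.disjoint_left.2 fun x h1 h2 => hcd ?_
    have h3 := congrArg (fun z : ℤ => z / 2 ^ b) ((h1 : _ = _).symm.trans h2)
    have hz : (0:ℤ) < 2 ^ b := by positivity
    have h4 : ∀ c : ℤ, (2 ^ b * c + f c) / 2 ^ b = c := by
      intro c
      rw [Int.add_comm, Int.add_mul_ediv_left _ _ hz.ne', Int.ediv_eq_zero_of_lt (by positivity) (by exact_mod_cast hf c)]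
      simp
    simp only [h4] at h3
    exact Subtype.ext h3
  · intro c; exact cell_meas _ _

lemma hit_lev (m t : ℕ) : Lev (m + 13 * t) (hit m t) := by
  unfold hit
  refine (((Lev.mono (WW_lev _ _ _) ?_).inter (Lev.mono (WW_lev _ _ _) ?_)).inter
    (Lev.mono (WW_lev _ _ _) ?_)).inter (Lev.mono (WW_lev _ _ _) ?_) <;> omega

lemma hit_vol (m t : ℕ) {A : Set ℝ} (h : Lev (m + t) A) :
    volume (A ∩ hit m t) = volume A * ENNReal.ofReal (1 / 2 ^ (11 * t)) := by
  unfold hit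
  rw [← Set.inter_assoc, ← Set.inter_assoc, ← Set.inter_assoc]
  have l1 := (h.mono (show m + t ≤ m + t + t by omega)).inter
    (WW_lev (m+t) t (fun c => dig t (zz1 m t (pt (m+t) c))))
  have l1' := l1.mono (show m + t + t ≤ m + 2 * t by omega)
  have l2 := (l1'.mono (show m + 2 * t ≤ m + 2 * t + t by omega)).inter
    (WW_lev (m+2*t) t (fun c => dig t (zz2 m t (pt (m+2*t) c))))
  have l2' := l2.mono (show m + 2 * t + t ≤ m + 3 * t by omega)
  have l3 := (l2'.mono (show m + 3 * t ≤ m + 3 * t + 8 * t by omega)).inter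
    (WW_lev (m+3*t) (8*t) (fun _ => 0))
  have l3' := l3.mono (show m + 3 * t + 8 * t ≤ m + 12 * t by omega)
  rw [WW_vol (fun c => dig_lt _ _) l3', WW_vol (fun c => by positivity) l2', WW_vol (fun c => dig_lt _ _) l1',
    WW_vol (fun c => dig_lt _ _) h, mul_assoc, mul_assoc, mul_assoc]
  congr 1
  rw [← ENNReal.ofReal_mul (by positivity), ← ENNReal.ofReal_mul (by positivity), ← ENNReal.ofReal_mul (by positivity)]
  congr 1
  rw [show 11 * t = t + t + 8 * t + t by ring, pow_add, pow_add, pow_add]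
  field_simp

lemma hits_ae (m t : ℕ → ℕ) (hmt : ∀ n, m n + 13 * t n ≤ m (n+1) + t (n+1))
    (hS : Tendsto (fun N => ∑ n ∈ range N, (1:ℝ) / 2 ^ (11 * t n)) atTop atTop) :
    ∀ᵐ x ∂(volume : Measure ℝ), ∃ᶠ n in atTop, x ∈ hit (m n) (t n) := by
  have key : ∀ (n₀ : ℕ) (j : ℤ), volume {x : ℝ | x ∈ cell 0 j ∧ ∀ n ≥ n₀, x ∉ hit (m n) (t n)} = 0 := by
    intro n₀ j
    set A : ℕ → Set ℝ := fun k => Nat.rec (cell 0 j) (fun k B => B \ hit (m (n₀+k)) (t (n₀+k))) k with hA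
    have hA0 : A 0 = cell 0 j := rfl
    have hAs : ∀ k, A (k+1) = A k \ hit (m (n₀+k)) (t (n₀+k)) := fun k => rfl
    have hL : ∀ k, Lev (m (n₀+k) + t (n₀+k)) (A k) := by
      intro k
      induction k with
      | zero => rw [hA0]; exact Lev.mono ⟨{j}, by ext x; simp [cell]⟩ (Nat.zero_le _)
      | succ k ih =>
        rw [hAs]
        exact ((ih.mono (by omega)).diff (hit_lev _ _)).mono (hmt (n₀+k))
    have hV : ∀ k, volume (A k) ≤ ENNReal.ofReal (Real.exp (-∑ i ∈ range k, (1:ℝ) / 2 ^ (11 * t (n₀+i)))) := by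
      intro k
      induction k with
      | zero => rw [hA0, cell_vol]; simp
      | succ k ih =>
        have hfin : volume (A k) ≠ ∞ := ne_top_of_le_ne_top ENNReal.ofReal_ne_top ih
        have h1 := measure_inter_add_sdiff (μ := volume) (A k) (hit_lev (m (n₀+k)) (t (n₀+k))).meas
        rw [hit_vol _ _ (hL k), ← hAs k] at h1
        set q : ℝ := 1 / 2 ^ (11 * t (n₀+k)) with hq
        have hq0 : 0 ≤ q := by positivity
        have hq1 : q ≤ 1 := by
          rw [hq, div_le_one (by positivity)]; exact one_le_pow₀ (by norm_num)
        have hfin' : volume (A (k+1)) ≠ ∞ := ne_top_of_le_ne_top hfin (h1 ▸ le_add_self)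
        rw [← ENNReal.ofReal_toReal hfin] at h1 ih
        rw [← ENNReal.ofReal_toReal hfin'] at h1 ⊢
        set u := (volume (A k)).toReal
        set v := (volume (A (k+1))).toReal
        have hu : 0 ≤ u := ENNReal.toReal_nonneg
        have hv : 0 ≤ v := ENNReal.toReal_nonneg
        rw [← ENNReal.ofReal_mul hu, ← ENNReal.ofReal_add (by positivity) hv,
          ENNReal.ofReal_eq_ofReal_iff (by positivity) hu] at h1
        rw [ENNReal.ofReal_le_ofReal_iff (by positivity)] at ih
        apply ENNReal.ofReal_le_ofReal
        rw [sum_range_succ, neg_add, Real.exp_add, ← hq]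
        have he : 1 - q ≤ Real.exp (-q) := by linarith [Real.add_one_le_exp (-q)]
        calc v = u * (1 - q) := by linarith
          _ ≤ _ := mul_le_mul ih he (by linarith) (by positivity)
    have hS' : Tendsto (fun k => ∑ i ∈ range k, (1:ℝ) / 2 ^ (11 * t (n₀+i))) atTop atTop := by
      have h1 := (tendsto_add_atTop_iff_nat n₀).2 hS
      have h2 := tendsto_atTop_add_const_right atTop (-∑ n ∈ range n₀, (1:ℝ) / 2 ^ (11 * t n)) h1
      refine h2.congr fun k => ?_
      rw [add_comm k n₀, sum_range_add]; ring
    have hT : Tendsto (fun k => ENNReal.ofReal (Real.exp (-∑ i ∈ range k, (1:ℝ) / 2 ^ (11 * t (n₀+i))))) atTop (nhds 0) := by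
      rw [← ENNReal.ofReal_zero]
      exact ENNReal.tendsto_ofReal (Real.tendsto_exp_neg_atTop_nhds_zero.comp hS')
    refine le_antisymm (ge_of_tendsto' hT fun k => ?_) zero_le
    refine (measure_mono ?_).trans (hV k)
    rintro x ⟨hx0, hx⟩
    induction k with
    | zero => exact hx0
    | succ k ih => exact ⟨ih, hx _ (by omega)⟩
  have key2 : ∀ᵐ x ∂(volume : Measure ℝ), ∀ (n₀ : ℕ) (j : ℤ), ¬ (x ∈ cell 0 j ∧ ∀ n ≥ n₀, x ∉ hit (m n) (t n)) := by
    rw [ae_all_iff]; intro n₀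
    rw [ae_all_iff]; intro j
    rw [ae_iff]
    simpa using key n₀ j
  filter_upwards [key2] with x hx
  rw [frequently_atTop]
  intro n₀
  by_contra hcon
  push Not at hcon
  exact hx n₀ ⌊(2:ℝ)^0 * x⌋ ⟨rfl, hcon⟩


def tt (n : ℕ) : ℕ := Nat.log 2 (n+2) / 11 + 1
def mm (n : ℕ) : ℕ := 2 * (n+5)^2
def KK (n : ℕ) : ℕ := 2 ^ (mm n + 12 * tt n)
def LL (n : ℕ) : ℕ := 2 ^ (mm n + 3 * tt n)
noncomputable def hh (n : ℕ) : ℝ := √2 ^ mm n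

lemma tt_pos (n : ℕ) : 1 ≤ tt n := by unfold tt; omega

lemma mm_pos (n : ℕ) : 1 ≤ mm n := by unfold mm; exact Nat.succ_le_of_lt (by positivity)

lemma tt_mono {n n' : ℕ} (h : n ≤ n') : tt n ≤ tt n' := by
  unfold tt
  have := Nat.log_mono_right (b := 2) (show n + 2 ≤ n' + 2 by omega)
  omega

lemma tt_up (n : ℕ) : 2 ^ (11 * tt n) ≤ 2048 * (n + 2) := by
  have h := Nat.pow_log_le_self 2 (show n + 2 ≠ 0 by omega)
  have : 2 ^ (11 * tt n) ≤ 2 ^ (Nat.log 2 (n+2) + 11) :=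
    Nat.pow_le_pow_right (by norm_num) (by unfold tt; omega)
  rw [pow_add] at this
  omega

lemma tt_low (n : ℕ) : n + 2 ≤ 2 ^ (11 * tt n) := by
  have h := Nat.lt_pow_succ_log_self (b := 2) (by norm_num) (n+2)
  have : 2 ^ (Nat.log 2 (n+2)).succ ≤ 2 ^ (11 * tt n) :=
    Nat.pow_le_pow_right (by norm_num) (by unfold tt; omega)
  omega

lemma tt_small (n : ℕ) : 12 * tt n ≤ 2 * n + 20 := by
  have : Nat.log 2 (n+2) ≤ n + 1 := by
    have := Nat.log_lt_self 2 (show n + 2 ≠ 0 by omega); omega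
  unfold tt; omega

lemma mm_succ (n : ℕ) : mm (n+1) = mm n + 4 * n + 22 := by unfold mm; ring

lemma mt_gap (n : ℕ) : mm n + 13 * tt n ≤ mm (n+1) + tt (n+1) := by
  have := tt_small n
  have := tt_mono (show n ≤ n + 1 by omega)
  have := mm_succ n
  omega

lemma tt_tendsto : Tendsto tt atTop atTop := by
  rw [tendsto_atTop]
  intro b
  filter_upwards [eventually_ge_atTop (2 ^ (11 * b))] with n hn
  by_contra hc
  have h1 := tt_low n
  have : 2 ^ (11 * tt n) ≤ 2 ^ (11 * b) := Nat.pow_le_pow_right (by norm_num) (by omega)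
  omega

lemma hits_all : ∀ᵐ x ∂(volume : Measure ℝ), ∃ᶠ n in atTop, x ∈ hit (mm n) (tt n) := by
  apply hits_ae mm tt mt_gap
  have h0 := Real.tendsto_sum_range_one_div_nat_succ_atTop
  have h1 := h0.const_mul_atTop (show (0:ℝ) < 1 / 4096 by norm_num)
  refine tendsto_atTop_mono (fun N => ?_) h1
  rw [mul_sum]
  refine sum_le_sum fun n _ => ?_
  rw [div_mul_div_comm, one_mul]
  apply one_div_le_one_div_of_le (by positivity)
  have := tt_up n
  have : 2 ^ (11 * tt n) ≤ 4096 * (n + 1) := by omega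
  exact_mod_cast this

lemma KK_succ (n : ℕ) : 2 * KK n ≤ KK (n+1) := by
  unfold KK
  rw [← pow_succ']
  apply Nat.pow_le_pow_right (by norm_num)
  have := tt_mono (show n ≤ n + 1 by omega)
  have := mm_succ n
  omega

lemma KK_pos (n : ℕ) : 0 < KK n := by unfold KK; positivity

lemma KK_strict : StrictMono KK := strictMono_nat_of_lt_succ fun n => by
  have := KK_succ n; have := KK_pos n; omega

lemma KK_gt (n : ℕ) : n < KK n := by
  refine n.lt_two_pow_self.trans_le (Nat.pow_le_pow_right (by norm_num) ?_)
  unfold mm; nlinarith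

lemma gg_top (m t : ℕ) : gg m t (m+2) = 2 ^ (m + 3 * t) := by simp [gg]

noncomputable def bb (R : ℕ → ℕ) (n : ℕ) : ℕ → ℝ :=
  sh (KK n) (rep (gol (gg (mm n) (tt n)) (mm n + 2)).1 (LL n) (R n))

noncomputable def aa (R : ℕ → ℕ) (k : ℕ) : ℝ := 1 + ∑ n ∈ range (k+1), (bb R n k - |bb R n k|)

section
variable {R : ℕ → ℕ}

lemma cc_supp (n : ℕ) : ∀ k, LL n ≤ k → (gol (gg (mm n) (tt n)) (mm n + 2)).1 k = 0 := by
  intro k hk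
  exact (gol_supp (gg_gap _ _ (tt_pos n)) _ k (by rw [gg_top]; exact hk)).1

lemma bb_low {n k : ℕ} (h : k < KK n) : bb R n k = 0 := by
  unfold bb sh; rw [if_neg (by omega)]

lemma bb_high {n k : ℕ} (h : KK n + R n * LL n ≤ k) : bb R n k = 0 := by
  unfold bb sh; rw [if_pos (by omega)]
  exact rep_supp (cc_supp n) _ _ (by omega)

lemma bb_abs (n k : ℕ) : |bb R n k| = 0 ∨ |bb R n k| = 1 := by
  unfold bb sh
  split_ifs
  · exact (rep_abs (cc_supp n) (fun k => (gol_abs (gg_gap _ _ (tt_pos n)) _ k).1) _ _).2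
  · simp

lemma bb_abs_eq (n : ℕ) : (fun k => |bb R n k|) =
    sh (KK n) (rep (fun k => |(gol (gg (mm n) (tt n)) (mm n + 2)).1 k|) (LL n) (R n)) := by
  funext k
  unfold bb sh
  split_ifs
  · exact (rep_abs (cc_supp n) (fun k => (gol_abs (gg_gap _ _ (tt_pos n)) _ k).1) _ _).1
  · simp

lemma RL_le (hR : ∀ n, R n ≤ 2 ^ (7 * tt n)) (n : ℕ) : R n * LL n * 2 ^ (2 * tt n) ≤ KK n := by
  calc R n * LL n * 2 ^ (2 * tt n) ≤ 2 ^ (7 * tt n) * LL n * 2 ^ (2 * tt n) := by gcongr; exact hR n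
    _ = KK n := by unfold LL KK; rw [← pow_add, ← pow_add]; congr 1; ring

lemma RL_le' (hR : ∀ n, R n ≤ 2 ^ (7 * tt n)) (n : ℕ) : R n * LL n ≤ KK n :=
  (Nat.le_mul_of_pos_right _ (by positivity)).trans (RL_le hR n)

lemma aa_sign (hR : ∀ n, R n ≤ 2 ^ (7 * tt n)) (k : ℕ) : aa R k = 1 ∨ aa R k = -1 := by
  by_cases h : ∃ n, bb R n k ≠ 0
  · obtain ⟨n, hn⟩ := h
    have h1 : KK n ≤ k := by by_contra hc; exact hn (bb_low (by omega))
    have h2 : k < KK (n+1) := by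
      by_contra hc
      have := KK_succ n; have := RL_le' hR n
      exact hn (bb_high (by omega))
    have hs : ∑ n ∈ range (k+1), (bb R n k - |bb R n k|) = bb R n k - |bb R n k| := by
      apply sum_eq_single
      · intro j _ hj
        have : bb R j k = 0 := by
          rcases lt_or_gt_of_ne hj with hlt | hgt
          · apply bb_high
            have := KK_succ j; have := RL_le' hR j
            have := KK_strict.monotone (show j + 1 ≤ n by omega)
            omega
          · apply bb_low
            have := KK_strict.monotone (show n + 1 ≤ j by omega)
            omega
        simp [this]
      · intro hc
        have := KK_gt n
        exact absurd (mem_range.2 (by omega)) hc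
    unfold aa
    rw [hs]
    rcases bb_abs (R := R) n k with h0 | h0
    · exact absurd (abs_eq_zero.1 h0) hn
    · rcases (abs_eq (by norm_num)).1 h0 with h3 | h3 <;> rw [h3] <;> norm_num
  · push Not at h
    left
    simp [aa, h]

lemma aa_zero : aa R 0 = 1 := by
  have : bb R 0 0 = 0 := bb_low (KK_pos 0)
  simp [aa, this]

lemma ps_sum (M N : ℕ) (f : ℕ → ℕ → ℝ) (x : ℝ) :
    ps (fun k => ∑ n ∈ range M, f n k) N x = ∑ n ∈ range M, ps (f n) N x := by
  unfold ps
  rw [sum_comm]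
  refine sum_congr rfl fun k _ => ?_
  push_cast
  rw [sum_mul]

lemma ps_aa {M N : ℕ} (h : N ≤ KK M) (x : ℝ) : ps (aa R) N x =
    ps (fun _ => 1) N x + ∑ n ∈ range M, (ps (bb R n) N x - ps (fun k => |bb R n k|) N x) := by
  have e : ps (aa R) N x = ps (fun k => 1 + ∑ n ∈ range M, (bb R n k - |bb R n k|)) N x := by
    unfold ps
    refine sum_congr rfl fun k hk => ?_
    have hk := mem_range.1 hk
    congr 2
    unfold aa
    congr 1
    trans ∑ n ∈ range (max (k+1) M), (bb R n k - |bb R n k|)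
    · apply sum_subset (range_mono (le_max_left _ _))
      intro j _ hj
      have hj : k + 1 ≤ j := by simpa using hj
      have : bb R j k = 0 := bb_low (by have := KK_gt j; omega)
      simp [this]
    · symm
      apply sum_subset (range_mono (le_max_right _ _))
      intro j _ hj
      have hj : M ≤ j := by simpa using hj
      have : bb R j k = 0 := bb_low (by have := KK_strict.monotone hj; omega)
      simp [this]
  rw [e, ps_add, ps_sum]
  congr 1
  refine sum_congr rfl fun n _ => ?_
  exact ps_sub _ _ _ _

lemma hh_pos (n : ℕ) : 0 < hh n := by unfold hh; positivity

lemma ps_bb (n N : ℕ) (x : ℝ) : ‖ps (bb R n) N x‖ ≤ R n * (√8 * hh n) + 8 * hh n := by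
  have hg := gg_gap (mm n) (tt n) (tt_pos n)
  have h8 : √8 = 2 * √2 := by
    rw [show (8:ℝ) = 2^2 * 2 by norm_num, Real.sqrt_mul (by norm_num), Real.sqrt_sq (by norm_num)]
  have e1 : √8 * hh n = √2 ^ (mm n + 2 + 1) := by
    rw [h8, hh, show mm n + 2 + 1 = mm n + 1 + 2 by ring, pow_add _ _ 2, Real.sq_sqrt (by norm_num), pow_succ]; ring
  have e2 : 8 * hh n = 4 * √2 ^ (mm n + 2) := by
    rw [hh, pow_add _ _ 2, Real.sq_sqrt (by norm_num)]; ring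
  unfold bb
  rw [ps_sh, norm_mul, norm_ee, one_mul, e1, e2]
  refine rep_part (F := (gpq (gg (mm n) (tt n)) x (mm n + 2)).1) ?_ (by positivity) (gpq_le _ _ _).1 ?_ _ _
  · intro N hN
    exact (gol_full hg x _ N (by rw [gg_top]; exact hN)).1
  · intro N; exact (gol_part hg x _ N).1

lemma ps_bb_abs (n N : ℕ) {x : ℝ} (hx : ee x ≠ 1) :
    ‖ps (fun k => |bb R n k|) N x‖ ≤ R n * (4 * Cx x) := by
  rw [bb_abs_eq, ps_sh, norm_mul, norm_ee, one_mul]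
  exact rep_part' (fun N => gol_abs_part _ _ (tt_pos n) hx N) _ _

lemma ps_bb_full (n : ℕ) (x : ℝ) : ps (bb R n) (KK n + R n * LL n) x =
    ee (2 ^ (mm n + 12 * tt n) * x) * ((gpq (gg (mm n) (tt n)) x (mm n + 2)).1 *
        ∑ r ∈ range (R n), ee (r * (2 ^ (mm n+3*tt n) * x))) := by
  have hg := gg_gap (mm n) (tt n) (tt_pos n)
  unfold bb
  rw [ps_sh, Nat.add_sub_cancel_left, rep_full (F := (gpq (gg (mm n) (tt n)) x (mm n + 2)).1) _ _ _ le_rfl]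
  · simp [KK, LL]
  · intro N hN
    exact (gol_full hg x _ N (by rw [gg_top]; exact hN)).1

lemma R_le (hR : ∀ n, R n ≤ 2 ^ (7 * tt n)) (n : ℕ) : (R n : ℝ) ≤ 2048 * (n + 2) := by
  have h1 := hR n
  have h2 := tt_up n
  have h3 : 2 ^ (7 * tt n) ≤ 2 ^ (11 * tt n) := Nat.pow_le_pow_right (by norm_num) (by omega)
  have : R n ≤ 2048 * (n + 2) := by omega
  exact_mod_cast this

lemma hh_eq (n : ℕ) : hh n = 2 ^ ((n+5)^2) := by
  unfold hh mm; rw [pow_mul, Real.sq_sqrt (by norm_num)]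

lemma hh_lt {i n : ℕ} (h : i < n) : hh i ≤ hh n / 2 ^ n := by
  rw [hh_eq, hh_eq, le_div_iff₀ (by positivity), ← pow_add]
  apply pow_le_pow_right₀ (by norm_num)
  nlinarith

noncomputable def eps (C : ℝ) (n : ℕ) : ℝ := (7000 + 9000 * C) * ((n+2)^2 / 2 ^ n)

set_option maxHeartbeats 2000000 in
lemma main_err (hR : ∀ n, R n ≤ 2 ^ (7 * tt n)) {n N : ℕ} (hN : N ≤ KK (n+1)) {x : ℝ} (hx : ee x ≠ 1) :
    ‖ps (aa R) N x - ps (bb R n) N x‖ ≤ eps (Cx x) n * hh n := by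
  rw [ps_aa hN, sum_sub_distrib, sum_range_succ]
  set C := Cx x with hC
  have hC0 : 0 ≤ C := Cx_nonneg x
  have h8 : √8 ≤ 3 := by rw [Real.sqrt_le_left (by norm_num)]; norm_num
  have e : ps (fun _ => 1) N x + (∑ i ∈ range n, ps (bb R i) N x + ps (bb R n) N x -
      ∑ i ∈ range (n+1), ps (fun k => |bb R i k|) N x) - ps (bb R n) N x =
      ps (fun _ => 1) N x + ∑ i ∈ range n, ps (bb R i) N x -
      ∑ i ∈ range (n+1), ps (fun k => |bb R i k|) N x := by ring
  rw [e]
  have b1 : ‖∑ i ∈ range n, ps (bb R i) N x‖ ≤ n * (7000 * (n+2) * (hh n / 2 ^ n)) := by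
    refine (norm_sum_le_of_le (range n) (f := fun i => ps (bb R i) N x) (n := fun _ => 7000 * (n+2) * (hh n / 2 ^ n)) ?_).trans (by simp)
    intro i hi
    have hi := mem_range.1 hi
    refine (ps_bb i N x).trans ?_
    have h1 := R_le hR i
    have h2 := hh_lt hi
    have h3 := hh_pos i
    have h4 : (i:ℝ) ≤ n := by exact_mod_cast hi.le
    have h5 : (0:ℝ) ≤ i := Nat.cast_nonneg _
    calc R i * (√8 * hh i) + 8 * hh i ≤ (2048 * (i+2)) * (3 * hh i) + 8 * hh i := by gcongr
      _ = (6144 * (i+2) + 8) * hh i := by ring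
      _ ≤ (7000 * (n+2)) * (hh n / 2 ^ n) := by
        apply mul_le_mul _ h2 h3.le (by positivity)
        linarith
  have b2 : ‖∑ i ∈ range (n+1), ps (fun k => |bb R i k|) N x‖ ≤ (n+1) * (2048 * (n+2) * (4 * C)) := by
    refine (norm_sum_le_of_le (range (n+1)) (f := fun i => ps (fun k => |bb R i k|) N x) (n := fun _ => 2048 * (n+2) * (4 * C)) ?_).trans (by simp)
    intro i hi
    have hi := mem_range.1 hi
    refine (ps_bb_abs i N hx).trans ?_
    have h1 := R_le hR i
    have h4 : (i:ℝ) ≤ n := by exact_mod_cast (show i ≤ n by omega)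
    calc R i * (4 * C) ≤ 2048 * (i+2) * (4 * C) := by gcongr
      _ ≤ _ := by gcongr
  have b3 := ps_one hx N
  have hq : (1:ℝ) ≤ hh n / 2 ^ n := by
    rw [hh_eq, le_div_iff₀ (by positivity), one_mul]
    apply pow_le_pow_right₀ (by norm_num)
    nlinarith
  set q := hh n / 2 ^ n with hq'
  have hn : (0:ℝ) ≤ n := Nat.cast_nonneg _
  calc _ ≤ ‖ps (fun _ => 1) N x‖ + ‖∑ i ∈ range n, ps (bb R i) N x‖ +
        ‖∑ i ∈ range (n+1), ps (fun k => |bb R i k|) N x‖ :=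
        (norm_sub_le _ _).trans (by gcongr; exact norm_add_le _ _)
    _ ≤ C + n * (7000 * (n+2) * q) + (n+1) * (2048 * (n+2) * (4 * C)) := by gcongr
    _ ≤ C * q + n * (7000 * (n+2) * q) + (n+1) * (2048 * (n+2) * (4 * C)) * q := by
      have : C ≤ C * q := le_mul_of_one_le_right hC0 hq
      have : (n+1) * (2048 * (n+2) * (4 * C)) ≤ (n+1) * (2048 * (n+2) * (4 * C)) * q :=
        le_mul_of_one_le_right (by positivity) hq
      linarith
    _ = (C + n * (7000 * (n+2)) + (n+1) * (2048 * (n+2) * (4 * C))) * q := by ring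
    _ ≤ ((7000 + 9000 * C) * (n+2)^2) * q := by
      apply mul_le_mul_of_nonneg_right _ (by linarith)
      have : 0 ≤ n * C := by positivity
      have : 0 ≤ n * (n * C) := by positivity
      nlinarith
    _ = eps C n * hh n := by rw [hq', eps]; ring

lemma cos_sum (R : ℕ → ℕ) (N : ℕ) (x : ℝ) : ∑ k ∈ Icc 1 N, aa R k * Real.cos (2 * π * k * x) =
    (ps (aa R) (N+1) x).re - 1 := by
  unfold ps
  rw [sum_range_succ', Complex.add_re, Complex.re_sum, Complex.mul_re]
  have : Icc 1 N = Ico 1 (N+1) := rfl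
  rw [this, sum_Ico_eq_sum_range]
  simp only [aa_zero, Nat.add_sub_cancel, Nat.cast_zero, zero_mul, ee_zero]
  simp only [Complex.ofReal_one, Complex.one_re, Complex.one_im, mul_one, mul_zero, sub_zero, add_sub_cancel_right]
  refine sum_congr rfl fun k _ => ?_
  rw [Complex.re_ofReal_mul, ee_re, add_comm 1 k]
  congr 2; ring

lemma sum_err (hR : ∀ n, R n ≤ 2 ^ (7 * tt n)) {n N : ℕ} (hN : N < KK (n+1)) {x : ℝ} (hx : ee x ≠ 1) :
    |(∑ k ∈ Icc 1 N, aa R k * Real.cos (2 * π * k * x)) - (ps (bb R n) (N+1) x).re| ≤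
      (eps (Cx x) n + 1) * hh n := by
  have h := main_err hR (show N + 1 ≤ KK (n+1) by omega) hx
  have h1 : (1:ℝ) ≤ hh n := by rw [hh_eq]; exact one_le_pow₀ (by norm_num)
  have h2 := (Complex.abs_re_le_norm _).trans h
  rw [Complex.sub_re] at h2
  rw [cos_sum]
  rw [abs_le] at h2 ⊢
  constructor <;> nlinarith
end

attribute [irreducible] tt mm KK LL



noncomputable def ll (n : ℕ) : ℝ := Real.log (Real.log (KK n))

lemma KK_cast (n : ℕ) : (KK n : ℝ) = 2 ^ (mm n + 12 * tt n) := by unfold KK; push_cast; rfl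

lemma log_KK (n : ℕ) : Real.log (KK n) = (mm n + 12 * tt n : ℕ) * Real.log 2 := by
  rw [KK_cast, Real.log_pow]

lemma log_KK_ge (n : ℕ) : 3 ≤ Real.log (KK n) := by
  rw [log_KK]
  have h1 : 50 ≤ mm n + 12 * tt n := by
    unfold mm
    have := Nat.pow_le_pow_left (show 5 ≤ n + 5 by omega) 2
    omega
  have h2 : (50:ℝ) ≤ (mm n + 12 * tt n : ℕ) := by exact_mod_cast h1
  have := Real.log_two_gt_d9
  nlinarith

lemma ll_ge (n : ℕ) : 1 ≤ ll n := by
  unfold ll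
  have h := log_KK_ge n
  rw [Real.le_log_iff_exp_le (by linarith)]
  linarith [Real.exp_one_lt_d9]

lemma exp_le (n : ℕ) : mm n + 12 * tt n ≤ 2 ^ (28 * tt n) := by
  have a1 := tt_low n
  have a2 := tt_pos n
  have a3 : 12 * tt n ≤ 12 * 2 ^ (22 * tt n) := by
    have := (22 * tt n).lt_two_pow_self
    have h : tt n ≤ 22 * tt n := by omega
    exact Nat.mul_le_mul_left _ (h.trans this.le)
  have a4 : mm n ≤ 32 * 2 ^ (22 * tt n) := by
    rw [show 22 * tt n = 11 * tt n * 2 by ring, pow_mul 2 (11 * tt n) 2]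
    unfold mm
    generalize 2 ^ (11 * tt n) = P at *
    have h5 : n + 5 ≤ 4 * P := by omega
    have := Nat.pow_le_pow_left h5 2
    rw [mul_pow] at this
    omega
  have a5 : 64 * 2 ^ (22 * tt n) ≤ 2 ^ (28 * tt n) := by
    rw [show (64:ℕ) = 2 ^ 6 by norm_num, ← pow_add]
    exact Nat.pow_le_pow_right (by norm_num) (by omega)
  generalize 2 ^ (22 * tt n) = P at *
  generalize 2 ^ (28 * tt n) = Q at *
  omega

lemma ll_le (n : ℕ) : ll n ≤ 28 * tt n := by
  unfold ll
  have h := log_KK_ge n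
  have h1 := exp_le n
  have h2 : Real.log (KK n) ≤ 2 ^ (28 * tt n) := by
    rw [log_KK]
    have : ((mm n + 12 * tt n : ℕ) : ℝ) ≤ 2 ^ (28 * tt n) := by exact_mod_cast h1
    have h3 := Real.log_two_lt_d9
    have h4 : (0:ℝ) ≤ (mm n + 12 * tt n : ℕ) := Nat.cast_nonneg _
    exact (mul_le_of_le_one_right h4 (by linarith)).trans this
  calc _ ≤ Real.log (2 ^ (28 * tt n)) := Real.log_le_log (by linarith) h2
    _ = (28 * tt n : ℕ) * Real.log 2 := Real.log_pow _ _
    _ ≤ (28 * tt n : ℕ) * 1 := mul_le_mul_of_nonneg_left (by linarith [Real.log_two_lt_d9]) (Nat.cast_nonneg _)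
    _ = 28 * tt n := by push_cast; ring

noncomputable def DD (n : ℕ) : ℝ := √(KK n * ll n)

lemma DD_eq (n : ℕ) : DD n = hh n * 2 ^ (6 * tt n) * √(ll n) := by
  unfold DD
  rw [Real.sqrt_mul (Nat.cast_nonneg _)]
  congr 1
  rw [KK_cast, Real.sqrt_eq_iff_mul_self_eq (by positivity) (by unfold hh; positivity), ← sq, mul_pow, hh, sq_sqrt2,
    ← pow_mul, ← pow_add]
  congr 1; ring

lemma DD_ge (n : ℕ) : hh n * 2 ^ tt n ≤ DD n := by
  rw [DD_eq]
  have h1 : 1 ≤ √(ll n) := Real.one_le_sqrt.2 (ll_ge n)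
  have h2 := hh_pos n
  have h3 : (2:ℝ) ^ tt n ≤ 2 ^ (6 * tt n) := pow_le_pow_right₀ (by norm_num) (by omega)
  calc hh n * 2 ^ tt n ≤ hh n * 2 ^ (6 * tt n) := by gcongr
    _ ≤ _ := le_mul_of_one_le_right (by positivity) h1

lemma DD_pos (n : ℕ) : 0 < DD n := lt_of_lt_of_le (by have := hh_pos n; positivity) (DD_ge n)

lemma loglog_mono {a b : ℝ} (ha : 3 ≤ a) (hab : a ≤ b) : Real.log (Real.log a) ≤ Real.log (Real.log b) := by
  have : 1 ≤ Real.log a := by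
    rw [Real.le_log_iff_exp_le (by linarith)]; linarith [Real.exp_one_lt_d9]
  exact Real.log_le_log (by linarith) (Real.log_le_log (by linarith) hab)

lemma KK_ge3 (n : ℕ) : (4:ℝ) ≤ KK n := by
  rw [KK_cast]
  have : (2:ℝ)^2 ≤ 2 ^ (mm n + 12 * tt n) := pow_le_pow_right₀ (by norm_num) (by have := tt_pos n; omega)
  linarith

lemma DD_le {n N : ℕ} (h : KK n ≤ N) : DD n ≤ √(N * Real.log (Real.log N)) := by
  unfold DD
  have h1 : (KK n : ℝ) ≤ N := by exact_mod_cast h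
  have h2 := loglog_mono (by linarith [KK_ge3 n]) h1
  have h3 := ll_ge n
  apply Real.sqrt_le_sqrt
  exact mul_le_mul h1 h2 (by linarith) (by linarith [KK_ge3 n])

/-- upper comparison of the normaliser at the end of a block -/
lemma DD_end {n N : ℕ} {η : ℝ} (hη : 0 ≤ η) (h3 : 3 ≤ N) (h : (N:ℝ) ≤ KK n * (1 + η)) :
    √(N * Real.log (Real.log N)) ≤ (1 + η) * DD n := by
  have hK := KK_ge3 n
  have hl := log_KK_ge n
  have hll := ll_ge n
  have h3' : (3:ℝ) ≤ N := by exact_mod_cast h3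
  have a0 := loglog_mono h3' h
  have a1 : Real.log (KK n * (1 + η)) ≤ Real.log (KK n) * (1 + η) := by
    rw [Real.log_mul (by linarith) (by linarith)]
    have := Real.log_le_sub_one_of_pos (show 0 < 1 + η by linarith)
    nlinarith
  have a1' : 0 < Real.log (KK n * (1 + η)) := Real.log_pos (by nlinarith)
  have a2 : Real.log (Real.log (KK n * (1 + η))) ≤ ll n * (1 + η) := by
    refine (Real.log_le_log a1' a1).trans ?_
    rw [Real.log_mul (by linarith) (by linarith)]
    have := Real.log_le_sub_one_of_pos (show 0 < 1 + η by linarith)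
    change ll n + _ ≤ _
    nlinarith
  have a3 := a0.trans a2
  rw [DD, Real.sqrt_le_left (by positivity), mul_pow, Real.sq_sqrt (by positivity)]
  calc (N:ℝ) * Real.log (Real.log N) ≤ N * (ll n * (1 + η)) := by gcongr
    _ ≤ (KK n * (1 + η)) * (ll n * (1 + η)) := by gcongr
    _ = _ := by ring

noncomputable def lam (Λ : ℝ≥0∞) (n : ℕ) : ℝ := (min Λ ((tt n + 1 : ℕ) : ℝ≥0∞)).toReal

lemma lam_nonneg (Λ n) : 0 ≤ lam Λ n := ENNReal.toReal_nonneg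

lemma lam_le (Λ n) : lam Λ n ≤ tt n + 1 := by
  unfold lam
  have := ENNReal.toReal_mono (ENNReal.natCast_ne_top (tt n + 1)) (min_le_right Λ ((tt n + 1 : ℕ) : ℝ≥0∞))
  rw [ENNReal.toReal_natCast] at this
  push_cast at this ⊢
  exact this

lemma lam_tendsto (Λ : ℝ≥0∞) : Tendsto (fun n => ENNReal.ofReal (lam Λ n)) atTop (nhds Λ) := by
  have e : (fun n => ENNReal.ofReal (lam Λ n)) = fun n => min Λ ((tt n + 1 : ℕ) : ℝ≥0∞) := by
    funext n
    exact ENNReal.ofReal_toReal (ne_top_of_le_ne_top (ENNReal.natCast_ne_top _) (min_le_right _ _))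
  rw [e]
  have h1 : Tendsto (fun n => ((tt n + 1 : ℕ) : ℝ≥0∞)) atTop (nhds ∞) :=
    ENNReal.tendsto_nat_nhds_top.comp ((tendsto_add_atTop_nat 1).comp tt_tendsto)
  have h2 := (tendsto_const_nhds (x := Λ)).min h1
  simpa using h2

noncomputable def RR (Λ : ℝ≥0∞) (n : ℕ) : ℕ :=
  min ⌊lam Λ n * 2 ^ (6 * tt n) * √(ll n / 8)⌋₊ (2 ^ (7 * tt n))

lemma RR_le (Λ : ℝ≥0∞) (n : ℕ) : RR Λ n ≤ 2 ^ (7 * tt n) := min_le_right _ _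

lemma sqrt_ll8 (n : ℕ) : √(ll n / 8) * √8 = √(ll n) := by
  rw [← Real.sqrt_mul (by linarith [ll_ge n])]; congr 1; ring

lemma RR_up (Λ : ℝ≥0∞) (n : ℕ) : RR Λ n * (√8 * hh n) ≤ lam Λ n * DD n := by
  have hl := lam_nonneg Λ n
  have h1 : (RR Λ n : ℝ) ≤ lam Λ n * 2 ^ (6 * tt n) * √(ll n / 8) := by
    refine le_trans ?_ (Nat.floor_le (by positivity))
    exact Nat.cast_le.2 (min_le_left _ _)
  have := hh_pos n
  calc RR Λ n * (√8 * hh n) ≤ (lam Λ n * 2 ^ (6 * tt n) * √(ll n / 8)) * (√8 * hh n) := by gcongr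
    _ = lam Λ n * (hh n * 2 ^ (6 * tt n) * (√(ll n / 8) * √8)) := by ring
    _ = _ := by rw [sqrt_ll8, DD_eq]

lemma sq_lt_pow {t : ℕ} (ht : 7 ≤ t) : (t + 1) * (2 * t) ≤ 2 ^ t := by
  induction t, ht using Nat.le_induction with
  | base => norm_num
  | succ t ht ih => rw [pow_succ]; nlinarith

lemma RR_low (Λ : ℝ≥0∞) {n : ℕ} (ht : 7 ≤ tt n) : lam Λ n * DD n - √8 * hh n ≤ RR Λ n * (√8 * hh n) := by
  have hl := lam_nonneg Λ n
  have hl' := lam_le Λ n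
  have h8 : lam Λ n * 2 ^ (6 * tt n) * √(ll n / 8) ≤ 2 ^ (7 * tt n) := by
    have a1 : √(ll n / 8) ≤ 2 * tt n := by
      rw [Real.sqrt_le_left (by positivity)]
      have := ll_le n
      have : (1:ℝ) ≤ tt n := by exact_mod_cast tt_pos n
      nlinarith
    have a2 : ((tt n:ℝ) + 1) * (2 * tt n) ≤ 2 ^ tt n := by exact_mod_cast sq_lt_pow ht
    calc lam Λ n * 2 ^ (6 * tt n) * √(ll n / 8) ≤ (tt n + 1) * 2 ^ (6 * tt n) * (2 * tt n) := by gcongr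
      _ = (((tt n:ℝ) + 1) * (2 * tt n)) * 2 ^ (6 * tt n) := by ring
      _ ≤ 2 ^ tt n * 2 ^ (6 * tt n) := by gcongr
      _ = _ := by rw [← pow_add]; congr 1; ring
  have h1 : lam Λ n * 2 ^ (6 * tt n) * √(ll n / 8) - 1 ≤ (RR Λ n : ℝ) := by
    unfold RR
    rw [Nat.cast_min]
    apply le_min
    · linarith [Nat.lt_floor_add_one (lam Λ n * 2 ^ (6 * tt n) * √(ll n / 8))]
    · push_cast; linarith
  have hh0 := hh_pos n
  have h2 := mul_le_mul_of_nonneg_right h1 (show 0 ≤ √8 * hh n by positivity)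
  refine le_trans (le_of_eq ?_) h2
  have : (lam Λ n * 2 ^ (6 * tt n) * √(ll n / 8)) * (√8 * hh n) = lam Λ n * DD n := by
    rw [DD_eq, ← sqrt_ll8]; ring
  rw [sub_mul, this]; ring

noncomputable def del (C : ℝ) (n : ℕ) : ℝ := (501 * (tt n + 1) + 9 + eps C n) / 2 ^ tt n

lemma eps_nonneg {C : ℝ} (hC : 0 ≤ C) (n : ℕ) : 0 ≤ eps C n := by unfold eps; positivity

lemma del_nonneg {C : ℝ} (hC : 0 ≤ C) (n : ℕ) : 0 ≤ del C n := by
  have := eps_nonneg hC n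
  unfold del; positivity

lemma eps_tendsto (C : ℝ) : Tendsto (eps C) atTop (nhds 0) := by
  have h := tendsto_pow_const_div_const_pow_of_one_lt 2 (show (1:ℝ) < 2 by norm_num)
  have h2 := ((tendsto_add_atTop_iff_nat 2).2 h).const_mul ((7000 + 9000 * C) * 4)
  rw [mul_zero] at h2
  refine h2.congr fun n => ?_
  unfold eps
  push_cast
  rw [pow_add]
  field_simp
  ring

lemma del_tendsto (C : ℝ) : Tendsto (del C) atTop (nhds 0) := by
  have hp : Tendsto (fun n => (2:ℝ) ^ tt n) atTop atTop :=
    (tendsto_pow_atTop_atTop_of_one_lt (by norm_num)).comp tt_tendsto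
  have h0 := (tendsto_pow_const_div_const_pow_of_one_lt 1 (show (1:ℝ) < 2 by norm_num)).comp tt_tendsto
  have h1 := (eps_tendsto C).mul hp.inv_tendsto_atTop
  have h2 := hp.inv_tendsto_atTop.const_mul 510
  have h3 := ((h0.const_mul 501).add h2).add h1
  simp only [mul_zero, add_zero] at h3
  refine h3.congr fun n => ?_
  simp only [Function.comp, del, Pi.inv_apply]
  field_simp
  ring

lemma upper (Λ : ℝ≥0∞) {n N : ℕ} (h1 : KK n ≤ N) (h2 : N < KK (n+1)) {x : ℝ} (hx : ee x ≠ 1) :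
    |∑ k ∈ Icc 1 N, aa (RR Λ) k * Real.cos (2 * π * k * x)| / √(N * Real.log (Real.log N)) ≤
      lam Λ n + del (Cx x) n := by
  have hD := DD_le h1
  have hD0 := DD_pos n
  have hC := Cx_nonneg x
  have he := eps_nonneg hC n
  have hd := del_nonneg hC n
  have hl := lam_nonneg Λ n
  rw [div_le_iff₀ (by linarith)]
  refine le_trans ?_ (mul_le_mul_of_nonneg_left hD (by linarith))
  have b := sum_err (RR_le Λ) h2 hx
  have c := (Complex.abs_re_le_norm _).trans (ps_bb (R := RR Λ) n (N+1) x)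
  have d := RR_up Λ n
  set S := ∑ k ∈ Icc 1 N, aa (RR Λ) k * Real.cos (2 * π * k * x)
  have e : |S| ≤ |S - (ps (bb (RR Λ) n) (N+1) x).re| + |(ps (bb (RR Λ) n) (N+1) x).re| := by
    have := abs_add_le (S - (ps (bb (RR Λ) n) (N+1) x).re) ((ps (bb (RR Λ) n) (N+1) x).re)
    simpa using this
  have f : (eps (Cx x) n + 9) * hh n ≤ del (Cx x) n * DD n := by
    have : (eps (Cx x) n + 9) * hh n ≤ del (Cx x) n * (hh n * 2 ^ tt n) := by
      have : del (Cx x) n * (hh n * 2 ^ tt n) = (501 * (tt n + 1) + 9 + eps (Cx x) n) * hh n := by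
        unfold del; field_simp
      rw [this]
      have := hh_pos n
      have h0 : (0:ℝ) ≤ tt n := Nat.cast_nonneg _
      apply mul_le_mul_of_nonneg_right _ this.le
      linarith
    exact this.trans (mul_le_mul_of_nonneg_left (DD_ge n) hd)
  nlinarith

noncomputable def NN (Λ : ℝ≥0∞) (n : ℕ) : ℕ := KK n + RR Λ n * LL n - 1

lemma real_fin {l τ E q D h : ℝ} (hq : 0 ≤ q) (hD : 0 ≤ D) (hE : 0 ≤ E) (hτ : 0 ≤ τ)
    (e4 : (E + 4) * h ≤ (E + 4) * (q * D)) (e6 : l * (q * D) ≤ (τ + 1) * (q * D)) :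
    (l - (501 * (τ + 1) + 9 + E) * q) * ((1 + q) * D) ≤
      l * D - 3 * h - l * D * (500 * q) - (E + 1) * h := by
  have h1 : 0 ≤ ((501 * (τ + 1) + 9 + E) * q) * (q * D) := by positivity
  have h2 : 0 ≤ q * D := by positivity
  have : (l - (501 * (τ + 1) + 9 + E) * q) * ((1 + q) * D) =
    l * D + l * (q * D) - (501 * (τ + 1) + 9 + E) * (q * D) - ((501 * (τ + 1) + 9 + E) * q) * (q * D) := by ring
  rw [this]
  nlinarith

set_option maxHeartbeats 2000000 in
lemma lower (Λ : ℝ≥0∞) {n : ℕ} (ht : 7 ≤ tt n) {x : ℝ} (hx : ee x ≠ 1) (hit_x : x ∈ hit (mm n) (tt n)) :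
    lam Λ n - del (Cx x) n ≤
    |∑ k ∈ Icc 1 (NN Λ n), aa (RR Λ) k * Real.cos (2 * π * k * x)| /
      √((NN Λ n : ℕ) * Real.log (Real.log (NN Λ n : ℕ))) := by
  set S := ∑ k ∈ Icc 1 (NN Λ n), aa (RR Λ) k * Real.cos (2 * π * k * x) with hS
  set D := √((NN Λ n : ℕ) * Real.log (Real.log (NN Λ n : ℕ))) with hDdef
  rcases le_or_gt (lam Λ n - del (Cx x) n) 0 with hneg | hpos
  · exact hneg.trans (by positivity)
  have hK4 : 4 ≤ KK n := by exact_mod_cast KK_ge3 n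
  have hRL := RL_le (RR_le Λ) n
  have hRL' := RL_le' (RR_le Λ) n
  have hKs := KK_succ n
  have hN1 : NN Λ n + 1 = KK n + RR Λ n * LL n := by unfold NN; omega
  have hN3 : 3 ≤ NN Λ n := by omega
  have hC := Cx_nonneg x
  have he := eps_nonneg hC n
  have hd := del_nonneg hC n
  have hl := lam_nonneg Λ n
  have hl' := lam_le Λ n
  have hD0 := DD_pos n
  set q : ℝ := 1 / 2 ^ tt n with hq
  have hq0 : 0 < q := by positivity
  have hq1 : q ≤ 1 := by rw [hq, div_le_one (by positivity)]; exact one_le_pow₀ (by norm_num)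
  have hDe : D ≤ (1 + q) * DD n := by
    refine DD_end hq0.le hN3 ?_
    have a1 : ((NN Λ n : ℕ) : ℝ) + 1 = KK n + RR Λ n * LL n := by exact_mod_cast hN1
    have a2 : (RR Λ n : ℝ) * LL n * 2 ^ (2 * tt n) ≤ KK n := by exact_mod_cast hRL
    have a3 : (RR Λ n : ℝ) * LL n * 2 ^ tt n ≤ KK n := by
      refine le_trans ?_ a2
      exact mul_le_mul_of_nonneg_left (pow_le_pow_right₀ (by norm_num) (Nat.le_mul_of_pos_left _ (by norm_num)))
        (by positivity)
    have a4 : (RR Λ n : ℝ) * LL n ≤ KK n * q := by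
      rw [hq, mul_one_div, le_div_iff₀ (by positivity)]; exact a3
    linarith
  have hD1 : 0 < D := by
    rw [hDdef]
    apply Real.sqrt_pos.2
    have h3 : (3:ℝ) ≤ (NN Λ n : ℕ) := by exact_mod_cast hN3
    apply mul_pos (by linarith)
    apply Real.log_pos
    rw [Real.lt_log_iff_exp_lt (by linarith)]
    linarith [Real.exp_one_lt_d9]
  rw [le_div_iff₀ hD1]
  refine (mul_le_mul_of_nonneg_left hDe hpos.le).trans ?_
  have b := sum_err (RR_le Λ) (show NN Λ n < KK (n+1) by omega) hx
  rw [← hS, hN1, ps_bb_full] at b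
  have c := hit_est (mm_pos n) (tt_pos n) (RR_le Λ n) hit_x
  rw [← hq] at c
  change RR Λ n * hh n * _ ≤ _ at c
  have d := RR_up Λ n
  have d' := RR_low Λ ht
  set T := (ee (2 ^ (mm n + 12 * tt n) * x) * ((gpq (gg (mm n) (tt n)) x (mm n + 2)).1 *
        ∑ r ∈ range (RR Λ n), ee (r * (2 ^ (mm n+3*tt n) * x)))).re
  have hT : T - (eps (Cx x) n + 1) * hh n ≤ |S| := by
    have := (abs_le.1 b).1
    have := le_abs_self S
    linarith
  refine le_trans ?_ hT
  have s8 : 1 ≤ √8 := Real.one_le_sqrt.2 (by norm_num)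
  have s8' : √8 ≤ 3 := by rw [Real.sqrt_le_left (by norm_num)]; norm_num
  have hh0 := hh_pos n
  have e1 : RR Λ n * hh n ≤ lam Λ n * DD n := by
    refine le_trans ?_ d
    have : 0 ≤ RR Λ n * hh n := by positivity
    nlinarith
  have e2 : hh n ≤ q * DD n := by
    have := DD_ge n
    rw [hq, one_div_mul_eq_div, le_div_iff₀ (by positivity)]; exact this
  have e3 : lam Λ n * DD n - 3 * hh n - lam Λ n * DD n * (500 * q) - (eps (Cx x) n + 1) * hh n ≤
      T - (eps (Cx x) n + 1) * hh n := by
    have f1 := mul_le_mul_of_nonneg_right e1 (show 0 ≤ 500 * q by positivity)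
    have f2 := mul_le_mul_of_nonneg_right s8' hh0.le
    have : RR Λ n * hh n * (√8 - 500 * q) = RR Λ n * (√8 * hh n) - RR Λ n * hh n * (500 * q) := by ring
    linarith
  refine le_trans ?_ e3
  have e4 : (eps (Cx x) n + 4) * hh n ≤ (eps (Cx x) n + 4) * (q * DD n) :=
    mul_le_mul_of_nonneg_left e2 (by linarith)
  have e5 : del (Cx x) n = (501 * (tt n + 1) + 9 + eps (Cx x) n) * q := by
    rw [hq, del]; ring
  have e6 : lam Λ n * (q * DD n) ≤ (tt n + 1) * (q * DD n) :=
    mul_le_mul_of_nonneg_right hl' (by positivity)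
  rw [e5]
  exact real_fin hq0.le hD0.le he (Nat.cast_nonneg _) e4 e6

lemma ee_ne_one_ae : ∀ᵐ x ∂(volume : Measure ℝ), ee x ≠ 1 := by
  have hc : Set.Countable (Set.range (fun n : ℤ => (n:ℝ))) := Set.countable_range _
  filter_upwards [hc.ae_notMem volume] with x hx h
  unfold ee at h
  rw [Complex.exp_eq_one_iff] at h
  obtain ⟨n, hn⟩ := h
  apply hx
  refine ⟨n, ?_⟩
  have h2 : (2 * π * x : ℝ) = n * (2 * π) := by
    have := congrArg Complex.im hn
    simpa using this
  have hp : (0:ℝ) < 2 * π := by positivity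
  have : 2 * π * (n:ℝ) = 2 * π * x := by rw [h2]; ring
  exact mul_left_cancel₀ hp.ne' this

lemma final (Λ : ℝ≥0∞) :
    ∀ᵐ x ∂(volume : Measure ℝ),
        Filter.atTop.limsup (fun N : ℕ =>
            ENNReal.ofReal (|∑ k ∈ Finset.Icc 1 N, aa (RR Λ) k * Real.cos (2 * π * k * x)| /
              Real.sqrt (N * Real.log (Real.log N))))
          = Λ := by
  filter_upwards [hits_all, ee_ne_one_ae] with x hx1 hx
  have hC := Cx_nonneg x
  have hδ : Tendsto (fun n => ENNReal.ofReal (del (Cx x) n)) atTop (nhds 0) := by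
    rw [← ENNReal.ofReal_zero]
    exact ENNReal.tendsto_ofReal (del_tendsto _)
  apply le_antisymm
  · have hT : Tendsto (fun n => ENNReal.ofReal (lam Λ n + del (Cx x) n)) atTop (nhds Λ) := by
      have := (lam_tendsto Λ).add hδ
      rw [add_zero] at this
      refine this.congr fun n => ?_
      exact (ENNReal.ofReal_add (lam_nonneg _ _) (del_nonneg hC _)).symm
    refine le_of_forall_gt fun c hc => ?_
    have hev := (hT.eventually (gt_mem_nhds hc))
    obtain ⟨c', hc1, hc2⟩ := exists_between hc
    have hev := (hT.eventually (gt_mem_nhds hc1))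
    obtain ⟨n₀, hn₀⟩ := eventually_atTop.1 hev
    refine lt_of_le_of_lt (limsup_le_of_le (h := ?_)) hc2
    filter_upwards [eventually_ge_atTop (KK n₀)] with N hN
    have hex : ∃ n, n₀ ≤ n ∧ KK n ≤ N ∧ N < KK (n+1) := by
      have hP : ∃ n, N < KK (n+1) := ⟨N, by have := KK_gt (N+1); omega⟩
      classical
      refine ⟨max n₀ (Nat.find hP), le_max_left _ _, ?_, ?_⟩
      · rcases le_total n₀ (Nat.find hP) with h | h
        · rw [max_eq_right h]
          rcases Nat.eq_zero_or_pos (Nat.find hP) with h0 | h0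
          · rw [h0]; rw [h0] at h; have : n₀ = 0 := by omega
            rw [← this]; exact hN
          · have := Nat.find_min hP (show Nat.find hP - 1 < Nat.find hP by omega)
            rw [show Nat.find hP - 1 + 1 = Nat.find hP by omega] at this
            omega
        · rw [max_eq_left h]; exact hN
      · exact (Nat.find_spec hP).trans_le (KK_strict.monotone (by omega))
    obtain ⟨n, hn, h1, h2⟩ := hex
    exact (ENNReal.ofReal_le_ofReal (upper Λ h1 h2 hx)).trans (hn₀ n hn).le
  · have hT : Tendsto (fun n => ENNReal.ofReal (lam Λ n - del (Cx x) n)) atTop (nhds Λ) := by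
      have := ENNReal.Tendsto.sub (lam_tendsto Λ) hδ (Or.inr ENNReal.zero_ne_top)
      rw [tsub_zero] at this
      refine this.congr fun n => ?_
      exact (ENNReal.ofReal_sub _ (del_nonneg hC _)).symm
    refine le_of_forall_lt fun c hc => ?_
    obtain ⟨c', hc1, hc2⟩ := exists_between hc
    refine lt_of_lt_of_le hc1 (le_limsup_of_frequently_le ?_ )
    have hev := (hT.eventually (lt_mem_nhds hc2)).and (tt_tendsto.eventually_ge_atTop 7)
    have hfr := hx1.and_eventually hev
    rw [frequently_atTop] at hfr ⊢
    intro a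
    obtain ⟨n, hn, hhit, hlt, ht⟩ := hfr a
    refine ⟨NN Λ n, ?_, hlt.le.trans (ENNReal.ofReal_le_ofReal (lower Λ ht hx hhit))⟩
    have := KK_gt n
    unfold NN; omega

/-- **Corollary 1.** For any `Λ ∈ [0,∞]` there is a sequence of signs `a_k ∈ {−1,1}` such that
the limsup in the LIL for `∑ a_k cos 2πkx` equals `Λ` almost everywhere (the limsup being taken
in the extended nonnegative reals, so the value `∞` is allowed). -/
theorem littlewood_signs_lil (Λ : ℝ≥0∞) :
    ∃ a : ℕ → ℝ,
      (∀ k, 1 ≤ k → a k = 1 ∨ a k = -1) ∧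
      (∀ᵐ x ∂(volume : Measure ℝ),
        Filter.atTop.limsup (fun N : ℕ =>
            ENNReal.ofReal (|∑ k ∈ Finset.Icc 1 N, a k * Real.cos (2 * π * k * x)| /
              Real.sqrt (N * Real.log (Real.log N))))
          = Λ) := by
  exact ⟨aa (RR Λ), fun k _ => aa_sign (RR_le Λ) k, final Λ⟩
end

section
/- For any ε > 0 and almost every real number x, the star-discrepancy of the fractional parts of the first N odd multiples of x satisfies D_N*(⟨x⟩, ⟨3x⟩, …, ⟨(2N−1)x⟩) = O( (log N)(log log N)^{1+ε} / N ) as N → ∞. -/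
open MeasureTheory Filter Finset Real Asymptotics

/-- The star-discrepancy of the points `y 1, …, y N`:
`D_N^*(y_1,…,y_N) = sup_{0 ≤ a ≤ 1} |(1/N) ∑_{k=1}^N 1_{[0,a]}(y_k) − a|`. -/
noncomputable def starDiscrepancy (N : ℕ) (y : ℕ → ℝ) : ℝ :=
  sSup {v : ℝ | ∃ a : ℝ, 0 ≤ a ∧ a ≤ 1 ∧
    v = |(∑ k ∈ Finset.Icc 1 N, (if 0 ≤ y k ∧ y k ≤ a then (1:ℝ) else 0)) / N - a|}

lemma dom_sum_perm (q : ℕ) (hq : 0 < q) (p m : ℤ) (h : IsCoprime p (q : ℤ)) (f : ℤ → ℝ) :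
    ∑ k ∈ range q, f ((m + k * p) % q) = ∑ j ∈ range q, f (j : ℤ) := by
  have hq' : (0 : ℤ) < q := by exact_mod_cast hq
  have hinj : Set.InjOn (fun k : ℕ => ((m + k * p) % q).toNat) (range q : Finset ℕ) := by
    intro k hk l hl hkl
    simp only [coe_range, Set.mem_Iio] at hk hl
    have h1 : (m + k * p) % q = (m + l * p) % q := by
      have a1 := Int.emod_nonneg (m + k * p) hq'.ne'
      have a2 := Int.emod_nonneg (m + l * p) hq'.ne'
      simp only at hkl
      omega
    have h2 : (q : ℤ) ∣ ((l : ℤ) - k) * p := by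
      have := Int.ModEq.dvd h1
      rwa [show (m + l * p) - (m + k * p) = ((l : ℤ) - k) * p by ring] at this
    have h3 : (q : ℤ) ∣ ((l : ℤ) - k) := h.symm.dvd_of_dvd_mul_right h2
    have h4 : ((l : ℤ) - k) = 0 := by
      apply Int.eq_zero_of_abs_lt_dvd h3
      rw [abs_lt]; omega
    omega
  have himg : (range q).image (fun k : ℕ => ((m + k * p) % q).toNat) = range q := by
    apply Finset.eq_of_subset_of_card_le
    · intro x hx
      rw [Finset.mem_image] at hx
      obtain ⟨k, _, rfl⟩ := hx
      rw [Finset.mem_range]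
      have a1 := Int.emod_nonneg (m + k * p) hq'.ne'
      have a2 := Int.emod_lt_of_pos (m + k * p) hq'
      omega
    · rw [Finset.card_image_of_injOn hinj]
  conv_rhs => rw [← himg]
  rw [Finset.sum_image hinj]
  apply Finset.sum_congr rfl
  intro k _
  rw [Int.toNat_of_nonneg (Int.emod_nonneg _ hq'.ne')]

lemma dom_fract_sum (q : ℕ) (hq : 0 < q) (p : ℤ) (h : IsCoprime p (q : ℤ)) (γ : ℝ) :
    ((q : ℝ) - 1) / 2 ≤ ∑ k ∈ range q, Int.fract (γ + k * ((p : ℝ) / q)) ∧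
    ∑ k ∈ range q, Int.fract (γ + k * ((p : ℝ) / q)) ≤ ((q : ℝ) + 1) / 2 := by
  have hq' : (0 : ℝ) < q := by exact_mod_cast hq
  have hqz : (0 : ℤ) < q := by exact_mod_cast hq
  set m : ℤ := ⌊q * γ⌋ with hm
  set θ : ℝ := Int.fract (q * γ) with hθ
  have hθ0 : 0 ≤ θ := Int.fract_nonneg _
  have hθ1 : θ < 1 := Int.fract_lt_one _
  have hγ : q * γ = m + θ := by rw [hm, hθ, Int.floor_add_fract]
  have key : ∀ k ∈ range q, Int.fract (γ + k * ((p : ℝ) / q)) =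
      (fun j : ℤ => ((j : ℝ) + θ) / q) ((m + k * p) % q) := by
    intro k _
    simp only
    rw [Int.fract_eq_iff]
    have a1 := Int.emod_nonneg (m + k * p) hqz.ne'
    have a2 := Int.emod_lt_of_pos (m + k * p) hqz
    have b1 : (0 : ℝ) ≤ (((m + k * p) % q : ℤ) : ℝ) := by exact_mod_cast a1
    have b2 : (((m + k * p) % q : ℤ) : ℝ) + 1 ≤ q := by exact_mod_cast a2
    refine ⟨by positivity, ?_, (m + k * p) / q, ?_⟩
    · rw [div_lt_one hq']; linarith
    · have e := Int.emod_add_mul_ediv (m + k * p) q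
      have e' : (((m + k * p) % q : ℤ) : ℝ) + q * (((m + k * p) / q : ℤ) : ℝ) = m + k * p := by
        exact_mod_cast e
      field_simp
      linarith
  rw [Finset.sum_congr rfl key, dom_sum_perm q hq p m h (fun j : ℤ => ((j : ℝ) + θ) / q)]
  have e2 : ∑ j ∈ range q, (((j : ℤ) : ℝ) + θ) / q = ((q : ℝ) - 1) / 2 + θ := by
    rw [← Finset.sum_div, Finset.sum_add_distrib]
    have := Finset.sum_range_id_mul_two q
    have h3 : (∑ i ∈ range q, (i : ℝ)) * 2 = q * (q - 1) := by
      have h4 : ((∑ i ∈ range q, i : ℕ) : ℝ) * 2 = ((q * (q - 1) : ℕ) : ℝ) := by exact_mod_cast this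
      rw [Nat.cast_mul, Nat.cast_sub hq] at h4
      push_cast at h4
      exact h4
    simp only [Int.cast_natCast, Finset.sum_const, card_range, nsmul_eq_mul]
    field_simp
    linarith
  simp only [e2]
  constructor <;> linarith

lemma dom_saw_block (q : ℕ) (hq : 0 < q) (p : ℤ) (h : IsCoprime p (q : ℤ)) (α γ : ℝ)
    (hα : |q * α - p| ≤ 1 / q) :
    |∑ k ∈ range q, (Int.fract (γ + k * α) - 1 / 2)| ≤ 5 / 2 := by
  have hq' : (0 : ℝ) < q := by exact_mod_cast hq
  have hη : ∀ k ∈ range q, |k * α - k * ((p : ℝ) / q)| ≤ 1 / q := by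
    intro k hk
    have hk' : (k : ℝ) ≤ q := by exact_mod_cast (Finset.mem_range.1 hk).le
    have : k * α - k * ((p : ℝ) / q) = (k / q) * (q * α - p) := by field_simp
    rw [this, abs_mul, abs_of_nonneg (by positivity)]
    calc (k : ℝ) / q * |q * α - p| ≤ 1 * |q * α - p| := by
          gcongr
          rw [div_le_one hq']; exact hk'
      _ ≤ _ := by linarith
  obtain ⟨l1, -⟩ := dom_fract_sum q hq p h (γ + 1 / q)
  obtain ⟨-, u2⟩ := dom_fract_sum q hq p h (γ - 1 / q)
  have A : ∑ k ∈ range q, Int.fract (γ + 1 / q + k * ((p : ℝ) / q)) ≤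
      ∑ k ∈ range q, (Int.fract (γ + k * α) + 2 / q) := by
    apply Finset.sum_le_sum
    intro k hk
    have h1 := abs_le.1 (hη k hk)
    have h2 : ⌊γ + k * α⌋ ≤ ⌊γ + 1 / q + k * ((p : ℝ) / q)⌋ := Int.floor_mono (by linarith)
    have h3 : (⌊γ + k * α⌋ : ℝ) ≤ ⌊γ + 1 / q + k * ((p : ℝ) / q)⌋ := by exact_mod_cast h2
    rw [Int.fract, Int.fract]
    have : (2 : ℝ) / q = 1 / q + 1 / q := by ring
    linarith
  have B : ∑ k ∈ range q, Int.fract (γ + k * α) ≤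
      ∑ k ∈ range q, (Int.fract (γ - 1 / q + k * ((p : ℝ) / q)) + 2 / q) := by
    apply Finset.sum_le_sum
    intro k hk
    have h1 := abs_le.1 (hη k hk)
    have h2 : ⌊γ - 1 / q + k * ((p : ℝ) / q)⌋ ≤ ⌊γ + k * α⌋ := Int.floor_mono (by linarith)
    have h3 : (⌊γ - 1 / q + k * ((p : ℝ) / q)⌋ : ℝ) ≤ ⌊γ + k * α⌋ := by exact_mod_cast h2
    rw [Int.fract, Int.fract]
    have : (2 : ℝ) / q = 1 / q + 1 / q := by ring
    linarith
  rw [Finset.sum_add_distrib] at A B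
  simp only [Finset.sum_const, card_range, nsmul_eq_mul] at A B
  have e : (q : ℝ) * (2 / q) = 2 := by field_simp
  rw [Finset.sum_sub_distrib]
  simp only [Finset.sum_const, card_range, nsmul_eq_mul]
  rw [abs_le]
  constructor <;> linarith

/-- Continuants. -/
def domQ (a : ℕ → ℕ) : ℕ → ℕ
  | 0 => 1
  | 1 => a 0
  | n + 2 => a (n + 1) * domQ a (n + 1) + domQ a n

/-- Numerators. -/
def domP (a : ℕ → ℕ) : ℕ → ℕ
  | 0 => 0
  | 1 => 1
  | n + 2 => a (n + 1) * domP a (n + 1) + domP a n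

lemma domQ_pos (a : ℕ → ℕ) (ha : ∀ n, 1 ≤ a n) : ∀ n, 0 < domQ a n ∧ domQ a n ≤ domQ a (n + 1)
  | 0 => ⟨by simp [domQ], by simpa [domQ] using ha 0⟩
  | n + 1 => by
    obtain ⟨h1, h2⟩ := domQ_pos a ha n
    refine ⟨by omega, ?_⟩
    rw [domQ]
    nlinarith [ha (n + 1)]

lemma domQ_step (a : ℕ → ℕ) (ha : ∀ n, 1 ≤ a n) (n : ℕ) :
    domQ a (n + 1) ≤ (a n + 1) * domQ a n := by
  cases n with
  | zero => simp [domQ]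
  | succ n =>
    rw [domQ]
    have := (domQ_pos a ha n).2
    linarith

lemma domQ_growth (a : ℕ → ℕ) (ha : ∀ n, 1 ≤ a n) (n : ℕ) : 2 ^ n ≤ domQ a (2 * n) := by
  induction n with
  | zero => simp [domQ]
  | succ n ih =>
    have : 2 * (n + 1) = 2 * n + 2 := by ring
    rw [this, domQ, pow_succ]
    have h1 := (domQ_pos a ha (2 * n)).2
    nlinarith [ha (2 * n + 1)]

lemma dom_det (a : ℕ → ℕ) (n : ℕ) :
    (domQ a (n + 1) : ℤ) * domP a n - domP a (n + 1) * domQ a n = (-1) ^ (n + 1) := by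
  induction n with
  | zero => simp [domQ, domP]
  | succ n ih =>
    rw [domQ, domP, pow_succ, ← ih]
    push_cast
    ring

/-- `α` is well approximated by fractions with denominators `domQ a n`. -/
def DomGood (a : ℕ → ℕ) (α : ℝ) : Prop :=
  ∀ n, ∃ p : ℤ, IsCoprime p (domQ a n : ℤ) ∧ |domQ a n * α - p| ≤ 1 / domQ a n

lemma DomGood.neg {a : ℕ → ℕ} {α : ℝ} (h : DomGood a α) : DomGood a (-α) := by
  intro n
  obtain ⟨p, h1, h2⟩ := h n
  refine ⟨-p, h1.neg_left, ?_⟩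
  rw [← abs_neg]
  convert h2 using 2
  push_cast; ring

lemma DomGood.add_int {a : ℕ → ℕ} {α : ℝ} (h : DomGood a α) (z : ℤ) : DomGood a (α + z) := by
  intro n
  obtain ⟨p, h1, h2⟩ := h n
  refine ⟨p + z * domQ a n, ?_, ?_⟩
  · exact (IsCoprime.add_mul_right_left_iff).2 h1
  convert h2 using 2
  push_cast; ring

lemma dom_good_of_cf (t : ℕ → ℝ) (a : ℕ → ℕ) (ha : ∀ n, 1 ≤ a n) (ht : ∀ n, 0 < t n)
    (hat : ∀ n, 1 / t n = a n + t (n + 1)) : DomGood a (t 0) := by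
  set δ : ℕ → ℝ := fun n => domQ a n * t 0 - domP a n with hδ
  have hrec : ∀ n, δ (n + 1) = - t (n + 1) * δ n := by
    intro n
    induction n with
    | zero =>
      have := hat 0
      have h0 := ht 0
      simp only [hδ, domQ, domP]
      field_simp at this
      push_cast
      linarith
    | succ n ih =>
      have h1 := hat (n + 1)
      have h0 := ht (n + 1)
      have e : δ (n + 2) = a (n + 1) * δ (n + 1) + δ n := by
        simp only [hδ]
        rw [domQ, domP]; push_cast; ring
      have e2 : δ n = - (1 / t (n + 1)) * δ (n + 1) := by rw [ih]; field_simp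
      rw [show n + 1 + 1 = n + 2 from rfl, e, e2, h1]
      ring
  have hsign : ∀ n, 0 < (-1 : ℝ) ^ n * δ n := by
    intro n
    induction n with
    | zero => simpa [hδ, domQ, domP] using ht 0
    | succ n ih =>
      rw [hrec, pow_succ]
      have := mul_pos (ht (n + 1)) ih
      linarith
  intro n
  have hdet := dom_det a n
  refine ⟨domP a n, ?_, ?_⟩
  · refine ⟨(-1) ^ (n + 1) * domQ a (n + 1), - (-1) ^ (n + 1) * domP a (n + 1), ?_⟩
    have : ((-1 : ℤ) ^ (n + 1)) * (-1) ^ (n + 1) = 1 := by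
      rw [← mul_pow]; simp
    calc _ = (-1 : ℤ) ^ (n + 1) * ((domQ a (n + 1) : ℤ) * domP a n - domP a (n + 1) * domQ a n) := by
          ring
      _ = 1 := by rw [hdet, this]
  · have hdet' : (domQ a (n + 1) : ℝ) * domP a n - domP a (n + 1) * domQ a n = (-1) ^ (n + 1) := by
      exact_mod_cast hdet
    have e : domQ a (n + 1) * ((-1) ^ n * δ n) + domQ a n * ((-1) ^ (n + 1) * δ (n + 1)) = 1 := by
      have : ((-1 : ℝ) ^ n) * (-1) ^ n = 1 := by
        rw [← mul_pow]; simp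
      calc _ = (-1 : ℝ) ^ n * (-1) * ((domQ a (n + 1) : ℝ) * domP a n - domP a (n + 1) * domQ a n) := by
            simp only [hδ]; ring
        _ = 1 := by rw [hdet', pow_succ]; linarith
    have habs : |(domQ a n : ℝ) * t 0 - (domP a n : ℤ)| = (-1) ^ n * δ n := by
      rw [← abs_of_pos (hsign n), abs_mul, abs_pow]; simp [hδ]
    rw [habs]
    obtain ⟨p1, p2⟩ := domQ_pos a ha n
    have p1' : (0 : ℝ) < domQ a n := by exact_mod_cast p1
    have p2' : (domQ a n : ℝ) ≤ domQ a (n + 1) := by exact_mod_cast p2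
    rw [le_div_iff₀ p1']
    have s1 := hsign n
    have s2 := mul_pos p1' (hsign (n + 1))
    nlinarith

lemma dom_saw_mul (q : ℕ) (hq : 0 < q) (p : ℤ) (h : IsCoprime p (q : ℤ)) (α : ℝ)
    (hα : |q * α - p| ≤ 1 / q) (b r : ℕ) (C : ℝ)
    (hr : ∀ γ : ℝ, |∑ k ∈ range r, (Int.fract (γ + k * α) - 1 / 2)| ≤ C) (γ : ℝ) :
    |∑ k ∈ range (b * q + r), (Int.fract (γ + k * α) - 1 / 2)| ≤ 5 / 2 * b + C := by
  induction b generalizing γ with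
  | zero => simpa using hr γ
  | succ b ih =>
    have : (b + 1) * q + r = q + (b * q + r) := by ring
    rw [this, Finset.sum_range_add]
    have h1 := dom_saw_block q hq p h α γ hα
    have h2 := ih (γ + q * α)
    have e : ∀ k : ℕ, γ + q * α + k * α = γ + ((q + k : ℕ) : ℝ) * α := by
      intro k; push_cast; ring
    simp only [e] at h2
    refine (abs_add_le _ _).trans ?_
    rw [Nat.cast_succ]
    linarith

lemma dom_saw_sum (a : ℕ → ℕ) (ha : ∀ n, 1 ≤ a n) (α : ℝ) (hα : DomGood a α) (n : ℕ) :
    ∀ N : ℕ, N < domQ a n → ∀ γ : ℝ,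
      |∑ k ∈ range N, (Int.fract (γ + k * α) - 1 / 2)| ≤ 5 / 2 * ∑ i ∈ range n, (a i : ℝ) := by
  induction n with
  | zero =>
    intro N hN γ
    have : N = 0 := by simp [domQ] at hN; exact hN
    subst this
    simp
  | succ n ih =>
    intro N hN γ
    have hq := (domQ_pos a ha n).1
    have hb : N / domQ a n ≤ a n := by
      have := lt_of_lt_of_le hN (domQ_step a ha n)
      have := (Nat.div_lt_iff_lt_mul hq).2 this
      omega
    obtain ⟨p, hp1, hp2⟩ := hα n
    have := dom_saw_mul (domQ a n) hq p hp1 α hp2 (N / domQ a n) (N % domQ a n) _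
      (ih _ (Nat.mod_lt _ hq)) γ
    rw [Nat.div_add_mod'] at this
    refine this.trans ?_
    rw [Finset.sum_range_succ]
    have : ((N / domQ a n : ℕ) : ℝ) ≤ a n := by exact_mod_cast hb
    linarith

lemma dom_indicator (y b : ℝ) (h0 : 0 ≤ b) (h1 : b < 1) :
    (if 0 ≤ Int.fract y ∧ Int.fract y ≤ b then (1 : ℝ) else 0) - b =
      -(Int.fract y - 1 / 2) - (Int.fract (b - y) - 1 / 2) := by
  have hy0 := Int.fract_nonneg y
  have hy1 := Int.fract_lt_one y
  have e : y = ⌊y⌋ + Int.fract y := (Int.floor_add_fract y).symm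
  split_ifs with h
  · have : Int.fract (b - y) = b - Int.fract y := by
      rw [Int.fract_eq_iff]
      refine ⟨by linarith [h.2], by linarith, -⌊y⌋, ?_⟩
      push_cast; linarith
    rw [this]; ring
  · have h' : b < Int.fract y := by
      by_contra hc
      exact h ⟨hy0, not_lt.1 hc⟩
    have : Int.fract (b - y) = b - Int.fract y + 1 := by
      rw [Int.fract_eq_iff]
      refine ⟨by linarith, by linarith, -⌊y⌋ - 1, ?_⟩
      push_cast; linarith
    rw [this]; ring

lemma dom_disc_bound (a : ℕ → ℕ) (ha : ∀ n, 1 ≤ a n) (x : ℝ) (hx : DomGood a (2 * x)) (n N : ℕ)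
    (hN0 : 0 < N) (hN : N < domQ a n) :
    0 ≤ starDiscrepancy N (fun k => Int.fract ((2 * (k : ℝ) - 1) * x)) ∧
    starDiscrepancy N (fun k => Int.fract ((2 * (k : ℝ) - 1) * x)) ≤
      (5 * ∑ i ∈ range n, (a i : ℝ)) / N := by
  have hN' : (0 : ℝ) < N := by exact_mod_cast hN0
  unfold starDiscrepancy
  constructor
  · apply Real.sSup_nonneg
    rintro v ⟨b, -, -, rfl⟩
    exact abs_nonneg _
  · apply Real.sSup_le
    swap
    · positivity
    rintro v ⟨b, hb0, hb1, rfl⟩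
    rcases hb1.lt_or_eq with hb1 | rfl
    · have e1 : (∑ k ∈ Finset.Icc 1 N, (if 0 ≤ Int.fract ((2 * (k : ℝ) - 1) * x) ∧
            Int.fract ((2 * (k : ℝ) - 1) * x) ≤ b then (1:ℝ) else 0)) / N - b =
          (∑ k ∈ range N, ((if 0 ≤ Int.fract (x + k * (2 * x)) ∧
            Int.fract (x + k * (2 * x)) ≤ b then (1:ℝ) else 0) - b)) / N := by
        rw [Finset.sum_sub_distrib]
        simp only [Finset.sum_const, card_range, nsmul_eq_mul]
        rw [sub_div, mul_div_cancel_left₀ _ hN'.ne']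
        congr 2
        rw [Finset.sum_bij' (fun k _ => k - 1) (fun k _ => k + 1)]
        · intro k hk; simp at hk ⊢; omega
        · intro k hk; simp at hk ⊢; omega
        · intro k hk; simp at hk ⊢; omega
        · intro k hk; simp at hk ⊢
        · intro k hk
          simp only [Finset.mem_Icc] at hk
          have : (2 * (k : ℝ) - 1) * x = x + ((k - 1 : ℕ) : ℝ) * (2 * x) := by
            rw [Nat.cast_sub hk.1]; push_cast; ring
          rw [this]
      rw [e1, abs_div, abs_of_pos hN']
      gcongr
      rw [Finset.sum_congr rfl (fun (k : ℕ) _ => dom_indicator (x + k * (2 * x)) b hb0 hb1),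
        Finset.sum_sub_distrib, Finset.sum_neg_distrib]
      have h1 := dom_saw_sum a ha _ hx n N hN x
      have h2 := dom_saw_sum a ha _ hx.neg n N hN (b - x)
      have e : ∀ k : ℕ, b - x + k * (-(2 * x)) = b - (x + k * (2 * x)) := by intro k; ring
      simp only [e] at h2
      refine (abs_sub _ _).trans ?_
      rw [abs_neg]
      linarith
    · have : (∑ k ∈ Finset.Icc 1 N, (if 0 ≤ Int.fract ((2 * (k : ℝ) - 1) * x) ∧
            Int.fract ((2 * (k : ℝ) - 1) * x) ≤ 1 then (1:ℝ) else 0)) = N := by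
        rw [Finset.sum_congr rfl (g := fun _ => (1 : ℝ))]
        · simp
        · intro k _
          rw [if_pos ⟨Int.fract_nonneg _, (Int.fract_lt_one _).le⟩]
      rw [this, div_self hN'.ne']
      simp
      positivity

/-- Gauss map. -/
noncomputable def domG (x : ℝ) : ℝ := Int.fract (1 / x)

/-- First partial quotient. -/
noncomputable def domA (x : ℝ) : ℕ := ⌊1 / x⌋₊

/-- Integral against the (unnormalised) Gauss measure. -/
noncomputable def domI (f : ℝ → ENNReal) : ENNReal :=
  ∫⁻ x in Set.Ico (0 : ℝ) 1, f x * ENNReal.ofReal (1 / (1 + x))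

lemma domG_meas : Measurable domG := by
  unfold domG; fun_prop

lemma domA_meas : Measurable domA := by
  unfold domA; fun_prop

lemma dom_cov (φ : ℕ → ENNReal) (f : ℝ → ENNReal) :
    domI (fun x => φ (domA x) * f (domG x)) ≤
      ∑' k : ℕ, ∫⁻ t in Set.Ico (0 : ℝ) 1, φ (k + 1) * f t *
        ENNReal.ofReal (1 / ((k + 1 + t) * (k + 2 + t))) := by
  unfold domI
  have hset : Set.Ioc (0 : ℝ) 1 ⊆ ⋃ k : ℕ, (fun t : ℝ => 1 / ((k : ℝ) + 1 + t)) '' Set.Ico (0 : ℝ) 1 := by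
    intro x hx
    have h1 : 1 ≤ 1 / x := by rw [le_div_iff₀ hx.1]; linarith [hx.2]
    have h2 : 1 ≤ ⌊1 / x⌋₊ := (Nat.one_le_floor_iff _).2 h1
    obtain ⟨k, hk⟩ := Nat.exists_eq_add_of_le' h2
    rw [Set.mem_iUnion]
    refine ⟨k, 1 / x - (k + 1), ⟨?_, ?_⟩, ?_⟩
    · have := Nat.floor_le (zero_le_one.trans h1)
      rw [hk] at this; push_cast at this; linarith
    · have := Nat.lt_floor_add_one (1 / x)
      rw [hk] at this; push_cast at this; linarith
    · have := hx.1.ne'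
      simp
  rw [setLIntegral_congr (Ico_ae_eq_Ioc (μ := volume))]
  refine (lintegral_mono_set hset).trans ((lintegral_iUnion_le _ _).trans ?_)
  refine ENNReal.tsum_le_tsum fun k => ?_
  have hpos : ∀ t ∈ Set.Ico (0 : ℝ) 1, (0 : ℝ) < k + 1 + t := by
    intro t ht; have := ht.1; positivity
  rw [lintegral_image_eq_lintegral_abs_deriv_mul (f' := fun t => - 1 / ((k : ℝ) + 1 + t) ^ 2)
    measurableSet_Ico]
  · refine le_of_eq (setLIntegral_congr_fun measurableSet_Ico ?_)
    intro t ht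
    have hp := hpos t ht
    have e1 : domA (1 / ((k : ℝ) + 1 + t)) = k + 1 := by
      unfold domA
      rw [one_div_one_div, Nat.floor_eq_iff hp.le]
      push_cast
      exact ⟨by linarith [ht.1], by linarith [ht.2]⟩
    have e2 : domG (1 / ((k : ℝ) + 1 + t)) = t := by
      unfold domG
      rw [one_div_one_div, Int.fract_eq_iff]
      exact ⟨ht.1, ht.2, k + 1, by push_cast; ring⟩
    simp only [e1, e2]
    rw [mul_comm, mul_assoc, ← ENNReal.ofReal_mul (by positivity)]
    congr 2
    rw [neg_div, abs_neg, abs_of_nonneg (by positivity)]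
    have hp2 : (0 : ℝ) < k + 2 + t := by linarith
    have hp3 : 1 + 1 / ((k : ℝ) + 1 + t) = (k + 2 + t) / (k + 1 + t) := by field_simp; ring
    rw [hp3]
    field_simp
  · intro t ht
    have hp := hpos t ht
    have h1 : HasDerivAt (fun t : ℝ => (k : ℝ) + 1 + t) 1 t := (hasDerivAt_id t).const_add _
    have := h1.inv hp.ne'
    simp only [one_div]
    exact this.hasDerivWithinAt
  · intro s hs t ht hst
    simp only [one_div] at hst
    have := inv_injective hst
    linarith

lemma dom_step (φ : ℕ → ℝ) (hφ : ∀ k, 0 ≤ φ k) (c : ℝ) (f : ℝ → ENNReal) (hf : Measurable f)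
    (hc : ∀ t : ℝ, 0 ≤ t → t < 1 → ∀ n : ℕ,
      ∑ k ∈ range n, φ (k + 1) * (1 / ((k + 1 + t) * (k + 2 + t))) ≤ c * (1 / (1 + t))) :
    domI (fun x => ENNReal.ofReal (φ (domA x)) * f (domG x)) ≤ ENNReal.ofReal c * domI f := by
  refine (dom_cov (fun k => ENNReal.ofReal (φ k)) f).trans ?_
  rw [← lintegral_tsum]
  swap
  · intro k; fun_prop
  unfold domI
  rw [← lintegral_const_mul _ (by fun_prop)]
  refine setLIntegral_mono' measurableSet_Ico ?_
  intro t ht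
  have ht0 := ht.1
  have hc0 : 0 ≤ c := by
    have := hc 0 le_rfl one_pos 0
    simpa using this
  calc ∑' k : ℕ, ENNReal.ofReal (φ (k + 1)) * f t * ENNReal.ofReal (1 / ((k + 1 + t) * (k + 2 + t)))
      = ∑' k : ℕ, f t * ENNReal.ofReal (φ (k + 1) * (1 / ((k + 1 + t) * (k + 2 + t)))) := by
        congr 1; ext k
        rw [ENNReal.ofReal_mul (hφ _)]; ring
    _ = f t * ∑' k : ℕ, ENNReal.ofReal (φ (k + 1) * (1 / ((k + 1 + t) * (k + 2 + t)))) := by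
        rw [ENNReal.tsum_mul_left]
    _ ≤ f t * ENNReal.ofReal (c * (1 / (1 + t))) := by
        gcongr
        refine ENNReal.tsum_le_of_sum_range_le fun n => ?_
        rw [← ENNReal.ofReal_sum_of_nonneg]
        · exact ENNReal.ofReal_le_ofReal (hc t ht.1 ht.2 n)
        · intro k _
          have := hφ (k + 1)
          positivity
    _ = _ := by rw [ENNReal.ofReal_mul hc0]; ring

lemma dom_telescope (t : ℝ) (ht : 0 ≤ t) (n : ℕ) :
    ∑ k ∈ range n, (1 / (((k : ℝ) + 1 + t) * (k + 2 + t))) ≤ 1 / (1 + t) := by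
  have : ∑ k ∈ range n, (1 / (((k : ℝ) + 1 + t) * (k + 2 + t))) = 1 / (1 + t) - 1 / (n + 1 + t) := by
    induction n with
    | zero => simp
    | succ n ih =>
      rw [Finset.sum_range_succ, ih]
      push_cast
      field_simp
      ring
  rw [this]
  have : 0 ≤ 1 / (n + 1 + t) := by positivity
  linarith

/-- Truncated exponential weight. -/
noncomputable def domPhi (T : ℕ) (k : ℕ) : ℝ := if k ≤ T then Real.exp (k / T) else 1

lemma domPhi_sum (T : ℕ) (hT : 1 ≤ T) (t : ℝ) (ht : 0 ≤ t) (ht1 : t < 1) (n : ℕ) :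
    ∑ k ∈ range n, domPhi T (k + 1) * (1 / ((k + 1 + t) * (k + 2 + t))) ≤
      (1 + 4 * (1 + Real.log T) / T) * (1 / (1 + t)) := by
  have hT' : (0 : ℝ) < T := by exact_mod_cast hT
  have key : ∀ k : ℕ, domPhi T (k + 1) * (1 / ((k + 1 + t) * (k + 2 + t))) ≤
      1 / (((k : ℝ) + 1 + t) * (k + 2 + t)) +
        4 / T * (1 / (1 + t)) * (if k < T then 1 / ((k : ℝ) + 1) else 0) := by
    intro k
    unfold domPhi
    by_cases hk : k + 1 ≤ T
    · rw [if_pos hk, if_pos (by omega)]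
      have hu : ((k + 1 : ℕ) : ℝ) / T ≤ 1 := by
        rw [div_le_one hT']; exact_mod_cast hk
      have hu0 : 0 ≤ ((k + 1 : ℕ) : ℝ) / T := by positivity
      have h1 : Real.exp (((k + 1 : ℕ) : ℝ) / T) ≤ 1 + 2 * (((k + 1 : ℕ) : ℝ) / T) := by
        have := Real.exp_bound' hu0 hu (n := 1) one_pos
        simp at this
        push_cast
        linarith
      have h2 : 1 / (((k : ℝ) + 1 + t) * (k + 2 + t)) ≤ (1 / (1 + t)) * (2 / ((k + 1) * (k + 1))) := by
        rw [div_mul_div_comm, div_le_div_iff₀ (by positivity) (by positivity)]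
        have hk0 : (0 : ℝ) ≤ k := by positivity
        have : ((k : ℝ) + 1) * (k + 1) ≤ (k + 1 + t) * (k + 2 + t) := by
          apply mul_le_mul <;> linarith
        nlinarith [mul_nonneg ht (mul_nonneg (by linarith : (0:ℝ) ≤ k + 1) (by linarith : (0:ℝ) ≤ k + 1))]
      calc _ ≤ (1 + 2 * (((k + 1 : ℕ) : ℝ) / T)) * (1 / ((k + 1 + t) * (k + 2 + t))) := by
            gcongr
        _ = 1 / ((k + 1 + t) * (k + 2 + t)) + 2 * (((k + 1 : ℕ) : ℝ) / T) *
              (1 / ((k + 1 + t) * (k + 2 + t))) := by ring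
        _ ≤ 1 / ((k + 1 + t) * (k + 2 + t)) + 2 * (((k + 1 : ℕ) : ℝ) / T) *
              ((1 / (1 + t)) * (2 / ((k + 1) * (k + 1)))) := by gcongr
        _ = _ := by
            push_cast
            field_simp
            ring
    · rw [if_neg hk, if_neg (by omega)]
      simp
  refine (Finset.sum_le_sum fun k _ => key k).trans ?_
  rw [Finset.sum_add_distrib, ← Finset.mul_sum]
  have h1 := dom_telescope t ht n
  have h2 : ∑ k ∈ range n, (if k < T then 1 / ((k : ℝ) + 1) else 0) ≤ 1 + Real.log T := by
    rw [← Finset.sum_filter]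
    have h3 : ∑ k ∈ range T, 1 / ((k : ℝ) + 1) ≤ 1 + Real.log T := by
      have := harmonic_le_one_add_log T
      unfold harmonic at this
      push_cast at this
      simpa using this
    refine le_trans (Finset.sum_le_sum_of_subset_of_nonneg ?_ ?_) h3
    · intro k; simp
    · intros; positivity
  calc _ ≤ 1 / (1 + t) + 4 / T * (1 / (1 + t)) * (1 + Real.log T) := by gcongr
    _ = _ := by ring

lemma domI_one : domI (fun _ => 1) ≤ 1 := by
  unfold domI
  calc _ ≤ ∫⁻ x in Set.Ico (0 : ℝ) 1, 1 := by
        refine setLIntegral_mono' measurableSet_Ico ?_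
        intro x hx
        have := hx.1
        rw [one_mul]
        refine (ENNReal.ofReal_le_ofReal (?_ : _ ≤ (1 : ℝ))).trans (by simp)
        rw [div_le_one (by positivity)]; linarith
    _ = 1 := by simp

lemma domI_lower (f : ℝ → ENNReal) : ∫⁻ x in Set.Ico (0 : ℝ) 1, f x ≤ 2 * domI f := by
  unfold domI
  rw [← lintegral_const_mul' _ _ (by simp)]
  refine setLIntegral_mono' measurableSet_Ico ?_
  intro x hx
  have hx0 := hx.1
  have : (1 : ENNReal) ≤ 2 * ENNReal.ofReal (1 / (1 + x)) := by
    rw [show (2 : ENNReal) = ENNReal.ofReal 2 by simp, ← ENNReal.ofReal_mul (by norm_num)]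
    rw [ENNReal.one_le_ofReal]
    rw [mul_one_div, le_div_iff₀ (by positivity)]
    linarith [hx.2]
  calc f x = 1 * f x := by rw [one_mul]
    _ ≤ (2 * ENNReal.ofReal (1 / (1 + x))) * f x := by gcongr
    _ = _ := by ring

lemma dom_iter_meas (i : ℕ) : Measurable (fun x => domA (domG^[i] x)) :=
  domA_meas.comp (domG_meas.iterate i)

lemma dom_prod (T : ℕ) (hT : 1 ≤ T) (m : ℕ) :
    domI (fun x => ∏ i ∈ range m, ENNReal.ofReal (domPhi T (domA (domG^[i] x)))) ≤
      ENNReal.ofReal (1 + 4 * (1 + Real.log T) / T) ^ m := by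
  induction m with
  | zero => simpa using domI_one
  | succ m ih =>
    have e : (fun x => ∏ i ∈ range (m + 1), ENNReal.ofReal (domPhi T (domA (domG^[i] x)))) =
        fun x => ENNReal.ofReal (domPhi T (domA x)) *
          (fun y => ∏ i ∈ range m, ENNReal.ofReal (domPhi T (domA (domG^[i] y)))) (domG x) := by
      ext x
      rw [Finset.prod_range_succ', mul_comm]
      simp
    rw [e, pow_succ']
    refine (dom_step (domPhi T) ?_ _
      (fun y => ∏ i ∈ range m, ENNReal.ofReal (domPhi T (domA (domG^[i] y)))) ?_ (fun t h0 h1 n => domPhi_sum T hT t h0 h1 n)).trans ?_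
    · intro k; unfold domPhi; split_ifs <;> positivity
    · refine Finset.measurable_fun_prod _ fun i _ => ?_
      exact ENNReal.measurable_ofReal.comp
        ((measurable_from_nat (f := domPhi T)).comp (dom_iter_meas i))
    · gcongr

lemma dom_tail (T : ℕ) (hT : 1 ≤ T) (i : ℕ) :
    volume.restrict (Set.Ico (0 : ℝ) 1) {x | T < domA (domG^[i] x)} ≤ 2 * ENNReal.ofReal (1 / T) := by
  have hT' : (0 : ℝ) < T := by exact_mod_cast hT
  set χ : ℕ → ENNReal := fun k => if T < k then 1 else 0 with hχ
  have hχm : ∀ i, Measurable (fun x => χ (domA (domG^[i] x))) := fun i =>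
    (measurable_from_nat (f := χ)).comp (dom_iter_meas i)
  have hI : domI (fun x => χ (domA (domG^[i] x))) ≤ ENNReal.ofReal (1 / T) := by
    induction i with
    | zero =>
      unfold domI
      calc _ ≤ ∫⁻ x in Set.Ico (0 : ℝ) 1, (Set.Icc (0 : ℝ) (1 / T)).indicator 1 x := by
            refine setLIntegral_mono' measurableSet_Ico ?_
            intro x hx
            have hx0 := hx.1
            simp only [hχ, Function.iterate_zero, id]
            split_ifs with h
            · have h1 : (T : ℝ) ≤ 1 / x := by
                unfold domA at h
                have h2 : ((T + 1 : ℕ) : ℝ) ≤ 1 / x := (Nat.le_floor_iff (by positivity)).1 h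
                push_cast at h2; linarith
              have hxp : 0 < x := by
                rcases hx0.lt_or_eq with h | h
                · exact h
                · rw [← h] at h1; simp at h1; linarith
              have h3 : x ≤ 1 / T := by
                rw [le_div_iff₀ hxp] at h1
                rw [le_div_iff₀ hT']; linarith
              have hmem : x ∈ Set.Icc (0 : ℝ) (1 / T) := ⟨hx0, h3⟩
              rw [Set.indicator_of_mem hmem, one_mul]
              refine (ENNReal.ofReal_le_ofReal (?_ : _ ≤ (1 : ℝ))).trans (by simp)
              rw [div_le_one (by positivity)]; linarith
            · simp
        _ ≤ ∫⁻ x, (Set.Icc (0 : ℝ) (1 / T)).indicator 1 x := setLIntegral_le_lintegral _ _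
        _ = _ := by
            rw [lintegral_indicator_one measurableSet_Icc, Real.volume_Icc, sub_zero]
    | succ i ih =>
      have := dom_step (fun _ => 1) (fun _ => zero_le_one) 1 _ (hχm i) (by
        intro t h0 h1 n
        simpa using dom_telescope t h0 n)
      simp only [ENNReal.ofReal_one, one_mul] at this
      exact this.trans ih
  have e : volume.restrict (Set.Ico (0 : ℝ) 1) {x | T < domA (domG^[i] x)} =
      ∫⁻ x in Set.Ico (0 : ℝ) 1, χ (domA (domG^[i] x)) := by
    have hm : MeasurableSet {x | T < domA (domG^[i] x)} :=
      measurableSet_lt measurable_const (dom_iter_meas i)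
    rw [← lintegral_indicator_one hm]
    congr 1
    ext x
    by_cases h : T < domA (domG^[i] x) <;> simp [hχ, h]
  rw [e]
  refine (domI_lower _).trans ?_
  gcongr

/-- Sum of the first `m` partial quotients. -/
noncomputable def domS (m : ℕ) (x : ℝ) : ℝ := ∑ i ∈ range m, (domA (domG^[i] x) : ℝ)

lemma dom_bad (T m : ℕ) (hT : 1 ≤ T) (u : ℝ) :
    volume.restrict (Set.Ico (0 : ℝ) 1) {x | u * T < domS m x} ≤
      ENNReal.ofReal (2 * (m / T + Real.exp (-u) * Real.exp (4 * (1 + Real.log T) * m / T))) := by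
  have hT' : (0 : ℝ) < T := by exact_mod_cast hT
  have hlog : 0 ≤ Real.log T := Real.log_natCast_nonneg T
  set μ := volume.restrict (Set.Ico (0 : ℝ) 1) with hμ
  set P : ℝ → ENNReal := fun x => ∏ i ∈ range m, ENNReal.ofReal (domPhi T (domA (domG^[i] x))) with hP
  have hPm : Measurable P := by
    refine Finset.measurable_fun_prod _ fun i _ => ?_
    exact ENNReal.measurable_ofReal.comp
        ((measurable_from_nat (f := domPhi T)).comp (dom_iter_meas i))
  have hsub : {x | u * T < domS m x} ⊆
      (⋃ i ∈ range m, {x | T < domA (domG^[i] x)}) ∪ {x | ENNReal.ofReal (Real.exp u) ≤ P x} := by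
    intro x hx
    by_cases h : ∃ i ∈ range m, T < domA (domG^[i] x)
    · left
      obtain ⟨i, hi, h⟩ := h
      simp only [Set.mem_iUnion]
      exact ⟨i, hi, h⟩
    · right
      push Not at h
      simp only [Set.mem_ofPred_eq, hP]
      rw [← ENNReal.ofReal_prod_of_nonneg]
      · apply ENNReal.ofReal_le_ofReal
        rw [Finset.prod_congr rfl (g := fun i => Real.exp ((domA (domG^[i] x) : ℝ) / T))]
        · rw [← Real.exp_sum, ← Finset.sum_div]
          apply Real.exp_le_exp.2
          rw [le_div_iff₀ hT']
          exact le_of_lt hx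
        · intro i hi
          rw [domPhi, if_pos (h i hi)]
      · intro i _; unfold domPhi; split_ifs <;> positivity
  have h1 : μ (⋃ i ∈ range m, {x | T < domA (domG^[i] x)}) ≤ ENNReal.ofReal (2 * (m / T)) := by
    refine (measure_biUnion_finset_le _ _).trans ?_
    refine (Finset.sum_le_sum fun i _ => dom_tail T hT i).trans ?_
    rw [Finset.sum_const, card_range, nsmul_eq_mul]
    rw [show (2 : ENNReal) = ENNReal.ofReal 2 by simp, ← ENNReal.ofReal_mul (by norm_num),
      ← ENNReal.ofReal_natCast, ← ENNReal.ofReal_mul (by positivity)]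
    apply ENNReal.ofReal_le_ofReal
    apply le_of_eq; ring
  have h2 : μ {x | ENNReal.ofReal (Real.exp u) ≤ P x} ≤
      ENNReal.ofReal (2 * (Real.exp (-u) * Real.exp (4 * (1 + Real.log T) * m / T))) := by
    have hM := meas_ge_le_lintegral_div (μ := μ) hPm.aemeasurable
      (ε := ENNReal.ofReal (Real.exp u)) (by simp [Real.exp_pos]) (by simp)
    refine hM.trans ?_
    have h3 : ∫⁻ x, P x ∂μ ≤ ENNReal.ofReal (2 * Real.exp (4 * (1 + Real.log T) * m / T)) := by
      refine (domI_lower P).trans ?_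
      rw [ENNReal.ofReal_mul (by norm_num), ENNReal.ofReal_ofNat]
      gcongr
      refine (dom_prod T hT m).trans ?_
      rw [← ENNReal.ofReal_pow (by positivity)]
      apply ENNReal.ofReal_le_ofReal
      have : 4 * (1 + Real.log T) * m / T = m * (4 * (1 + Real.log T) / T) := by ring
      rw [this, Real.exp_nat_mul]
      gcongr
      rw [add_comm]
      exact Real.add_one_le_exp _
    refine (ENNReal.div_le_div_right h3 _).trans ?_
    rw [← ENNReal.ofReal_div_of_pos (Real.exp_pos u)]
    apply ENNReal.ofReal_le_ofReal
    rw [Real.exp_neg]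
    apply le_of_eq
    field_simp
  refine (measure_mono hsub).trans ((measure_union_le _ _).trans ?_)
  rw [mul_add, ENNReal.ofReal_add (by positivity) (by positivity)]
  gcongr

lemma dom_bad_j (δ : ℝ) (hδ : 0 < δ) (j : ℕ) (hj : 1 ≤ j) :
    volume.restrict (Set.Ico (0 : ℝ) 1)
      {x | 2 * Real.log j * ((2 ^ j * ⌈(j : ℝ) ^ (1 + δ)⌉₊ : ℕ) : ℝ) < domS (2 ^ j) x} ≤
      ENNReal.ofReal (2 * (1 / (j : ℝ) ^ (1 + δ) +
        Real.exp (4 * (4 + δ)) * (1 / (j : ℝ) ^ 2))) := by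
  have hj' : (1 : ℝ) ≤ j := by exact_mod_cast hj
  have hj0 : (0 : ℝ) < j := by linarith
  set y : ℝ := (j : ℝ) ^ (1 + δ) with hy
  have hy1 : 1 ≤ y := Real.one_le_rpow hj' (by linarith)
  have hyj : (j : ℝ) ≤ y := by
    calc (j : ℝ) = (j : ℝ) ^ (1 : ℝ) := by rw [Real.rpow_one]
      _ ≤ _ := Real.rpow_le_rpow_of_exponent_le hj' (by linarith)
  have hc1 : y ≤ ⌈y⌉₊ := Nat.le_ceil y
  have hc2 : (⌈y⌉₊ : ℝ) ≤ 2 * y := by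
    have := Nat.ceil_lt_add_one (by linarith : 0 ≤ y)
    linarith
  have hc0 : (0 : ℝ) < ⌈y⌉₊ := by linarith
  have hT : 1 ≤ 2 ^ j * ⌈y⌉₊ := by
    have : 0 < ⌈y⌉₊ := by exact_mod_cast hc0
    have : 0 < 2 ^ j * ⌈y⌉₊ := by positivity
    omega
  refine (dom_bad (2 ^ j * ⌈y⌉₊) (2 ^ j) hT (2 * Real.log j)).trans ?_
  apply ENNReal.ofReal_le_ofReal
  have hlog : Real.log ((2 ^ j * ⌈y⌉₊ : ℕ) : ℝ) ≤ (3 + δ) * j := by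
    push_cast
    rw [Real.log_mul (by positivity) hc0.ne', Real.log_pow]
    have h1 : Real.log ⌈y⌉₊ ≤ Real.log 2 + (1 + δ) * Real.log j := by
      rw [← Real.log_rpow hj0, ← Real.log_mul (by norm_num) (by positivity)]
      exact Real.log_le_log hc0 hc2
    have h2 : Real.log 2 ≤ 1 := by linarith [Real.log_two_lt_d9]
    have h3 : Real.log j ≤ j := by linarith [Real.log_le_sub_one_of_pos hj0]
    nlinarith
  have e1 : ((2 ^ j : ℕ) : ℝ) / ((2 ^ j * ⌈y⌉₊ : ℕ) : ℝ) = 1 / ⌈y⌉₊ := by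
    push_cast; field_simp
  have e2 : Real.exp (-(2 * Real.log j)) = 1 / (j : ℝ) ^ 2 := by
    rw [Real.exp_neg, mul_comm, Real.exp_mul, Real.exp_log hj0]
    norm_num
  have e3 : 4 * (1 + Real.log ((2 ^ j * ⌈y⌉₊ : ℕ) : ℝ)) * ((2 ^ j : ℕ) : ℝ) /
      ((2 ^ j * ⌈y⌉₊ : ℕ) : ℝ) ≤ 4 * (4 + δ) := by
    rw [mul_div_assoc, e1, mul_one_div, div_le_iff₀ hc0]
    nlinarith
  rw [e1, e2, mul_comm (1 / (j : ℝ) ^ 2)]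
  gcongr

lemma dom_ae_S (ε : ℝ) (hε : 0 < ε) :
    ∀ᵐ x ∂(volume.restrict (Set.Ico (0 : ℝ) 1)),
      ∀ᶠ j : ℕ in atTop, domS (2 ^ j) x ≤ 8 / ε * (2 ^ j * (j : ℝ) ^ (1 + ε)) := by
  set δ := ε / 2 with hδ
  have hδ0 : 0 < δ := by positivity
  set s : ℕ → Set ℝ := fun j =>
    {x | 1 ≤ j ∧ 2 * Real.log j * ((2 ^ j * ⌈(j : ℝ) ^ (1 + δ)⌉₊ : ℕ) : ℝ) < domS (2 ^ j) x} with hs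
  set g : ℕ → ℝ := fun j => 2 * (1 / (j : ℝ) ^ (1 + δ) +
        Real.exp (4 * (4 + δ)) * (1 / (j : ℝ) ^ 2)) with hg
  have hgs : Summable g := by
    refine Summable.mul_left _ (Summable.add ?_ (Summable.mul_left _ ?_))
    · exact Real.summable_one_div_nat_rpow.2 (by linarith)
    · exact Real.summable_one_div_nat_pow.2 (by norm_num)
  have hg0 : ∀ j, 0 ≤ g j := by intro j; simp only [hg]; positivity
  have hle : ∀ j, volume.restrict (Set.Ico (0 : ℝ) 1) (s j) ≤ ENNReal.ofReal (g j) := by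
    intro j
    by_cases hj : 1 ≤ j
    · refine le_trans (measure_mono ?_) (dom_bad_j δ hδ0 j hj)
      intro x hx
      exact hx.2
    · have : s j = ∅ := by
        ext x; simp [hs]; intro h; omega
      rw [this]; simp
  have hsum : ∑' j, volume.restrict (Set.Ico (0 : ℝ) 1) (s j) ≠ ⊤ := by
    refine ne_top_of_le_ne_top ?_ (ENNReal.tsum_le_tsum hle)
    exact hgs.tsum_ofReal_ne_top
  filter_upwards [ae_eventually_notMem hsum] with x hx
  filter_upwards [hx, eventually_ge_atTop 1] with j hj hj1
  have h1 : domS (2 ^ j) x ≤ 2 * Real.log j * ((2 ^ j * ⌈(j : ℝ) ^ (1 + δ)⌉₊ : ℕ) : ℝ) := by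
    by_contra hc
    exact hj ⟨hj1, not_le.1 hc⟩
  refine h1.trans ?_
  have hj' : (1 : ℝ) ≤ j := by exact_mod_cast hj1
  have hj0 : (0 : ℝ) < j := by linarith
  have hy1 : 1 ≤ (j : ℝ) ^ (1 + δ) := Real.one_le_rpow hj' (by linarith)
  have hc2 : (⌈(j : ℝ) ^ (1 + δ)⌉₊ : ℝ) ≤ 2 * (j : ℝ) ^ (1 + δ) := by
    have := Nat.ceil_lt_add_one (by linarith : 0 ≤ (j : ℝ) ^ (1 + δ))
    linarith
  have hl : Real.log j ≤ (j : ℝ) ^ δ / δ := Real.log_le_rpow_div hj0.le hδ0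
  have hl0 : 0 ≤ Real.log j := Real.log_nonneg hj'
  push_cast
  calc 2 * Real.log j * (2 ^ j * (⌈(j : ℝ) ^ (1 + δ)⌉₊ : ℝ))
      ≤ 2 * ((j : ℝ) ^ δ / δ) * (2 ^ j * (2 * (j : ℝ) ^ (1 + δ))) := by gcongr
    _ = 4 / δ * (2 ^ j * ((j : ℝ) ^ (1 + δ) * (j : ℝ) ^ δ)) := by ring
    _ = 8 / ε * (2 ^ j * (j : ℝ) ^ (1 + ε)) := by
        rw [← Real.rpow_add hj0, show 1 + δ + δ = 1 + ε by rw [hδ]; ring,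
          show 4 / δ = 8 / ε by rw [hδ]; field_simp; norm_num]

lemma dom_cf (α : ℝ) (h0 : 0 ≤ α) (h1 : α < 1) (hirr : Irrational α) :
    (∀ n, 1 ≤ domA (domG^[n] α)) ∧ DomGood (fun n => domA (domG^[n] α)) α := by
  have H : ∀ n, Irrational (domG^[n] α) ∧ 0 < domG^[n] α ∧ domG^[n] α < 1 := by
    intro n
    induction n with
    | zero => exact ⟨hirr, lt_of_le_of_ne h0 hirr.ne_zero.symm, h1⟩
    | succ n ih =>
      rw [Function.iterate_succ_apply']
      have hi : Irrational (domG (domG^[n] α)) := by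
        unfold domG
        rw [Int.fract, one_div]
        exact ih.1.inv.sub_intCast _
      refine ⟨hi, lt_of_le_of_ne (Int.fract_nonneg _) hi.ne_zero.symm, Int.fract_lt_one _⟩
  have hA : ∀ n, 1 ≤ domA (domG^[n] α) := by
    intro n
    unfold domA
    rw [Nat.one_le_floor_iff, le_div_iff₀ (H n).2.1]
    linarith [(H n).2.2]
  refine ⟨hA, ?_⟩
  refine dom_good_of_cf (fun n => domG^[n] α) _ hA (fun n => (H n).2.1) ?_
  intro n
  rw [Function.iterate_succ_apply']
  have hp := (H n).2.1
  generalize domG^[n] α = z at hp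
  unfold domA domG
  rw [natCast_floor_eq_intCast_floor (by positivity), Int.floor_add_fract]

lemma dom_ae_lift (P : ℝ → Prop) (h : ∀ᵐ x ∂(volume.restrict (Set.Ico (0 : ℝ) 1)), P x) :
    ∀ᵐ x ∂(volume : Measure ℝ), P (Int.fract (2 * x)) := by
  rw [ae_restrict_iff' measurableSet_Ico] at h
  have h2 : ∀ n : ℤ, ∀ᵐ x : ℝ ∂(volume : Measure ℝ),
      (2 * x - n) ∈ Set.Ico (0 : ℝ) 1 → P (2 * x - n) := by
    intro n
    have q1 : Measure.QuasiMeasurePreserving (fun x : ℝ => x - n) volume volume :=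
      (measurePreserving_sub_right volume (n : ℝ)).quasiMeasurePreserving
    have q2 : Measure.QuasiMeasurePreserving (fun x : ℝ => 2 * x) volume volume := by
      refine ⟨by fun_prop, ?_⟩
      rw [Real.map_volume_mul_left (by norm_num)]
      exact Measure.smul_absolutelyContinuous
    exact (q1.comp q2).ae h
  filter_upwards [ae_all_iff.2 h2] with x hx
  exact hx ⌊2 * x⌋ ⟨Int.fract_nonneg _, Int.fract_lt_one _⟩

lemma dom_final (ε : ℝ) (hε : 0 < ε) (x : ℝ) (hirr : Irrational (Int.fract (2 * x)))
    (hS : ∀ᶠ j : ℕ in atTop, domS (2 ^ j) (Int.fract (2 * x)) ≤ 8 / ε * (2 ^ j * (j : ℝ) ^ (1 + ε))) :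
      (fun N : ℕ => starDiscrepancy N (fun k => Int.fract ((2 * (k : ℝ) - 1) * x)))
        =O[Filter.atTop]
      (fun N : ℕ => Real.log N * (Real.log (Real.log N)) ^ ((1:ℝ) + ε) / N) := by
  obtain ⟨hA, hG⟩ := dom_cf _ (Int.fract_nonneg (2 * x)) (Int.fract_lt_one _) hirr
  have hG' := hG.add_int ⌊2 * x⌋
  rw [Int.fract_add_floor] at hG'
  set a : ℕ → ℕ := fun n => domA (domG^[n] (Int.fract (2 * x))) with ha
  have hlog : Tendsto (fun N : ℕ => Nat.log 2 N) atTop atTop := by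
    refine tendsto_atTop.2 fun b => ?_
    filter_upwards [eventually_ge_atTop (2 ^ b)] with N hN
    exact Nat.le_log_of_pow_le (by norm_num) hN
  have hjt : Tendsto (fun N : ℕ => Nat.log 2 (Nat.log 2 N) + 2) atTop atTop :=
    tendsto_atTop_mono (fun N => Nat.le_add_right _ 2) (hlog.comp hlog)
  have hrl : Tendsto (fun N : ℕ => Real.log (Real.log N)) atTop atTop :=
    Real.tendsto_log_atTop.comp (Real.tendsto_log_atTop.comp tendsto_natCast_atTop_atTop)
  have hrl1 : Tendsto (fun N : ℕ => Real.log N) atTop atTop :=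
    Real.tendsto_log_atTop.comp tendsto_natCast_atTop_atTop
  refine IsBigO.of_bound (5 * (8 / ε * (8 * 6 ^ (1 + ε)))) ?_
  filter_upwards [hjt.eventually hS, hrl.eventually_ge_atTop 1, hrl1.eventually_ge_atTop 1,
    eventually_ge_atTop 4] with N h1 h2 h3 h4
  set L := Nat.log 2 N with hL
  set j := Nat.log 2 L + 2 with hj
  have hN0 : (0 : ℝ) < N := by positivity
  have hL1 : 1 ≤ L := Nat.le_log_of_pow_le (by norm_num) (by omega)
  have hNQ : N < domQ a (2 ^ j) := by
    have e : 2 ^ j = 2 * 2 ^ (Nat.log 2 L + 1) := by rw [hj]; ring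
    rw [e]
    refine lt_of_lt_of_le ?_ (domQ_growth a hA _)
    have q1 : N < 2 ^ (L + 1) := Nat.lt_pow_succ_log_self (by norm_num) N
    have q2 : L < 2 ^ (Nat.log 2 L + 1) := Nat.lt_pow_succ_log_self (by norm_num) L
    exact lt_of_lt_of_le q1 (Nat.pow_le_pow_right (by norm_num) q2)
  obtain ⟨b0, b1⟩ := dom_disc_bound a hA x hG' (2 ^ j) N (by omega) hNQ
  have hl2 : (1 : ℝ) / 2 ≤ Real.log 2 := by linarith [Real.log_two_gt_d9]
  have hLr : (L : ℝ) ≤ 2 * Real.log N := by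
    have q : 2 ^ L ≤ N := Nat.pow_log_le_self 2 (by omega)
    have q' : ((2 : ℝ) ^ L) ≤ N := by exact_mod_cast q
    have := Real.log_le_log (by positivity) q'
    rw [Real.log_pow] at this
    nlinarith [(Nat.cast_nonneg L : (0 : ℝ) ≤ L)]
  have qq : 2 ^ Nat.log 2 L ≤ L := Nat.pow_log_le_self 2 (by omega)
  have qq' : (2 : ℝ) ^ Nat.log 2 L ≤ L := by exact_mod_cast qq
  have h2j : (2 : ℝ) ^ j ≤ 8 * Real.log N := by
    rw [hj, pow_add]
    linarith
  have hjr : (j : ℝ) ≤ 6 * Real.log (Real.log N) := by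
    have q3 := Real.log_le_log (by positivity) (qq'.trans hLr)
    rw [Real.log_pow, Real.log_mul (by norm_num) (by linarith)] at q3
    have : (Nat.log 2 L : ℝ) ≤ 1 + 2 * Real.log (Real.log N) + 1 := by
      have := Real.log_two_lt_d9
      nlinarith [(Nat.cast_nonneg (Nat.log 2 L) : (0 : ℝ) ≤ Nat.log 2 L)]
    rw [hj]; push_cast; linarith
  have hS' : ∑ i ∈ range (2 ^ j), (a i : ℝ) ≤
      8 / ε * (8 * Real.log N * (6 * Real.log (Real.log N)) ^ (1 + ε)) := by
    refine le_trans (show _ ≤ _ from h1) ?_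
    gcongr
  rw [Real.norm_of_nonneg b0, Real.norm_of_nonneg (by positivity)]
  refine b1.trans ?_
  rw [← mul_div_assoc]
  gcongr ?_ / _
  rw [Real.mul_rpow (by norm_num) (by linarith)] at hS'
  calc _ ≤ 5 * (8 / ε * (8 * Real.log N * (6 ^ (1 + ε) * Real.log (Real.log N) ^ (1 + ε)))) := by
        gcongr
    _ = _ := by ring

/-- **Lemma 3 (odd multiples).** For any `ε > 0` and almost every `x`, the star-discrepancy of
`⟨x⟩, ⟨3x⟩, …, ⟨(2N−1)x⟩` is `O((log N)(log log N)^{1+ε}/N)` as `N → ∞`. -/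
theorem discrepancy_odd_multiples
    (ε : ℝ) (hε : 0 < ε) :
    ∀ᵐ x ∂(volume : Measure ℝ),
      (fun N : ℕ => starDiscrepancy N (fun k => Int.fract ((2 * (k : ℝ) - 1) * x)))
        =O[Filter.atTop]
      (fun N : ℕ => Real.log N * (Real.log (Real.log N)) ^ ((1:ℝ) + ε) / N) := by
  have hirr : ∀ᵐ x ∂(volume.restrict (Set.Ico (0 : ℝ) 1)), Irrational x :=
    ae_restrict_of_ae ((Set.countable_range ((↑) : ℚ → ℝ)).ae_notMem volume)
  filter_upwards [dom_ae_lift _ hirr, dom_ae_lift _ (dom_ae_S ε hε)] with x h1 h2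
  exact dom_final ε hε x h1 h2
end

section
/- Let h: ℝ → ℝ satisfy h(x+1) = h(x) for all x and have bounded variation on [0,1]. Then for almost every real number x, (1/N) ∑_{k=1}^N h(kx)² → ∫₀¹ h(y)² dy as N → ∞. -/
open MeasureTheory Filter Finset Real

/-- average along multiples on the circle -/
lemma weyl_fourier (x : ℝ) (hx : Irrational x) (n : ℤ) :
    Tendsto (fun N : ℕ => (∑ k ∈ Finset.Icc 1 N, (fourier n : C(UnitAddCircle, ℂ)) (((k:ℝ) * x : ℝ) : UnitAddCircle)) / N)
      atTop (nhds (∫ y : UnitAddCircle, (fourier n : C(UnitAddCircle, ℂ)) y)) := by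
  by_cases hn : n = 0
  · subst hn
    simp only [fourier_zero, integral_const]
    simp
    refine tendsto_const_nhds.congr' ?_
    filter_upwards [eventually_gt_atTop 0] with N hN
    have : (N:ℂ) ≠ 0 := by exact_mod_cast hN.ne'
    simp [this, measureReal_def]
  · have hint : ∫ y : UnitAddCircle, (fourier n : C(UnitAddCircle, ℂ)) y = 0 :=
      integral_eq_zero_of_add_right_eq_neg (μ := volume) (fourier_add_half_inv_index hn one_pos)
    rw [hint]
    set z : ℂ := Complex.exp (2 * π * Complex.I * n * x) with hz
    have hzk : ∀ k : ℕ, (fourier n : C(UnitAddCircle, ℂ)) (((k:ℝ) * x : ℝ) : UnitAddCircle) = z ^ k := by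
      intro k
      rw [fourier_coe_apply, hz, ← Complex.exp_nat_mul]
      congr 1
      push_cast
      ring
    have hz1 : z ≠ 1 := by
      intro h
      rw [hz, Complex.exp_eq_one_iff] at h
      obtain ⟨m, hm⟩ := h
      have h2 : (2 * π * Complex.I : ℂ) ≠ 0 := Complex.two_pi_I_ne_zero
      have h3 : (n * x : ℂ) = m := by
        apply mul_left_cancel₀ h2
        linear_combination hm
      have h4 : (n * x : ℝ) = m := by exact_mod_cast h3
      exact (hx.intCast_mul hn).ne_int m h4
    have hznorm : ‖z‖ = 1 := by
      rw [hz, show (2 * π * Complex.I * n * x : ℂ) = ((2 * π * n * x : ℝ) : ℂ) * Complex.I by push_cast; ring]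
      exact Complex.norm_exp_ofReal_mul_I _
    simp_rw [hzk]
    have hb : ∀ N : ℕ, ‖(∑ k ∈ Finset.Icc 1 N, z ^ k) / N‖ ≤ (2 / ‖z - 1‖) / N := by
      intro N
      rw [norm_div, Complex.norm_natCast]
      gcongr
      have : ∑ k ∈ Finset.Icc 1 N, z ^ k = (z ^ (N+1) - z) / (z - 1) := by
        rw [← Finset.Ico_add_one_right_eq_Icc, geom_sum_Ico hz1 (by omega), pow_one]
      rw [this, norm_div]
      gcongr
      calc ‖z ^ (N+1) - z‖ ≤ ‖z ^ (N+1)‖ + ‖z‖ := norm_sub_le _ _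
        _ = 2 := by rw [norm_pow, hznorm]; norm_num
    exact squeeze_zero_norm hb (tendsto_const_div_atTop_nhds_zero_nat _)

lemma weyl_cont (x : ℝ) (hx : Irrational x) (f : C(UnitAddCircle, ℂ)) :
    Tendsto (fun N : ℕ => (∑ k ∈ Finset.Icc 1 N, f (((k:ℝ) * x : ℝ) : UnitAddCircle)) / N)
      atTop (nhds (∫ y : UnitAddCircle, f y)) := by
  have hint : ∀ f : C(UnitAddCircle, ℂ), Integrable (fun y => f y) := fun f =>
    f.continuous.integrable_of_hasCompactSupport (HasCompactSupport.of_compactSpace _)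
  have hspan : ∀ g ∈ Submodule.span ℂ (Set.range (fourier : ℤ → C(UnitAddCircle, ℂ))),
      Tendsto (fun N : ℕ => (∑ k ∈ Finset.Icc 1 N, g (((k:ℝ) * x : ℝ) : UnitAddCircle)) / N)
      atTop (nhds (∫ y : UnitAddCircle, g y)) := by
    intro g hg
    induction hg using Submodule.span_induction with
    | mem g hg => obtain ⟨n, rfl⟩ := hg; exact weyl_fourier x hx n
    | zero => simp
    | add f g _ _ hf hg =>
      have := hf.add hg
      rw [← integral_add (hint f) (hint g)] at this
      refine this.congr fun N => ?_
      simp [Finset.sum_add_distrib, add_div]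
    | smul c f _ hf =>
      have := hf.const_mul c
      rw [← integral_const_mul] at this
      refine this.congr fun N => ?_
      simp only [ContinuousMap.smul_apply, smul_eq_mul]
      rw [← Finset.mul_sum, mul_div_assoc]
  rw [Metric.tendsto_atTop]
  intro ε hε
  have hf : f ∈ (Submodule.span ℂ (Set.range (fourier : ℤ → C(UnitAddCircle, ℂ)))).topologicalClosure := by
    rw [span_fourier_closure_eq_top]; trivial
  obtain ⟨g, hg, hfg⟩ := Metric.mem_closure_iff.1 hf (ε/3) (by positivity)
  obtain ⟨N0, hN0⟩ := Metric.tendsto_atTop.1 (hspan g hg) (ε/3) (by positivity)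
  refine ⟨N0, fun N hN => ?_⟩
  have hp : ∀ y, ‖f y - g y‖ ≤ ε/3 := fun y => by
    rw [← dist_eq_norm]; exact (ContinuousMap.dist_apply_le_dist y).trans hfg.le
  have h1 : dist ((∑ k ∈ Finset.Icc 1 N, f (((k:ℝ) * x : ℝ) : UnitAddCircle)) / N)
      ((∑ k ∈ Finset.Icc 1 N, g (((k:ℝ) * x : ℝ) : UnitAddCircle)) / N) ≤ ε/3 := by
    rw [dist_eq_norm, ← sub_div, ← Finset.sum_sub_distrib, norm_div, Complex.norm_natCast]
    apply div_le_of_le_mul₀ (by positivity) (by positivity)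
    refine (norm_sum_le_of_le _ fun k _ => hp _).trans ?_
    simp [mul_comm]
  have h2 : dist (∫ y, g y) (∫ y : UnitAddCircle, f y) ≤ ε/3 := by
    rw [dist_comm, dist_eq_norm, ← integral_sub (hint f) (hint g)]
    refine (norm_integral_le_of_norm_le_const (Eventually.of_forall hp)).trans ?_
    simp [measureReal_def]
  have h3 := hN0 N hN
  refine (dist_triangle4 _ ((∑ k ∈ Finset.Icc 1 N, g (((k:ℝ) * x : ℝ) : UnitAddCircle)) / N)
    (∫ y : UnitAddCircle, g y) _).trans_lt ?_
  linarith

/-- empirical measure -/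
noncomputable def empMeas (x : ℝ) (N : ℕ) : Measure UnitAddCircle :=
  ((N + 1 : ℕ) : ENNReal)⁻¹ • ∑ k ∈ Finset.Icc 1 (N+1), Measure.dirac (((k:ℝ) * x : ℝ) : UnitAddCircle)

instance (x : ℝ) (N : ℕ) : IsProbabilityMeasure (empMeas x N) := by
  constructor
  simp only [empMeas, Measure.smul_apply, Measure.finsetSum_apply, measure_univ, smul_eq_mul]
  simp only [Finset.sum_const, Nat.card_Icc, nsmul_eq_mul, mul_one]
  exact ENNReal.inv_mul_cancel (by simp) (by simp)

lemma integral_empMeas (x : ℝ) (N : ℕ) (f : C(UnitAddCircle, ℂ)) :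
    ∫ y, f y ∂(empMeas x N) = 
      (∑ k ∈ Finset.Icc 1 (N+1), f (((k:ℝ) * x : ℝ) : UnitAddCircle)) / (N+1 : ℕ) := by
  rw [empMeas, integral_smul_measure, integral_finsetSum_measure]
  · rw [ENNReal.toReal_inv, ENNReal.toReal_natCast]
    simp only [integral_dirac, div_eq_inv_mul, Complex.real_smul]
    push_cast
    rfl
  · intro i _
    exact f.continuous.integrable_of_hasCompactSupport (HasCompactSupport.of_compactSpace _)

/-- empirical probability measure -/
noncomputable def empProb (x : ℝ) (N : ℕ) : ProbabilityMeasure UnitAddCircle :=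
  ⟨empMeas x N, inferInstance⟩

/-- Haar probability measure on the circle -/
noncomputable def haarProb : ProbabilityMeasure UnitAddCircle :=
  ⟨volume, ⟨UnitAddCircle.measure_univ⟩⟩

lemma tendsto_empMeas (x : ℝ) (hx : Irrational x) :
    Tendsto (empProb x) atTop (nhds haarProb) := by
  rw [ProbabilityMeasure.tendsto_iff_forall_integral_rclike_tendsto ℂ]
  intro f
  have := (tendsto_add_atTop_iff_nat 1).2 (weyl_cont x hx f.toContinuousMap)
  refine this.congr fun N => ?_
  exact (integral_empMeas x N f.toContinuousMap).symm

lemma coe_toIocMod' (y : ℝ) : ((toIocMod one_pos 0 y : ℝ) : UnitAddCircle) = y := by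
  have h := toIocMod_add_toIocDiv_zsmul (one_pos : (0:ℝ) < 1) 0 y
  conv_rhs => rw [← h]
  rw [AddCircle.coe_add, AddCircle.coe_zsmul, AddCircle.coe_period, smul_zero, add_zero]

lemma mem_arc {a b : ℝ} (ha : 0 ≤ a) (hb : b ≤ 1) (y : ℝ) :
    (y : UnitAddCircle) ∈ ((↑) : ℝ → UnitAddCircle) '' Set.Ioc a b ↔
      toIocMod one_pos 0 y ∈ Set.Ioc a b := by
  constructor
  · rintro ⟨z, hz, hzy⟩
    have : z = toIocMod one_pos 0 y := by
      rw [← coe_toIocMod' y] at hzy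
      exact (AddCircle.coe_eq_coe_iff_of_mem_Ioc (a := 0)
        ⟨by linarith [hz.1], by linarith [hz.2]⟩ (toIocMod_mem_Ioc one_pos 0 y)).1 hzy
    rwa [← this]
  · intro h
    exact ⟨_, h, coe_toIocMod' y⟩

lemma arc_freq (x : ℝ) (hx : Irrational x) {a b : ℝ} (ha : 0 ≤ a) (hab : a < b) (hb : b ≤ 1) :
    Tendsto (fun N : ℕ => (∑ k ∈ Finset.Icc 1 N, (Set.Ioc a b).indicator (fun _ => (1:ℝ))
      (toIocMod one_pos 0 ((k:ℝ) * x))) / N) atTop (nhds (b - a)) := by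
  set A := ((↑) : ℝ → UnitAddCircle) '' Set.Ioc a b with hA
  have hAsub : ((↑) : ℝ → UnitAddCircle) '' Set.Ioo a b ⊆ A := Set.image_mono Set.Ioo_subset_Ioc_self
  have hopen : IsOpen (((↑) : ℝ → UnitAddCircle) '' Set.Ioo a b) :=
    QuotientAddGroup.isOpenMap_coe _ isOpen_Ioo
  have hclosed : IsClosed (((↑) : ℝ → UnitAddCircle) '' Set.Icc a b) :=
    (isCompact_Icc.image (AddCircle.continuous_mk' 1)).isClosed
  have hmeas : MeasurableSet A := by
    rw [hA, ← Set.Ioo_union_right hab, Set.image_union, Set.image_singleton]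
    exact hopen.measurableSet.union (measurableSet_singleton _)
  have hvol : (volume : Measure UnitAddCircle) A = ENNReal.ofReal (b - a) := by
    rw [AddCircle.add_projection_respects_measure 1 0 hmeas, ← Real.volume_Ioc]
    congr 1
    ext y
    constructor
    · rintro ⟨h1, h2⟩
      have := (mem_arc ha hb y).1 h1
      rwa [(toIocMod_eq_self one_pos).2 h2] at this
    · intro h
      exact ⟨⟨y, h, rfl⟩, by linarith [h.1], by linarith [h.2]⟩
  have hfr : (volume : Measure UnitAddCircle) (frontier A) = 0 := by
    have hsub : frontier A ⊆ ((↑) : ℝ → UnitAddCircle) '' {a, b} := by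
      intro y hy
      have h1 : y ∈ ((↑) : ℝ → UnitAddCircle) '' Set.Icc a b :=
        closure_minimal (Set.image_mono Set.Ioc_subset_Icc_self) hclosed hy.1
      obtain ⟨t, ht, rfl⟩ := h1
      refine ⟨t, ?_, rfl⟩
      by_contra hne
      simp only [Set.mem_insert_iff, Set.mem_singleton_iff, not_or] at hne
      exact hy.2 (interior_maximal hAsub hopen
        ⟨t, ⟨lt_of_le_of_ne ht.1 (Ne.symm hne.1), lt_of_le_of_ne ht.2 hne.2⟩, rfl⟩)
    have hs : ∀ y : UnitAddCircle, volume ({y} : Set UnitAddCircle) = 0 := fun y => by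
      rw [← Metric.closedBall_zero, AddCircle.volume_closedBall]; simp
    refine measure_mono_null hsub ?_
    rw [Set.image_pair, Set.insert_eq]
    exact measure_union_null (hs _) (hs _)
  have key := ProbabilityMeasure.tendsto_measure_of_null_frontier_of_tendsto' (tendsto_empMeas x hx) (E := A) hfr
  rw [← tendsto_add_atTop_iff_nat 1]
  have key2 := (ENNReal.tendsto_toReal (by simp [haarProb, hvol])).comp key
  simp only [empProb, haarProb, ProbabilityMeasure.coe_mk, hvol, ENNReal.toReal_ofReal (sub_nonneg.2 hab.le)] at key2
  refine key2.congr fun N => ?_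
  simp only [Function.comp, empMeas, Measure.smul_apply, Measure.finsetSum_apply, Measure.dirac_apply, smul_eq_mul]
  rw [ENNReal.toReal_mul, ENNReal.toReal_sum (by intro i _; classical rw [Set.indicator_apply]; split_ifs <;> simp)]
  rw [ENNReal.toReal_inv, ENNReal.toReal_natCast, div_eq_inv_mul]
  congr 1
  refine Finset.sum_congr rfl fun k _ => ?_
  have := mem_arc ha hb (k * x)
  by_cases h : (((k:ℝ)*x:ℝ):UnitAddCircle) ∈ A
  · rw [Set.indicator_of_mem h, Set.indicator_of_mem (this.1 h)]; simp
  · rw [Set.indicator_of_notMem h, Set.indicator_of_notMem (fun h' => h (this.2 h'))]; simp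

lemma step_avg (u : ℕ → ℝ)
    (hfreq : ∀ a b : ℝ, 0 ≤ a → a < b → b ≤ 1 → Tendsto (fun N : ℕ =>
      (∑ k ∈ Finset.Icc 1 N, (Set.Ioc a b).indicator (fun _ => (1:ℝ)) (u k)) / N)
      atTop (nhds (b - a))) (c : ℕ → ℝ) (M : ℕ) (hM : 0 < M) :
    Tendsto (fun N : ℕ => (∑ k ∈ Finset.Icc 1 N, ∑ j ∈ Finset.range M,
      c j * (Set.Ioc ((j:ℝ)/M) (((j+1:ℕ):ℝ)/M)).indicator (fun _ => (1:ℝ)) (u k)) / N) atTop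
      (nhds (∑ j ∈ Finset.range M, c j / M)) := by
  have hM' : (0:ℝ) < M := by exact_mod_cast hM
  have : Tendsto (fun N : ℕ => ∑ j ∈ Finset.range M, c j * ((∑ k ∈ Finset.Icc 1 N,
      (Set.Ioc ((j:ℝ)/M) (((j+1:ℕ):ℝ)/M)).indicator (fun _ => (1:ℝ)) (u k)) / N)) atTop
      (nhds (∑ j ∈ Finset.range M, c j / M)) := by
    refine tendsto_finsetSum _ fun j hj => ?_
    have hj' : ((j+1:ℕ):ℝ) ≤ M := by exact_mod_cast Finset.mem_range.1 hj
    have := (hfreq ((j:ℝ)/M) (((j+1:ℕ):ℝ)/M) (by positivity)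
      (by gcongr; simp) ((div_le_one hM').2 hj')).const_mul (c j)
    convert this using 2
    push_cast
    field_simp
    ring
  refine this.congr fun N => ?_
  rw [Finset.sum_comm, Finset.sum_div]
  refine Finset.sum_congr rfl fun j _ => ?_
  rw [← Finset.mul_sum, mul_div_assoc]

lemma step_eval (M : ℕ) (hM : 0 < M) (y : ℝ) (hy : y ∈ Set.Ioc (0:ℝ) 1) :
    ∃ j < M, (j:ℝ)/M < y ∧ y ≤ ((j+1:ℕ):ℝ)/M ∧ ∀ c : ℕ → ℝ, ∑ j ∈ Finset.range M,
      c j * (Set.Ioc ((j:ℝ)/M) (((j+1:ℕ):ℝ)/M)).indicator (fun _ => (1:ℝ)) y = c j := by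
  have hM' : (0:ℝ) < M := by exact_mod_cast hM
  have hpos : 0 < ⌈M * y⌉₊ := Nat.ceil_pos.2 (mul_pos hM' hy.1)
  obtain ⟨j, hj⟩ := Nat.exists_eq_add_of_lt hpos
  rw [zero_add] at hj
  have h1 : (j:ℝ) < M * y := Nat.lt_ceil.1 (by omega)
  have h2 : M * y ≤ ((j+1:ℕ):ℝ) := Nat.ceil_le.1 hj.le
  have h3 : M * y ≤ M := by nlinarith [hy.2]
  have hjM : j < M := by exact_mod_cast h1.trans_le h3
  have h4 : (j:ℝ)/M < y := (div_lt_iff₀' hM').2 h1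
  have h5 : y ≤ ((j+1:ℕ):ℝ)/M := (le_div_iff₀' hM').2 h2
  refine ⟨j, hjM, h4, h5, fun c => ?_⟩
  rw [Finset.sum_eq_single_of_mem j (Finset.mem_range.2 hjM)]
  · rw [Set.indicator_of_mem (Set.mem_Ioc.2 ⟨h4, h5⟩), mul_one]
  · intro i _ hij
    rw [Set.indicator_of_notMem, mul_zero]
    rintro ⟨h6, h7⟩
    rw [div_lt_iff₀' hM'] at h6
    rw [le_div_iff₀' hM'] at h7
    have h8 : (i:ℝ) < ((j+1:ℕ):ℝ) := h6.trans_le h2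
    have h9 : (j:ℝ) < ((i+1:ℕ):ℝ) := h1.trans_le h7
    have h8' : i < j + 1 := by exact_mod_cast h8
    have h9' : j < i + 1 := by exact_mod_cast h9
    omega

lemma mono_avg (u : ℕ → ℝ) (hu : ∀ k, u k ∈ Set.Ioc (0:ℝ) 1)
    (hfreq : ∀ a b : ℝ, 0 ≤ a → a < b → b ≤ 1 → Tendsto (fun N : ℕ =>
      (∑ k ∈ Finset.Icc 1 N, (Set.Ioc a b).indicator (fun _ => (1:ℝ)) (u k)) / N)
      atTop (nhds (b - a))) (p : ℝ → ℝ) (hp : MonotoneOn p (Set.Icc 0 1)) :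
    Tendsto (fun N : ℕ => (∑ k ∈ Finset.Icc 1 N, p (u k)) / N) atTop
      (nhds (∫ y in (0:ℝ)..1, p y)) := by
  rw [Metric.tendsto_atTop]
  intro ε hε
  obtain ⟨M, hMgt⟩ := exists_nat_gt ((p 1 - p 0) / (ε / 2) + 1)
  have hp01 : p 0 ≤ p 1 := hp (by simp) (by simp) zero_le_one
  have hM' : (0:ℝ) < M := by
    have : 0 ≤ (p 1 - p 0) / (ε / 2) := div_nonneg (by linarith) (by linarith)
    linarith
  have hM : 0 < M := by exact_mod_cast hM'
  have hmem : ∀ j ≤ M, (j:ℝ)/M ∈ Set.Icc (0:ℝ) 1 := fun j hj =>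
    ⟨by positivity, (div_le_one hM').2 (by exact_mod_cast hj)⟩
  have hle : ∀ j : ℕ, (j:ℝ)/M ≤ ((j+1:ℕ):ℝ)/M := fun j => by gcongr; simp
  have hii : ∀ j < M, IntervalIntegrable p volume ((j:ℝ)/M) (((j+1:ℕ):ℝ)/M) := by
    intro j hj
    apply MonotoneOn.intervalIntegrable
    rw [Set.uIcc_of_le (hle j)]
    exact hp.mono (Set.Icc_subset_Icc (hmem j hj.le).1 (hmem (j+1) hj).2)
  have hsum : ∫ y in (0:ℝ)..1, p y =
      ∑ j ∈ Finset.range M, ∫ y in ((j:ℝ)/M)..(((j+1:ℕ):ℝ)/M), p y := by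
    rw [intervalIntegral.sum_integral_adjacent_intervals (a := fun j : ℕ => (j:ℝ)/M) hii]
    simp [hM'.ne']
  have hconst : ∀ (j : ℕ) (c : ℝ), ∫ _ in ((j:ℝ)/M)..(((j+1:ℕ):ℝ)/M), c = c / M := by
    intro j c
    rw [intervalIntegral.integral_const, smul_eq_mul]
    push_cast
    field_simp
    ring
  have hL : ∑ j ∈ Finset.range M, p ((j:ℝ)/M) / M ≤ ∫ y in (0:ℝ)..1, p y := by
    rw [hsum]
    refine Finset.sum_le_sum fun j hj => ?_
    have hj := Finset.mem_range.1 hj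
    rw [← hconst j]
    refine intervalIntegral.integral_mono_on (hle j) intervalIntegrable_const (hii j hj) fun y hy => ?_
    exact hp (hmem j hj.le) ⟨(hmem j hj.le).1.trans hy.1, hy.2.trans (hmem (j+1) hj).2⟩ hy.1
  have hU : ∫ y in (0:ℝ)..1, p y ≤ ∑ j ∈ Finset.range M, p (((j+1:ℕ):ℝ)/M) / M := by
    rw [hsum]
    refine Finset.sum_le_sum fun j hj => ?_
    have hj := Finset.mem_range.1 hj
    rw [← hconst j (p (((j+1:ℕ):ℝ)/M))]
    refine intervalIntegral.integral_mono_on (hle j) (hii j hj) intervalIntegrable_const fun y hy => ?_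
    exact hp ⟨(hmem j hj.le).1.trans hy.1, hy.2.trans (hmem (j+1) hj).2⟩ (hmem (j+1) hj) hy.2
  have hUL : ∑ j ∈ Finset.range M, p (((j+1:ℕ):ℝ)/M) / M
      - ∑ j ∈ Finset.range M, p ((j:ℝ)/M) / M < ε / 2 := by
    rw [← Finset.sum_sub_distrib, Finset.sum_range_sub (fun j : ℕ => p ((j:ℝ)/M) / M) M,
      ← sub_div, div_self hM'.ne', Nat.cast_zero, zero_div, div_lt_iff₀' hM']
    rw [← div_lt_iff₀ (by linarith)]
    linarith
  have tL := step_avg u hfreq (fun j => p ((j:ℝ)/M)) M hM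
  have tU := step_avg u hfreq (fun j => p (((j+1:ℕ):ℝ)/M)) M hM
  obtain ⟨N1, hN1⟩ := Metric.tendsto_atTop.1 tL (ε/2) (by linarith)
  obtain ⟨N2, hN2⟩ := Metric.tendsto_atTop.1 tU (ε/2) (by linarith)
  refine ⟨max N1 N2, fun N hN => ?_⟩
  have e1 := hN1 N (le_of_max_le_left hN)
  have e2 := hN2 N (le_of_max_le_right hN)
  rw [Real.dist_eq, abs_lt] at e1 e2 ⊢
  have b1 : (∑ k ∈ Finset.Icc 1 N, ∑ j ∈ Finset.range M, p ((j:ℝ)/M) *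
      (Set.Ioc ((j:ℝ)/M) (((j+1:ℕ):ℝ)/M)).indicator (fun _ => (1:ℝ)) (u k)) / N
      ≤ (∑ k ∈ Finset.Icc 1 N, p (u k)) / N := by
    gcongr with k _
    obtain ⟨j, hj, h1, h2, h3⟩ := step_eval M hM (u k) (hu k)
    rw [h3 (fun j => p ((j:ℝ)/M))]
    exact hp (hmem j hj.le) (Set.Ioc_subset_Icc_self (hu k)) h1.le
  have b2 : (∑ k ∈ Finset.Icc 1 N, p (u k)) / N ≤
      (∑ k ∈ Finset.Icc 1 N, ∑ j ∈ Finset.range M, p (((j+1:ℕ):ℝ)/M) *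
      (Set.Ioc ((j:ℝ)/M) (((j+1:ℕ):ℝ)/M)).indicator (fun _ => (1:ℝ)) (u k)) / N := by
    gcongr with k _
    obtain ⟨j, hj, h1, h2, h3⟩ := step_eval M hM (u k) (hu k)
    rw [h3 (fun j => p (((j+1:ℕ):ℝ)/M))]
    exact hp (Set.Ioc_subset_Icc_self (hu k)) (hmem (j+1) hj) h2
  constructor <;> linarith [e1.1, e1.2, e2.1, e2.2]

/-- For any 1-periodic function `h` of bounded variation on `[0,1]` and almost every `x`,
`(1/N) ∑_{k=1}^N h(kx)² → ∫₀¹ h(y)² dy` as `N → ∞`. -/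
theorem average_of_squares_along_multiples
    (h : ℝ → ℝ) (hper : ∀ x : ℝ, h (x + 1) = h x)
    (hbv : BoundedVariationOn h (Set.Icc 0 1)) :
    ∀ᵐ x ∂(volume : Measure ℝ),
      Filter.Tendsto (fun N : ℕ => (∑ k ∈ Finset.Icc 1 N, (h ((k : ℝ) * x)) ^ 2) / N)
        Filter.atTop (nhds (∫ y in (0:ℝ)..1, (h y) ^ 2)) := by
  have hirr : ∀ᵐ x ∂(volume : Measure ℝ), Irrational x := by
    have : (Set.range ((↑) : ℚ → ℝ)).Countable := Set.countable_range _
    exact this.ae_notMem _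
  filter_upwards [hirr] with x hx
  obtain ⟨p, q, hp, hq, hpq⟩ :=
    (hbv.mul hbv).locallyBoundedVariationOn.exists_monotoneOn_sub_monotoneOn
  have hsq : ∀ y, h y ^ 2 = p y - q y := fun y => by
    have := congrFun hpq y
    simp only [Pi.mul_apply, Pi.sub_apply] at this
    rw [← this, sq]
  have hmod : ∀ y, h y = h (toIocMod one_pos 0 y) := fun y => by
    have hP : Function.Periodic h 1 := hper
    rw [← self_sub_toIocDiv_zsmul (one_pos : (0:ℝ) < 1) 0 y]
    exact (hP.sub_zsmul_eq _).symm
  set u : ℕ → ℝ := fun k => toIocMod one_pos 0 ((k:ℝ) * x) with hu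
  have hu' : ∀ k, u k ∈ Set.Ioc (0:ℝ) 1 := fun k => by
    have := toIocMod_mem_Ioc (one_pos : (0:ℝ) < 1) 0 ((k:ℝ) * x)
    rwa [zero_add] at this
  have hfreq : ∀ a b : ℝ, 0 ≤ a → a < b → b ≤ 1 → Tendsto (fun N : ℕ =>
      (∑ k ∈ Finset.Icc 1 N, (Set.Ioc a b).indicator (fun _ => (1:ℝ)) (u k)) / N)
      atTop (nhds (b - a)) := fun a b ha hab hb => arc_freq x hx ha hab hb
  have t := (mono_avg u hu' hfreq p hp).sub (mono_avg u hu' hfreq q hq)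
  have hI : ∀ p : ℝ → ℝ, MonotoneOn p (Set.Icc 0 1) → IntervalIntegrable p volume 0 1 := by
    intro p hp
    apply MonotoneOn.intervalIntegrable
    rwa [Set.uIcc_of_le zero_le_one]
  rw [← intervalIntegral.integral_sub (hI p hp) (hI q hq)] at t
  simp_rw [hsq]
  refine t.congr fun N => ?_
  rw [← sub_div, ← Finset.sum_sub_distrib]
  congr 1
  refine Finset.sum_congr rfl fun k _ => ?_
  rw [← hsq, ← hsq, hmod ((k:ℝ) * x)]
end
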